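/- Let 0 < δ < 1, let λ be a non-zero real number and let ε > 0. There exist C > 0 and X₀ such that for every X ≥ X₀, every Z with X^{1/2 − 1/14 + ε} ≤ Z ≤ X^{1/2}, and every real α with |S̃_2(λα)| > Z, there are coprime integers a and q satisfying 1 ≤ q ≤ (X^{1/2+ε}/Z)⁴ and |qλα − a| ≤ C X^{−1} (X^{1/2+ε}/Z)⁴. -/

import Mathlib

open scoped Classical
open MeasureTheory

noncomputable section

/-- `e x = exp(2πix)` -/
def e (x : ℝ) : ℂ := Complex.exp (2 * Real.pi * Complex.I * x)

/-- The exponential sum `S_k(α)` over primes `p` with `δX ≤ p^k ≤ X`. -/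
def S (k δ X α : ℝ) : ℂ :=
  ∑ p ∈ (Finset.range (⌈X⌉₊ + 1)).filter
      (fun p : ℕ => p.Prime ∧ δ * X ≤ (p : ℝ) ^ k ∧ (p : ℝ) ^ k ≤ X),
    (Real.log p : ℂ) * e ((p : ℝ) ^ k * α)

/-- The exponential sum `U_k(α)` over naturals `n` with `δX ≤ n^k ≤ X`. -/
def U (k δ X α : ℝ) : ℂ :=
  ∑ n ∈ (Finset.range (⌈X⌉₊ + 1)).filter
      (fun n : ℕ => δ * X ≤ (n : ℝ) ^ k ∧ (n : ℝ) ^ k ≤ X),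
    e ((n : ℝ) ^ k * α)

/-- The exponential integral `T_k(α)`. -/
def T (k δ X α : ℝ) : ℂ :=
  ∫ t in (δ * X) ^ (1 / k)..(X ^ (1 / k)), e (α * t ^ k)

/-- Chebyshev theta function. -/
def theta (x : ℝ) : ℝ :=
  ∑ p ∈ (Finset.range (⌊x⌋₊ + 1)).filter Nat.Prime, Real.log p

/-- The generalized Selberg integral `𝒥_k(X,h)`. -/
def selbergJ (k X h : ℝ) : ℝ :=
  ∫ x in X..(2 * X),
    (theta ((x + h) ^ (1 / k)) - theta (x ^ (1 / k)) -
      ((x + h) ^ (1 / k) - x ^ (1 / k))) ^ 2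

/-- `ψ(m,z) = 1` iff every prime factor of `m` is at least `z`. -/
def psi (m : ℕ) (z : ℝ) : ℝ :=
  if ∀ p : ℕ, p.Prime → p ∣ m → z ≤ (p : ℝ) then 1 else 0

/-- The function `z(p)` of Harman–Kumchev. -/
def zfun (X : ℝ) (p : ℕ) : ℝ :=
  if (p : ℝ) < X ^ ((1 : ℝ) / 7) then X ^ ((5 : ℝ) / 28) * (p : ℝ) ^ (-(1 : ℝ) / 2)
  else if (p : ℝ) ≤ X ^ ((3 : ℝ) / 14) then (p : ℝ)
  else X ^ ((5 : ℝ) / 14) * (p : ℝ)⁻¹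

/-- The Harman–Kumchev sieve weight `ρ(m)`. -/
def rho (X : ℝ) (m : ℕ) : ℝ :=
  psi m (X ^ ((5 : ℝ) / 42)) -
    ∑ p ∈ (Finset.range (⌈X ^ ((1 : ℝ) / 4)⌉₊ + 1)).filter
        (fun p : ℕ => p.Prime ∧ X ^ ((5 : ℝ) / 42) ≤ (p : ℝ) ∧ (p : ℝ) < X ^ ((1 : ℝ) / 4) ∧ p ∣ m),
      psi (m / p) (zfun X p)

/-- The sieved exponential sum `S̃_2(α)`. -/
def Stilde (δ X α : ℝ) : ℂ :=
  ∑ m ∈ (Finset.range (⌈X⌉₊ + 1)).filter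
      (fun m : ℕ => δ * X ≤ (m : ℝ) ^ 2 ∧ (m : ℝ) ^ 2 ≤ X),
    (rho X m : ℂ) * e ((m : ℝ) ^ 2 * α)

/-- The Fejér-type kernel `K_η(α)`. -/
def Kf (η α : ℝ) : ℝ :=
  if α = 0 then η ^ 2 else (Real.sin (Real.pi * α * η) / (Real.pi * α)) ^ 2

theorem e_add (x y : ℝ) : e (x + y) = e x * e y := by
  rw [e, e, e, ← Complex.exp_add]
  push_cast
  ring_nf

theorem e_neg (x : ℝ) : e (-x) = (starRingEnd ℂ) (e x) := by
  rw [e, e, ← Complex.exp_conj]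
  simp [map_ofNat (starRingEnd ℂ)]

theorem e_zero : e 0 = 1 := by simp [e]

@[simp]
theorem norm_e (x : ℝ) : ‖e x‖ = 1 := by
  have h : (2 * Real.pi * Complex.I * x : ℂ) = ((2 * Real.pi * x : ℝ) : ℂ) * Complex.I := by
    push_cast; ring
  rw [e, h, Complex.norm_exp_ofReal_mul_I]

theorem e_sub (x y : ℝ) : e (x - y) = e x * (starRingEnd ℂ) (e y) := by
  rw [sub_eq_add_neg, e_add, e_neg]

theorem e_int (n : ℤ) : e n = 1 := by
  rw [e, Complex.exp_eq_one_iff]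
  exact ⟨n, by push_cast; ring⟩

/-- The distance from a real number to the nearest integer. -/
def distInt (x : ℝ) : ℝ := ‖(x : UnitAddCircle)‖

theorem distInt_eq (x : ℝ) : distInt x = |x - round x| := UnitAddCircle.norm_eq

theorem distInt_nonneg (x : ℝ) : 0 ≤ distInt x := norm_nonneg _

theorem distInt_neg (x : ℝ) : distInt (-x) = distInt x := by
  simp [distInt]

theorem distInt_sub_le (x y : ℝ) : distInt (x - y) ≤ distInt x + distInt y := by
  simpa [distInt] using norm_sub_le (x : UnitAddCircle) (y : UnitAddCircle)

theorem distInt_le_abs_sub (x : ℝ) (n : ℤ) : distInt x ≤ |x - n| := by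
  rw [distInt_eq]
  exact round_le x n

theorem distInt_le_half (x : ℝ) : distInt x ≤ 1 / 2 := by
  rw [distInt_eq]
  exact abs_sub_round x

theorem four_mul_distInt_le (x : ℝ) : 4 * distInt x ≤ ‖e x - 1‖ := by
  have hx : e x = e (x - round x) := by
    rw [e_sub, e_int]; simp
  have h2 : e (x - round x) = Complex.exp (Complex.I * ((2 * Real.pi * (x - round x) : ℝ) : ℂ)) := by
    rw [e]; push_cast; ring_nf
  rw [hx, h2, Complex.norm_exp_I_mul_ofReal_sub_one, distInt_eq]
  have h3 : |Real.pi * (x - round x)| ≤ Real.pi / 2 := by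
    rw [abs_mul, abs_of_pos Real.pi_pos]
    have := abs_sub_round x
    nlinarith [Real.pi_pos]
  have h4 := Real.mul_abs_le_abs_sin h3
  rw [abs_mul, abs_of_pos Real.pi_pos] at h4
  have h5 : 2 / Real.pi * (Real.pi * |x - round x|) = 2 * |x - round x| := by
    field_simp
  rw [h5] at h4
  rw [norm_mul, Real.norm_eq_abs, Real.norm_eq_abs,
    show 2 * Real.pi * (x - round x) / 2 = Real.pi * (x - round x) by ring]
  norm_num
  linarith

/-- A majorant for geometric sums of length at most `Y` with ratio `e x`. -/
def geomBound (Y x : ℝ) : ℝ := 2 * Y / (1 + Y * distInt x)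

theorem geomBound_nonneg {Y : ℝ} (hY : 0 ≤ Y) (x : ℝ) : 0 ≤ geomBound Y x := by
  have := distInt_nonneg x
  unfold geomBound
  positivity

theorem norm_sum_e_Icc_le {Y : ℝ} (hY : 0 ≤ Y) {a b : ℕ} (hab : ((b + 1 - a : ℕ) : ℝ) ≤ Y)
    (x c : ℝ) : ‖∑ n ∈ Finset.Icc a b, e (n * x + c)‖ ≤ geomBound Y x := by
  have hd := distInt_nonneg x
  have h1 : ‖∑ n ∈ Finset.Icc a b, e (n * x + c)‖ ≤ Y := by
    refine (norm_sum_le _ _).trans ?_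
    simpa using hab
  have h2 : ‖∑ n ∈ Finset.Icc a b, e (n * x + c)‖ * ‖e x - 1‖ ≤ 2 := by
    rcases lt_or_ge b a with h | h
    · rw [Finset.Icc_eq_empty (by omega)]; simp
    rw [← norm_mul, Finset.sum_mul]
    have : ∀ n ∈ Finset.Icc a b, e (n * x + c) * (e x - 1)
        = e (((n + 1 : ℕ) : ℝ) * x + c) - e (n * x + c) := by
      intro n _
      rw [mul_sub, ← e_add, mul_one]
      push_cast
      ring_nf
    rw [Finset.sum_congr rfl this, ← Finset.Ico_add_one_right_eq_Icc,
      Finset.sum_Ico_sub (fun n : ℕ => e ((n : ℝ) * x + c)) (by omega)]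
    refine (norm_sub_le _ _).trans ?_
    simp only [norm_e]
    norm_num
  have h3 := four_mul_distInt_le x
  set s := ‖∑ n ∈ Finset.Icc a b, e (n * x + c)‖ with hs
  have hs0 : 0 ≤ s := norm_nonneg _
  have h4 : s * distInt x ≤ 1 / 2 := by nlinarith
  rw [geomBound, le_div_iff₀ (by positivity)]
  nlinarith

/-- Weyl differencing for quadratic sums over an interval. -/
theorem norm_sq_sum_e_sq_le {Y : ℝ} {a b : ℕ} (ha : 1 ≤ a) (hb : (b : ℝ) ≤ Y) (β : ℝ) :
    ‖∑ n ∈ Finset.Icc a b, e ((n : ℝ) ^ 2 * β)‖ ^ 2 ≤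
      Y + 2 * ∑ j ∈ Finset.Icc 1 ⌊Y⌋₊, geomBound Y (j * (2 * β)) := by
  have hY : 0 ≤ Y := le_trans (Nat.cast_nonneg _) hb
  set I := Finset.Icc a b
  set f : ℕ → ℂ := fun n => e ((n : ℝ) ^ 2 * β)
  set R := ∑ j ∈ Finset.Icc 1 ⌊Y⌋₊, geomBound Y (j * (2 * β)) with hR
  set lowSum := ∑ p ∈ (I ×ˢ I).filter (fun p => p.2 < p.1), f p.1 * (starRingEnd ℂ) (f p.2)
    with hlow
  have hsplit : (∑ n ∈ I, f n) * (starRingEnd ℂ) (∑ n ∈ I, f n) =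
      (I.card : ℂ) + (lowSum + (starRingEnd ℂ) lowSum) := by
    rw [map_sum, Finset.sum_mul_sum, ← Finset.sum_product',
      ← Finset.sum_filter_add_sum_filter_not (I ×ˢ I) (fun p => p.2 < p.1),
      ← Finset.sum_filter_add_sum_filter_not ((I ×ˢ I).filter (fun p => ¬ p.2 < p.1))
        (fun p => p.1 < p.2)]
    have h1 : ∑ p ∈ ((I ×ˢ I).filter (fun p => ¬ p.2 < p.1)).filter (fun p => p.1 < p.2),
        f p.1 * (starRingEnd ℂ) (f p.2) = (starRingEnd ℂ) lowSum := by
      rw [hlow, map_sum]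
      refine Finset.sum_nbij' (fun p => (p.2, p.1)) (fun p => (p.2, p.1)) ?_ ?_ ?_ ?_ ?_
      · simp only [Finset.mem_filter, Finset.mem_product]
        rintro p ⟨⟨⟨h1, h2⟩, h3⟩, h4⟩
        exact ⟨⟨h2, h1⟩, h4⟩
      · simp only [Finset.mem_filter, Finset.mem_product]
        rintro p ⟨⟨h1, h2⟩, h3⟩
        exact ⟨⟨⟨h2, h1⟩, by omega⟩, h3⟩
      · intros; rfl
      · intros; rfl
      · intro p _
        simp [mul_comm]
    have h2 : ∑ p ∈ ((I ×ˢ I).filter (fun p => ¬ p.2 < p.1)).filter (fun p => ¬ p.1 < p.2),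
        f p.1 * (starRingEnd ℂ) (f p.2) = (I.card : ℂ) := by
      rw [Finset.card_eq_sum_ones]
      push_cast
      refine Finset.sum_nbij' (fun p => p.1) (fun n => (n, n)) ?_ ?_ ?_ ?_ ?_
      · simp only [Finset.mem_filter, Finset.mem_product]
        rintro p ⟨⟨⟨h1, h2⟩, h3⟩, h4⟩
        exact h1
      · simp only [Finset.mem_filter, Finset.mem_product]
        intro n hn
        exact ⟨⟨⟨hn, hn⟩, by simp⟩, by simp⟩
      · simp only [Finset.mem_filter, Finset.mem_product]
        rintro p ⟨⟨⟨h1, h2⟩, h3⟩, h4⟩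
        ext <;> simp
        omega
      · intros; rfl
      · simp only [Finset.mem_filter, Finset.mem_product]
        rintro p ⟨⟨⟨h1, h2⟩, h3⟩, h4⟩
        have : p.1 = p.2 := by omega
        rw [this]
        simp only [f]
        rw [← e_sub, sub_self, e_zero]
    rw [h1, h2]
    ring
  have hlowle : ‖lowSum‖ ≤ R := by
    have h1 : lowSum = ∑ j ∈ Finset.Icc 1 ⌊Y⌋₊, ∑ n ∈ Finset.Icc a (b - j),
        e (n * (j * (2 * β)) + (j : ℝ) ^ 2 * β) := by
      rw [hlow, Finset.sum_sigma']
      refine Finset.sum_nbij' (fun p => ⟨p.1 - p.2, p.2⟩) (fun p => (p.1 + p.2, p.2)) ?_ ?_ ?_ ?_ ?_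
      · simp only [Finset.mem_filter, Finset.mem_product, Finset.mem_sigma, Finset.mem_Icc, I]
        rintro p ⟨⟨⟨h1, h2⟩, h3, h4⟩, h5⟩
        refine ⟨⟨by omega, Nat.le_floor ?_⟩, h3, by omega⟩
        refine le_trans ?_ hb
        exact_mod_cast (by omega : p.1 - p.2 ≤ b)
      · simp only [Finset.mem_filter, Finset.mem_product, Finset.mem_sigma, Finset.mem_Icc, I]
        rintro p ⟨⟨h1, h2⟩, h3, h4⟩
        omega
      · simp only [Finset.mem_filter]
        rintro p ⟨_, h⟩
        ext <;> simp
        omega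
      · rintro p _
        simp
      · simp only [Finset.mem_filter]
        rintro p ⟨_, h⟩
        simp only [f]
        rw [← e_sub, Nat.cast_sub h.le]
        ring_nf
    rw [h1]
    refine (norm_sum_le _ _).trans (Finset.sum_le_sum fun j hj => ?_)
    refine norm_sum_e_Icc_le hY (le_trans ?_ hb) _ _
    exact_mod_cast (by omega : b - j + 1 - a ≤ b)
  have hcard : (I.card : ℝ) ≤ Y := by
    refine le_trans ?_ hb
    simp only [I, Nat.card_Icc]
    exact_mod_cast (by omega : b + 1 - a ≤ b)
  have h5 : ((‖∑ n ∈ I, f n‖ ^ 2 : ℝ) : ℂ) = (I.card : ℂ) + (lowSum + (starRingEnd ℂ) lowSum) := by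
    rw [← hsplit, Complex.mul_conj, Complex.normSq_eq_norm_sq]
  have h6 : ‖((‖∑ n ∈ I, f n‖ ^ 2 : ℝ) : ℂ)‖ ≤ Y + 2 * R := by
    rw [h5]
    refine (norm_add_le _ _).trans (add_le_add (by simpa using hcard) ?_)
    refine (norm_add_le _ _).trans ?_
    rw [RCLike.norm_conj]
    linarith
  rwa [Complex.norm_real, Real.norm_of_nonneg (by positivity)] at h6

/-- `q` is the denominator of a rational approximation to `α` of Dirichlet quality. -/
def IsApproxDenom (α : ℝ) (q : ℕ) : Prop :=
  0 < q ∧ ∃ a : ℤ, IsCoprime a (q : ℤ) ∧ |q * α - a| ≤ 1 / q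

theorem IsApproxDenom.separation {α : ℝ} {q : ℕ} (h : IsApproxDenom α q) {j : ℕ}
    (hj : 1 ≤ j) (hjq : 2 * j ≤ q) : 1 / (2 * q) ≤ distInt (j * α) := by
  obtain ⟨hq, a, hcop, ha⟩ := h
  have hq' : (0 : ℝ) < q := by exact_mod_cast hq
  rw [distInt_eq]
  set n := round ((j : ℝ) * α)
  have hne : (j : ℤ) * a - n * q ≠ 0 := by
    intro h0
    have hdvd : (q : ℤ) ∣ j * a := ⟨n, by linarith⟩
    have : (q : ℤ) ∣ j := hcop.symm.dvd_of_dvd_mul_right hdvd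
    have := Nat.le_of_dvd (by omega) (Int.natCast_dvd_natCast.mp this)
    omega
  have h1 : (1 : ℝ) ≤ |(j : ℝ) * a - n * q| := by
    exact_mod_cast Int.one_le_abs hne
  have h2 : (j : ℝ) * a - n * q = q * (j * α - n) - j * (q * α - a) := by ring
  have h3 : |(j : ℝ) * (q * α - a)| ≤ 1 / 2 := by
    rw [abs_mul, Nat.abs_cast]
    have hjq' : 2 * (j : ℝ) ≤ q := by exact_mod_cast hjq
    calc (j : ℝ) * |q * α - a| ≤ j * (1 / q) := by gcongr
      _ ≤ 1 / 2 := by rw [mul_one_div, div_le_div_iff₀ hq' (by norm_num)]; linarith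
  have h4 : 1 ≤ q * |(j : ℝ) * α - n| + 1 / 2 := by
    calc (1 : ℝ) ≤ |q * (j * α - n) - j * (q * α - a)| := by rw [← h2]; exact h1
      _ ≤ |q * (j * α - n)| + |(j : ℝ) * (q * α - a)| := abs_sub _ _
      _ ≤ _ := by rw [abs_mul, Nat.abs_cast]; linarith
  rw [div_le_iff₀ (by positivity)]
  linarith

/-- Multiples of `α` are well spaced, so few of them lie close to an integer. -/
theorem IsApproxDenom.card_le {α : ℝ} {q : ℕ} (h : IsApproxDenom α q) (K : ℕ) {η : ℝ}
    (hη : 0 ≤ η) :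
    (((Finset.Icc 1 K).filter (fun k : ℕ => distInt (k * α) ≤ η)).card : ℝ) ≤
      (2 * K / q + 1) * (4 * q * η + 2) := by
  have hq : 0 < q := h.1
  have hq' : (0 : ℝ) < q := by exact_mod_cast hq
  set b := (q + 1) / 2 with hb
  have hb0 : 0 < b := by omega
  set x : ℕ → ℝ := fun k => k * α - round ((k : ℝ) * α) with hx
  set B : ℤ := ⌊2 * q * η⌋ with hB
  have hB0 : 0 ≤ B := Int.floor_nonneg.mpr (by positivity)
  set t : Finset (ℕ × ℤ) := Finset.range (K / b + 1) ×ˢ Finset.Icc (-(B + 1)) B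
  have hcard : ((Finset.Icc 1 K).filter (fun k : ℕ => distInt (k * α) ≤ η)).card ≤ t.card := by
    refine Finset.card_le_card_of_injOn (fun k => (k / b, ⌊2 * q * x k⌋)) ?_ ?_
    · intro k hk
      simp only [Finset.coe_filter, Finset.mem_Icc, Set.mem_ofPred_eq] at hk
      obtain ⟨⟨_, hk1⟩, hk2⟩ := hk
      rw [distInt_eq] at hk2
      have hk3 := abs_le.mp hk2
      simp only [t, Finset.coe_product, Set.mem_prod, Finset.mem_coe, Finset.mem_range,
        Finset.mem_Icc]
      refine ⟨Nat.lt_succ_of_le (Nat.div_le_div_right hk1), ?_, ?_⟩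
      · rw [Int.le_floor]
        have := Int.lt_floor_add_one (2 * q * η)
        push_cast
        have h4 : 2 * q * (-η) ≤ 2 * q * x k := by
          apply mul_le_mul_of_nonneg_left hk3.1 (by positivity)
        rw [← hB] at this
        linarith
      · apply Int.floor_le_floor
        apply mul_le_mul_of_nonneg_left hk3.2 (by positivity)
    · have key : ∀ k k' : ℕ, k < k' → k / b = k' / b → ⌊2 * q * x k⌋ ≠ ⌊2 * q * x k'⌋ := by
        intro k k' hlt h1 h2
        have hd : k' - k < b := by
          have e1 := Nat.div_add_mod k b
          have e2 := Nat.div_add_mod k' b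
          have e3 := Nat.mod_lt k' hb0
          rw [h1] at e1
          omega
        have hs := h.separation (j := k' - k) (by omega) (by omega)
        rw [Nat.cast_sub hlt.le] at hs
        have h3 := distInt_le_abs_sub (((k' : ℝ) - k) * α)
          (round ((k' : ℝ) * α) - round ((k : ℝ) * α))
        have h4 : ((k' : ℝ) - k) * α - ((round ((k' : ℝ) * α) - round ((k : ℝ) * α) : ℤ) : ℝ)
            = x k' - x k := by simp only [hx]; push_cast; ring
        rw [h4] at h3
        have h5 := Int.abs_sub_lt_one_of_floor_eq_floor h2
        have h6 : 2 * q * x k - 2 * q * x k' = -(2 * q * (x k' - x k)) := by ring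
        rw [h6, abs_neg, abs_mul, abs_of_pos (by positivity : (0 : ℝ) < 2 * q)] at h5
        have h7 : 1 ≤ 2 * q * |x k' - x k| := by
          have := hs.trans h3
          rw [div_le_iff₀ (by positivity)] at this
          linarith
        linarith
      intro k _ k' _ hkk
      simp only [Prod.mk.injEq] at hkk
      by_contra hne
      rcases lt_or_gt_of_ne hne with hlt | hlt
      · exact key k k' hlt hkk.1 hkk.2
      · exact key k' k hlt hkk.1.symm hkk.2.symm
  have h1 : (t.card : ℝ) = ((K / b : ℕ) + 1) * (2 * B + 2) := by
    simp only [t, Finset.card_product, Finset.card_range, Int.card_Icc]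
    rw [show B + 1 - -(B + 1) = 2 * B + 2 by ring]
    push_cast
    congr 1
    have : ((2 * B + 2).toNat : ℤ) = 2 * B + 2 := Int.toNat_of_nonneg (by omega)
    exact_mod_cast this
  have h2 : ((K / b : ℕ) : ℝ) ≤ 2 * K / q := by
    have hbq : (q : ℝ) ≤ 2 * b := by exact_mod_cast (by omega : q ≤ 2 * b)
    have hb0' : (0 : ℝ) < b := by exact_mod_cast hb0
    refine Nat.cast_div_le.trans ?_
    rw [div_le_div_iff₀ hb0' hq']
    have : (0 : ℝ) ≤ K := Nat.cast_nonneg _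
    nlinarith
  have h3 : (B : ℝ) ≤ 2 * q * η := Int.floor_le _
  have hB0' : (0 : ℝ) ≤ B := by exact_mod_cast hB0
  calc (((Finset.Icc 1 K).filter (fun k : ℕ => distInt (k * α) ≤ η)).card : ℝ) ≤ t.card := by
        exact_mod_cast hcard
    _ = ((K / b : ℕ) + 1) * (2 * B + 2) := h1
    _ ≤ (2 * K / q + 1) * (4 * q * η + 2) := by
        apply mul_le_mul <;> first | positivity | linarith

theorem geomBound_le_sum {Y : ℝ} (hY : 0 < Y) {I : ℕ} (hI : Y ≤ 2 ^ I) (x : ℝ) :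
    geomBound Y x ≤ ∑ i ∈ Finset.range (I + 1),
      4 * Y / 2 ^ i * (if distInt x ≤ 2 ^ i / Y then 1 else 0) := by
  have hd := distInt_nonneg x
  have hex : ∃ i, distInt x ≤ 2 ^ i / Y := ⟨I, by
    have := distInt_le_half x
    have : (1 : ℝ) ≤ 2 ^ I / Y := by rwa [le_div_iff₀ hY, one_mul]
    linarith⟩
  have hI' : Nat.find hex ≤ I := Nat.find_min' hex (by
    have := distInt_le_half x
    have : (1 : ℝ) ≤ 2 ^ I / Y := by rwa [le_div_iff₀ hY, one_mul]
    linarith)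
  set i := Nat.find hex with hi
  have h1 : 4 * Y / 2 ^ i * (if distInt x ≤ 2 ^ i / Y then 1 else 0) ≤
      ∑ i ∈ Finset.range (I + 1), 4 * Y / 2 ^ i * (if distInt x ≤ 2 ^ i / Y then 1 else 0) := by
    apply Finset.single_le_sum (f := fun i : ℕ =>
      4 * Y / 2 ^ i * (if distInt x ≤ 2 ^ i / Y then (1 : ℝ) else 0))
    · intro i _
      positivity
    · simp only [Finset.mem_range]; omega
  refine le_trans ?_ h1
  rw [if_pos (Nat.find_spec hex), mul_one, geomBound]
  rcases Nat.eq_zero_or_pos i with h0 | h0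
  · rw [h0, pow_zero, div_one, div_le_iff₀ (by positivity)]
    nlinarith [mul_nonneg hY.le hd]
  · have h2 := Nat.find_min hex (m := i - 1) (by omega)
    rw [not_le, div_lt_iff₀ hY] at h2
    have h3 : (2 : ℝ) ^ i = 2 * 2 ^ (i - 1) := by
      rw [← pow_succ']; congr 1; omega
    rw [h3, div_le_div_iff₀ (by positivity) (by positivity)]
    nlinarith [mul_pos hY hY, mul_nonneg hY.le hd]

theorem IsApproxDenom.sum_geomBound_le {α : ℝ} {q : ℕ} (h : IsApproxDenom α q) (K : ℕ)
    {Y : ℝ} (hY : 0 < Y) {I : ℕ} (hI : Y ≤ 2 ^ I) :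
    ∑ k ∈ Finset.Icc 1 K, geomBound Y (k * α) ≤
      (2 * K / q + 1) * (16 * q * (I + 1) + 16 * Y) := by
  have hq' : (0 : ℝ) < q := by exact_mod_cast h.1
  calc ∑ k ∈ Finset.Icc 1 K, geomBound Y (k * α)
      ≤ ∑ k ∈ Finset.Icc 1 K, ∑ i ∈ Finset.range (I + 1),
      4 * Y / 2 ^ i * (if distInt (k * α) ≤ 2 ^ i / Y then 1 else 0) :=
        Finset.sum_le_sum fun k _ => geomBound_le_sum hY hI _
    _ = ∑ i ∈ Finset.range (I + 1), 4 * Y / 2 ^ i *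
        (((Finset.Icc 1 K).filter (fun k : ℕ => distInt (k * α) ≤ 2 ^ i / Y)).card : ℝ) := by
        rw [Finset.sum_comm]
        refine Finset.sum_congr rfl fun i _ => ?_
        rw [← Finset.mul_sum, Finset.sum_boole]
    _ ≤ ∑ i ∈ Finset.range (I + 1), 4 * Y / 2 ^ i *
        ((2 * K / q + 1) * (4 * q * (2 ^ i / Y) + 2)) := by
        refine Finset.sum_le_sum fun i _ => ?_
        exact mul_le_mul_of_nonneg_left (h.card_le K (by positivity)) (by positivity)
    _ = (2 * K / q + 1) * (16 * q * (I + 1) + 8 * Y * ∑ i ∈ Finset.range (I + 1), (1 / 2) ^ i) := by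
        rw [Finset.mul_sum, mul_add, Finset.mul_sum]
        have : (2 * K / q + 1) * (16 * q * (I + 1)) =
          ∑ i ∈ Finset.range (I + 1), (2 * K / q + 1) * (16 * (q : ℝ)) := by
          rw [Finset.sum_const, Finset.card_range, nsmul_eq_mul]; push_cast; ring
        rw [this, ← Finset.sum_add_distrib]
        refine Finset.sum_congr rfl fun i _ => ?_
        rw [one_div, inv_pow]
        field_simp
        ring
    _ ≤ _ := by
        have hs : ∑ i ∈ Finset.range (I + 1), (1 / 2 : ℝ) ^ i ≤ 2 := sum_geometric_two_le _
        have : 8 * Y * ∑ i ∈ Finset.range (I + 1), (1 / 2 : ℝ) ^ i ≤ 16 * Y := by nlinarith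
        gcongr

theorem sum_comp_le_mul_sum {ι : Type*} (E : Finset ι) (k : ι → ℕ) (K : ℕ) (f : ℕ → ℝ)
    (hf : ∀ n, 0 ≤ f n) (hk : ∀ i ∈ E, k i ∈ Finset.Icc 1 K) (m : ℝ)
    (hm : ∀ n ∈ Finset.Icc 1 K, ((E.filter (fun i => k i = n)).card : ℝ) ≤ m) :
    ∑ i ∈ E, f (k i) ≤ m * ∑ n ∈ Finset.Icc 1 K, f n := by
  rw [← Finset.sum_fiberwise_of_maps_to hk, Finset.mul_sum]
  refine Finset.sum_le_sum fun n hn => ?_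
  rw [Finset.sum_congr rfl (g := fun _ => f n), Finset.sum_const, nsmul_eq_mul]
  · exact mul_le_mul_of_nonneg_right (hm n hn) (hf n)
  · intro i hi
    rw [(Finset.mem_filter.mp hi).2]

theorem exists_eq_Icc_of_convex (s : Finset ℕ) (V : ℕ) (hs : s ⊆ Finset.Icc 1 V)
    (hc : ∀ x ∈ s, ∀ z ∈ s, ∀ y, x ≤ y → y ≤ z → y ∈ s) :
    ∃ a b, 1 ≤ a ∧ b ≤ V ∧ s = Finset.Icc a b := by
  rcases s.eq_empty_or_nonempty with rfl | hne
  · exact ⟨1, 0, le_rfl, Nat.zero_le _, by simp⟩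
  · refine ⟨s.min' hne, s.max' hne, (Finset.mem_Icc.mp (hs (s.min'_mem hne))).1,
      (Finset.mem_Icc.mp (hs (s.max'_mem hne))).2, ?_⟩
    ext y
    rw [Finset.mem_Icc]
    exact ⟨fun hy => ⟨s.min'_le y hy, s.le_max' y hy⟩,
      fun hy => hc _ (s.min'_mem hne) _ (s.max'_mem hne) _ hy.1 hy.2⟩

theorem norm_sq_sum_e_sq_le_of_convex {Y : ℝ} (hY : 0 ≤ Y) (s : Finset ℕ)
    (hs : s ⊆ Finset.Icc 1 ⌊Y⌋₊)
    (hc : ∀ x ∈ s, ∀ z ∈ s, ∀ y, x ≤ y → y ≤ z → y ∈ s) (β : ℝ) :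
    ‖∑ n ∈ s, e ((n : ℝ) ^ 2 * β)‖ ^ 2 ≤
      Y + 2 * ∑ j ∈ Finset.Icc 1 ⌊Y⌋₊, geomBound Y (j * (2 * β)) := by
  obtain ⟨a, b, ha, hb, rfl⟩ := exists_eq_Icc_of_convex s _ hs hc
  exact norm_sq_sum_e_sq_le ha ((Nat.cast_le.mpr hb).trans (Nat.floor_le hY)) β

theorem norm_sum_e_le_of_subset {Y : ℝ} (hY : 0 ≤ Y) (s : Finset ℕ)
    (hs : s ⊆ Finset.Icc 1 ⌊Y⌋₊) (f : ℕ → ℝ) : ‖∑ n ∈ s, e (f n)‖ ≤ Y := by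
  refine (norm_sum_le _ _).trans ?_
  simp only [norm_e, Finset.sum_const, nsmul_eq_mul, mul_one]
  refine le_trans ?_ (Nat.floor_le hY)
  exact_mod_cast (Finset.card_le_card hs).trans (by simp)

/-- The frequency `2 j |u² - v²|` produced by differencing twice. -/
def pairFreq (u v j : ℕ) : ℕ := 2 * j * ((u : ℤ) ^ 2 - (v : ℤ) ^ 2).natAbs

theorem distInt_pairFreq (u v j : ℕ) (α : ℝ) :
    distInt (j * (2 * (((u : ℝ) ^ 2 - (v : ℝ) ^ 2) * α))) = distInt (pairFreq u v j * α) := by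
  have h : ((pairFreq u v j : ℕ) : ℝ) = 2 * j * |(u : ℝ) ^ 2 - (v : ℝ) ^ 2| := by
    rw [pairFreq]
    push_cast [Nat.cast_natAbs]
    rfl
  rw [h]
  rcases abs_choice ((u : ℝ) ^ 2 - (v : ℝ) ^ 2) with h1 | h1
  · rw [h1]; congr 1; ring
  · rw [h1, ← distInt_neg]; congr 1; ring

theorem geomBound_pairFreq (Y : ℝ) (u v j : ℕ) (α : ℝ) :
    geomBound Y (j * (2 * (((u : ℝ) ^ 2 - (v : ℝ) ^ 2) * α))) =
      geomBound Y (pairFreq u v j * α) := by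
  rw [geomBound, geomBound, distInt_pairFreq]

theorem pairFreq_eq (u v j : ℕ) :
    pairFreq u v j = 2 * j * ((u + v) * ((u : ℤ) - v).natAbs) := by
  rw [pairFreq, sq_sub_sq, Int.natAbs_mul]
  norm_cast

theorem pairFreq_pos {u v j : ℕ} (huv : u ≠ v) (hj : 1 ≤ j) : 1 ≤ pairFreq u v j := by
  rw [pairFreq_eq]
  have : 0 < ((u : ℤ) - v).natAbs := by omega
  have : 0 < u + v := by omega
  have : 0 < 2 * j * ((u + v) * ((u : ℤ) - v).natAbs) := by positivity
  exact this

theorem pairFreq_le {u v j U : ℕ} (hu : u ∈ Finset.Ico U (2 * U)) (hv : v ∈ Finset.Ico U (2 * U)) :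
    pairFreq u v j ≤ 8 * U ^ 2 * j := by
  rw [Finset.mem_Ico] at hu hv
  rw [pairFreq_eq]
  have h1 : u + v ≤ 4 * U := by omega
  have h2 : ((u : ℤ) - v).natAbs ≤ U := by omega
  calc 2 * j * ((u + v) * ((u : ℤ) - v).natAbs) ≤ 2 * j * ((4 * U) * U) := by gcongr
    _ = _ := by ring

theorem card_pairFreq_fiber_le (E : Finset (ℕ × ℕ × ℕ))
    (hE : ∀ x ∈ E, x.1 ≠ x.2.1 ∧ 1 ≤ x.2.2) (n : ℕ) (hn : 1 ≤ n) :
    (E.filter (fun x => pairFreq x.1 x.2.1 x.2.2 = n)).card ≤ 2 * n.divisors.card ^ 2 := by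
  have : ((n.divisors ×ˢ n.divisors) ×ˢ (Finset.univ : Finset Bool)).card =
      2 * n.divisors.card ^ 2 := by
    simp [Finset.card_product]; ring
  rw [← this]
  refine Finset.card_le_card_of_injOn
    (fun x => ((x.1 + x.2.1, ((x.1 : ℤ) - x.2.1).natAbs), decide (x.1 < x.2.1))) ?_ ?_
  · intro x hx
    simp only [Finset.coe_filter, Set.mem_ofPred_eq] at hx
    rw [pairFreq_eq] at hx
    simp only [Finset.coe_product, Set.mem_prod, Finset.mem_coe, Nat.mem_divisors,
      Finset.mem_univ, and_true]
    refine ⟨⟨?_, by omega⟩, ?_, by omega⟩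
    · exact ⟨2 * x.2.2 * ((x.1 : ℤ) - x.2.1).natAbs, by rw [← hx.2]; ring⟩
    · exact ⟨2 * x.2.2 * (x.1 + x.2.1), by rw [← hx.2]; ring⟩
  · rintro ⟨u, v, j⟩ hx ⟨u', v', j'⟩ hx' h
    simp only [Finset.coe_filter, Set.mem_ofPred_eq] at hx hx'
    simp only [Prod.mk.injEq, decide_eq_decide] at h
    obtain ⟨⟨h1, h2⟩, h3⟩ := h
    have hne := (hE _ hx.1).1
    have hne' := (hE _ hx'.1).1
    simp only at hne hne'
    have hu : u = u' ∧ v = v' := by omega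
    obtain ⟨rfl, rfl⟩ := hu
    have h4 := hx.2.trans hx'.2.symm
    rw [pairFreq_eq, pairFreq_eq] at h4
    have h5 : 0 < ((u : ℤ) - v).natAbs := by omega
    have h6 : 0 < u + v := by omega
    have h7 := Nat.eq_of_mul_eq_mul_right (by positivity) h4
    have : j = j' := by omega
    rw [this]

/-- The common setting of the mean value estimates: `N` is the length of the sums, `P` the saving,
`D` bounds divisor functions and logarithms, and `α` has a denominator `q` in the minor arc range. -/
structure MinorArc (N P D α : ℝ) (q : ℕ) : Prop where
  one_le_P : 1 ≤ P
  P_pow_le : P ^ 7 ≤ N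
  divisors_le : ∀ k : ℕ, 1 ≤ k → (k : ℝ) ≤ 16 * N ^ 2 → (k.divisors.card : ℝ) ≤ D
  log_le : ∃ I : ℕ, N ≤ 2 ^ I ∧ (I : ℝ) + 2 ≤ D
  approx : IsApproxDenom α q
  le_q : P ^ 4 ≤ q
  q_le : q * P ^ 4 ≤ N ^ 2

namespace MinorArc
variable {N P D α : ℝ} {q : ℕ}

theorem P_pos (h : MinorArc N P D α q) : 0 < P := by linarith [h.one_le_P]

theorem one_le_N (h : MinorArc N P D α q) : 1 ≤ N :=
  (one_le_pow₀ h.one_le_P).trans h.P_pow_le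

theorem N_pos (h : MinorArc N P D α q) : 0 < N := by linarith [h.one_le_N]

theorem two_le_D (h : MinorArc N P D α q) : 2 ≤ D := by
  obtain ⟨I, _, h2⟩ := h.log_le
  have : (0 : ℝ) ≤ I := Nat.cast_nonneg _
  linarith

theorem q_pos (h : MinorArc N P D α q) : (0 : ℝ) < q := by exact_mod_cast h.approx.1

theorem sum_geomBound_le (h : MinorArc N P D α q) {K : ℕ} {X Y : ℝ} (hK : (K : ℝ) ≤ 8 * X)
    (hX : 1 ≤ X) (hY : 0 < Y) (hYN : Y ≤ N) :
    ∑ k ∈ Finset.Icc 1 K, geomBound Y (k * α) ≤ 256 * D * (X * Y / q + X + Y + q) := by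
  obtain ⟨I, hI, hID⟩ := h.log_le
  have hq := h.q_pos
  have hD := h.two_le_D
  refine (h.approx.sum_geomBound_le K hY (hYN.trans hI)).trans ?_
  have hX0 : 0 ≤ X := by linarith
  calc (2 * K / q + 1) * (16 * q * ((I : ℝ) + 1) + 16 * Y)
      ≤ (2 * (8 * X) / q + 1) * (16 * q * D + 16 * Y * D) := by
        have h1 : (I : ℝ) + 1 ≤ D := by linarith
        have h2 : 16 * Y ≤ 16 * Y * D := by nlinarith
        gcongr
    _ = 256 * D * (X * Y / q + X) + 16 * D * (Y + q) := by field_simp; ring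
    _ ≤ 256 * D * (X * Y / q + X) + 256 * D * (Y + q) := by gcongr; norm_num
    _ = _ := by ring

theorem card_le (h : MinorArc N P D α q) {K : ℕ} {X η : ℝ} (hK : (K : ℝ) ≤ 8 * X)
    (hη : 0 ≤ η) :
    (((Finset.Icc 1 K).filter (fun k : ℕ => distInt (k * α) ≤ η)).card : ℝ) ≤
      64 * (X * η + X / q + q * η + 1) := by
  have hq := h.q_pos
  refine (h.approx.card_le K hη).trans ?_
  have hX0 : 0 ≤ X := by
    have : (0 : ℝ) ≤ K := Nat.cast_nonneg _
    linarith
  calc (2 * K / q + 1) * (4 * q * η + 2) ≤ (2 * (8 * X) / q + 1) * (4 * q * η + 2) := by gcongr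
    _ = 64 * (X * η) + 32 * (X / q) + 4 * (q * η) + 2 := by field_simp; ring
    _ ≤ _ := by
      have : 0 ≤ X / q := by positivity
      have : 0 ≤ q * η := by positivity
      linarith

theorem card_fiber_le (h : MinorArc N P D α q) (E : Finset (ℕ × ℕ × ℕ))
    (hE : ∀ x ∈ E, x.1 ≠ x.2.1 ∧ 1 ≤ x.2.2) (n : ℕ) (hn : 1 ≤ n) (hn' : (n : ℝ) ≤ 16 * N ^ 2) :
    ((E.filter (fun x => pairFreq x.1 x.2.1 x.2.2 = n)).card : ℝ) ≤ 2 * D ^ 2 := by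
  have h1 := h.divisors_le n hn hn'
  calc ((E.filter (fun x => pairFreq x.1 x.2.1 x.2.2 = n)).card : ℝ)
      ≤ 2 * (n.divisors.card : ℝ) ^ 2 := by exact_mod_cast card_pairFreq_fiber_le E hE n hn
    _ ≤ _ := by gcongr

end MinorArc

namespace MinorArc
variable {N P D α : ℝ} {q : ℕ}

/-- Mean value of the quadratic Weyl sums with frequencies `(u² - v²) α`. -/
theorem sum_norm_offDiag_le (h : MinorArc N P D α q) {U : ℕ} (hU : 1 ≤ U)
    (hUP : U * P ^ 4 ≤ N) (s : ℕ → ℕ → Finset ℕ)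
    (hs : ∀ u v, s u v ⊆ Finset.Icc 1 ⌊N / U⌋₊)
    (hc : ∀ u v, ∀ x ∈ s u v, ∀ z ∈ s u v, ∀ y, x ≤ y → y ≤ z → y ∈ s u v) :
    ∑ x ∈ (Finset.Ico U (2 * U)).offDiag,
      ‖∑ n ∈ s x.1 x.2, e ((n : ℝ) ^ 2 * (((x.1 : ℝ) ^ 2 - (x.2 : ℝ) ^ 2) * α))‖ ≤
      80 * D ^ 2 * (U * N / P ^ 2) := by
  have hN := h.N_pos
  have hP := h.one_le_P
  have hP0 := h.P_pos
  have hq := h.q_pos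
  have hD := h.two_le_D
  have hU0 : (1 : ℝ) ≤ U := by exact_mod_cast hU
  have hUpos : (0 : ℝ) < U := by linarith
  set Y : ℝ := N / U with hY
  have hYU : U * Y = N := by rw [hY]; field_simp
  have hYP : P ^ 4 ≤ Y := by rw [hY, le_div_iff₀ hUpos]; linarith
  have hY0 : 0 < Y := by positivity
  have hYN : Y ≤ N := by rw [← hYU]; nlinarith
  set E := (Finset.Ico U (2 * U)).offDiag with hE
  have hEcard : (E.card : ℝ) ≤ (U : ℝ) ^ 2 := by
    have : E.card ≤ U ^ 2 := by
      rw [hE, Finset.offDiag_card, Nat.card_Ico]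
      have : 2 * U - U = U := by omega
      rw [this, sq]; omega
    exact_mod_cast this
  set w : ℕ × ℕ → ℝ := fun x =>
    ‖∑ n ∈ s x.1 x.2, e ((n : ℝ) ^ 2 * (((x.1 : ℝ) ^ 2 - (x.2 : ℝ) ^ 2) * α))‖ with hw
  set J := Finset.Icc 1 ⌊Y⌋₊ with hJ
  have h1 : ∑ x ∈ E, w x ^ 2 ≤ U ^ 2 * Y +
      2 * ∑ x ∈ E, ∑ j ∈ J, geomBound Y (pairFreq x.1 x.2 j * α) := by
    calc ∑ x ∈ E, w x ^ 2 ≤ ∑ x ∈ E, (Y + 2 * ∑ j ∈ J, geomBound Y (pairFreq x.1 x.2 j * α)) := by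
          refine Finset.sum_le_sum fun x _ => ?_
          refine (norm_sq_sum_e_sq_le_of_convex hY0.le _ (hs _ _) (hc _ _) _).trans ?_
          simp only [geomBound_pairFreq]
          rfl
      _ ≤ _ := by
          rw [Finset.sum_add_distrib, Finset.sum_const, nsmul_eq_mul, ← Finset.mul_sum]
          gcongr
  have h2 : ∑ x ∈ E, ∑ j ∈ J, geomBound Y (pairFreq x.1 x.2 j * α) ≤
      2 * D ^ 2 * (256 * D * (U ^ 2 * Y * Y / q + U ^ 2 * Y + Y + q)) := by
    set E' : Finset (ℕ × ℕ × ℕ) := (E ×ˢ J).image (fun y => (y.1.1, y.1.2, y.2)) with hE'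
    have hmem : ∀ y ∈ E', (y.1 ∈ Finset.Ico U (2 * U) ∧ y.2.1 ∈ Finset.Ico U (2 * U) ∧
        y.1 ≠ y.2.1) ∧ 1 ≤ y.2.2 ∧ y.2.2 ≤ ⌊Y⌋₊ := by
      intro y hy
      simp only [hE', Finset.mem_image, Finset.mem_product, hE, Finset.mem_offDiag, hJ,
        Finset.mem_Icc] at hy
      obtain ⟨z, hz, rfl⟩ := hy
      exact hz
    have h3 : ∑ x ∈ E, ∑ j ∈ J, geomBound Y (pairFreq x.1 x.2 j * α) =
        ∑ y ∈ E', geomBound Y (pairFreq y.1 y.2.1 y.2.2 * α) := by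
      rw [← Finset.sum_product', hE', Finset.sum_image]
      rintro ⟨⟨a, b⟩, c⟩ _ ⟨⟨a', b'⟩, c'⟩ _ hh
      simp only [Prod.mk.injEq] at hh ⊢
      tauto
    set K := ⌊8 * (U ^ 2 * Y)⌋₊ with hK
    have hK1 : (K : ℝ) ≤ 8 * (U ^ 2 * Y) := Nat.floor_le (by positivity)
    have hK2 : 8 * (U ^ 2 * Y) ≤ 16 * N ^ 2 := by
      have : (U : ℝ) ≤ N := by
        have : (1 : ℝ) ≤ P ^ 4 := one_le_pow₀ hP
        nlinarith
      have : U ^ 2 * Y = U * N := by rw [← hYU]; ring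
      rw [this]; nlinarith
    rw [h3]
    refine (sum_comp_le_mul_sum E' (fun y => pairFreq y.1 y.2.1 y.2.2) K
      (fun k => geomBound Y (k * α)) (fun n => geomBound_nonneg hY0.le _) ?_ (2 * D ^ 2) ?_).trans ?_
    · intro y hy
      obtain ⟨⟨h4, h5, h6⟩, h7, h8⟩ := hmem y hy
      rw [Finset.mem_Icc]
      refine ⟨pairFreq_pos h6 h7, Nat.le_floor ?_⟩
      have h9 : (y.2.2 : ℝ) ≤ Y := (Nat.cast_le.mpr h8).trans (Nat.floor_le hY0.le)
      calc ((pairFreq y.1 y.2.1 y.2.2 : ℕ) : ℝ) ≤ ((8 * U ^ 2 * y.2.2 : ℕ) : ℝ) := by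
            exact_mod_cast pairFreq_le h4 h5
        _ = 8 * (U ^ 2 * y.2.2) := by push_cast; ring
        _ ≤ _ := by gcongr
    · intro n hn
      rw [Finset.mem_Icc] at hn
      refine h.card_fiber_le E' (fun y hy => ⟨(hmem y hy).1.2.2, (hmem y hy).2.1⟩) n hn.1 ?_
      exact (Nat.cast_le.mpr hn.2).trans (hK1.trans hK2)
    · have : (1 : ℝ) ≤ U ^ 2 * Y := by
        have : (1 : ℝ) ≤ P ^ 4 := one_le_pow₀ hP
        have : (1 : ℝ) ≤ U ^ 2 := one_le_pow₀ hU0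
        nlinarith
      exact mul_le_mul_of_nonneg_left (h.sum_geomBound_le hK1 this hY0 hYN) (by positivity)
  have hA : (U : ℝ) ^ 2 * Y ≤ N ^ 2 / P ^ 4 := by
    rw [le_div_iff₀ (by positivity)]
    calc (U : ℝ) ^ 2 * Y * P ^ 4 ≤ U ^ 2 * Y * Y := by gcongr
      _ = N ^ 2 := by rw [← hYU]; ring
  have hB : (U : ℝ) ^ 2 * Y * Y / q ≤ N ^ 2 / P ^ 4 := by
    have : (U : ℝ) ^ 2 * Y * Y = N ^ 2 := by rw [← hYU]; ring
    rw [this]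
    have := h.le_q
    gcongr
  have hC : Y ≤ N ^ 2 / P ^ 4 := by
    refine le_trans ?_ hA
    have : (1 : ℝ) ≤ U ^ 2 := one_le_pow₀ hU0
    nlinarith
  have hQ : (q : ℝ) ≤ N ^ 2 / P ^ 4 := by
    rw [le_div_iff₀ (by positivity)]; exact h.q_le
  have h4 : ∑ x ∈ E, w x ^ 2 ≤ 5000 * D ^ 4 * (N ^ 2 / P ^ 4) := by
    set G := N ^ 2 / P ^ 4
    have hG : 0 ≤ G := by positivity
    calc ∑ x ∈ E, w x ^ 2 ≤ G + 2 * (2 * D ^ 2 * (256 * D * (G + G + G + G))) := by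
          refine h1.trans (add_le_add hA ?_)
          refine mul_le_mul_of_nonneg_left (h2.trans ?_) (by norm_num)
          gcongr
      _ = G * 1 + 4096 * (D ^ 3 * G) := by ring
      _ ≤ G * D ^ 4 + 4096 * (D ^ 4 * G) := by
          have : 1 ≤ D := by linarith
          gcongr
          · exact one_le_pow₀ this
          · norm_num
      _ ≤ _ := by
          have : 0 ≤ D ^ 4 * G := by positivity
          linarith
  have h5 : (∑ x ∈ E, w x) ^ 2 ≤ (80 * D ^ 2 * (U * N / P ^ 2)) ^ 2 := by
    calc (∑ x ∈ E, w x) ^ 2 ≤ E.card * ∑ x ∈ E, w x ^ 2 := sq_sum_le_card_mul_sum_sq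
      _ ≤ U ^ 2 * (5000 * D ^ 4 * (N ^ 2 / P ^ 4)) := by
          gcongr
      _ ≤ U ^ 2 * (6400 * D ^ 4 * (N ^ 2 / P ^ 4)) := by gcongr; norm_num
      _ = _ := by field_simp; ring
  exact (abs_le_of_sq_le_sq' h5 (by positivity)).2

/-- The bilinear (Type II) estimate over a dyadic block. -/
theorem norm_bilinear_dyadic_le (h : MinorArc N P D α q) {U : ℕ} (hU : 1 ≤ U)
    (hUP : U * P ^ 4 ≤ N) (hPU : P ^ 2 ≤ D * (2 * U)) {lo hi : ℕ} (hhi : (hi : ℝ) ≤ N)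
    (A B : ℕ → ℂ) (hA : ∀ u, ‖A u‖ ≤ D) (hB : ∀ v, ‖B v‖ ≤ D) :
    ‖∑ u ∈ Finset.Ico U (2 * U), ∑ v ∈ Finset.Icc 1 hi,
      if lo ≤ u * v ∧ u * v ≤ hi then A u * B v * e (((u * v : ℕ) : ℝ) ^ 2 * α) else 0‖ ≤
      10 * D ^ 3 * (N / P) := by
  have hN := h.N_pos
  have hP := h.one_le_P
  have hP0 := h.P_pos
  have hD := h.two_le_D
  have hU0 : (1 : ℝ) ≤ U := by exact_mod_cast hU
  have hUpos : (0 : ℝ) < U := by linarith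
  set Y : ℝ := N / U with hY
  have hYU : U * Y = N := by rw [hY]; field_simp
  have hY0 : 0 < Y := by positivity
  set J := Finset.Icc 1 ⌊Y⌋₊ with hJ
  set I := Finset.Ico U (2 * U) with hI
  set c : ℕ → ℕ → Prop := fun u v => lo ≤ u * v ∧ u * v ≤ hi with hc
  set g : ℕ → ℕ → ℂ := fun u v => if c u v then e (((u * v : ℕ) : ℝ) ^ 2 * α) else 0 with hg
  have hred : ∑ u ∈ I, ∑ v ∈ Finset.Icc 1 hi,
      (if lo ≤ u * v ∧ u * v ≤ hi then A u * B v * e (((u * v : ℕ) : ℝ) ^ 2 * α) else 0) =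
      ∑ v ∈ J, B v * ∑ u ∈ I, A u * g u v := by
    have : ∀ u ∈ I, ∑ v ∈ Finset.Icc 1 hi,
        (if lo ≤ u * v ∧ u * v ≤ hi then A u * B v * e (((u * v : ℕ) : ℝ) ^ 2 * α) else 0) =
        ∑ v ∈ J, B v * (A u * g u v) := by
      intro u hu
      have hu1 : U ≤ u := (Finset.mem_Ico.mp hu).1
      have hterm : ∀ v, (if lo ≤ u * v ∧ u * v ≤ hi then
          A u * B v * e (((u * v : ℕ) : ℝ) ^ 2 * α) else 0) = B v * (A u * g u v) := by
        intro v
        simp only [hg, hc]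
        split_ifs <;> ring
      simp only [hterm]
      have hz : ∀ v, ¬ c u v → B v * (A u * g u v) = 0 := by
        intro v hv
        simp [hg, hv]
      rw [← Finset.sum_filter_of_ne (s := Finset.Icc 1 hi) (p := c u)
          (fun v _ hv => by by_contra hcv; exact hv (hz v hcv)),
        ← Finset.sum_filter_of_ne (s := J) (p := c u)
          (fun v _ hv => by by_contra hcv; exact hv (hz v hcv))]
      refine Finset.sum_congr ?_ fun _ _ => rfl
      ext v
      simp only [Finset.mem_filter, Finset.mem_Icc, hJ, hc]
      constructor
      · rintro ⟨⟨h1, h2⟩, h3, h4⟩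
        refine ⟨⟨h1, Nat.le_floor ?_⟩, h3, h4⟩
        rw [hY, le_div_iff₀ hUpos]
        calc (v : ℝ) * U ≤ v * u := by gcongr
          _ = ((u * v : ℕ) : ℝ) := by push_cast; ring
          _ ≤ hi := by exact_mod_cast h4
          _ ≤ N := hhi
      · rintro ⟨⟨h1, h2⟩, h3, h4⟩
        exact ⟨⟨h1, by nlinarith⟩, h3, h4⟩
    rw [Finset.sum_congr rfl this, Finset.sum_comm]
    exact Finset.sum_congr rfl fun v _ => by rw [Finset.mul_sum]
  rw [hred]
  set X : ℕ → ℂ := fun v => ∑ u ∈ I, A u * g u v with hX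
  set s : ℕ → ℕ → Finset ℕ := fun u u' => J.filter (fun v => c u v ∧ c u' v) with hs
  have hsJ : ∀ u u', s u u' ⊆ J := fun u u' => Finset.filter_subset _ _
  have hsc : ∀ u u', ∀ x ∈ s u u', ∀ z ∈ s u u', ∀ y, x ≤ y → y ≤ z → y ∈ s u u' := by
    intro u u' x hx z hz y hxy hyz
    simp only [hs, hJ, hc, Finset.mem_filter, Finset.mem_Icc] at hx hz ⊢
    obtain ⟨⟨hx1, hx2⟩, ⟨hx3, hx4⟩, hx5, hx6⟩ := hx
    obtain ⟨⟨hz1, hz2⟩, ⟨hz3, hz4⟩, hz5, hz6⟩ := hz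
    have := Nat.mul_le_mul_left u hxy
    have := Nat.mul_le_mul_left u hyz
    have := Nat.mul_le_mul_left u' hxy
    have := Nat.mul_le_mul_left u' hyz
    omega
  set w : ℕ × ℕ → ℝ := fun x =>
    ‖∑ n ∈ s x.1 x.2, e ((n : ℝ) ^ 2 * (((x.1 : ℝ) ^ 2 - (x.2 : ℝ) ^ 2) * α))‖ with hw
  have hgg : ∀ u u', ∑ v ∈ J, g u v * (starRingEnd ℂ) (g u' v) =
      ∑ n ∈ s u u', e ((n : ℝ) ^ 2 * (((u : ℝ) ^ 2 - (u' : ℝ) ^ 2) * α)) := by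
    intro u u'
    rw [hs, Finset.sum_filter]
    refine Finset.sum_congr rfl fun v _ => ?_
    simp only [hg]
    by_cases h1 : c u v <;> by_cases h2 : c u' v <;> simp only [h1, h2, if_true, if_false,
      and_self, and_true, and_false, zero_mul, map_zero, mul_zero]
    rw [← e_sub]
    congr 1
    push_cast
    ring
  have hsq : ∑ v ∈ J, ‖X v‖ ^ 2 ≤ D ^ 2 * ∑ x ∈ I ×ˢ I, w x := by
    have h1 : ((∑ v ∈ J, ‖X v‖ ^ 2 : ℝ) : ℂ) = ∑ x ∈ I ×ˢ I, A x.1 * (starRingEnd ℂ) (A x.2) *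
        ∑ v ∈ J, g x.1 v * (starRingEnd ℂ) (g x.2 v) := by
      push_cast
      have : ∀ v ∈ J, (‖X v‖ : ℂ) ^ 2 = ∑ x ∈ I ×ˢ I, A x.1 * (starRingEnd ℂ) (A x.2) *
          (g x.1 v * (starRingEnd ℂ) (g x.2 v)) := by
        intro v _
        have h2 := Complex.mul_conj (X v)
        rw [Complex.normSq_eq_norm_sq] at h2
        push_cast at h2
        rw [← h2, hX, map_sum, Finset.sum_mul_sum, ← Finset.sum_product']
        refine Finset.sum_congr rfl fun x _ => ?_
        rw [map_mul]; ring
      rw [Finset.sum_congr rfl this, Finset.sum_comm]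
      exact Finset.sum_congr rfl fun x _ => by rw [Finset.mul_sum]
    have h2 : ∑ v ∈ J, ‖X v‖ ^ 2 = ‖((∑ v ∈ J, ‖X v‖ ^ 2 : ℝ) : ℂ)‖ := by
      rw [Complex.norm_real, Real.norm_of_nonneg (Finset.sum_nonneg fun _ _ => by positivity)]
    rw [h2, h1, Finset.mul_sum]
    refine (norm_sum_le _ _).trans (Finset.sum_le_sum fun x _ => ?_)
    rw [norm_mul, norm_mul, RCLike.norm_conj, hgg]
    refine mul_le_mul_of_nonneg_right ?_ (norm_nonneg _)
    rw [sq]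
    exact mul_le_mul (hA _) (hA _) (norm_nonneg _) (by linarith)
  have hwsum : ∑ x ∈ I ×ˢ I, w x ≤ U * Y + 80 * D ^ 2 * (U * N / P ^ 2) := by
    rw [← Finset.diag_union_offDiag, Finset.sum_union (Finset.disjoint_diag_offDiag I)]
    refine add_le_add ?_ (h.sum_norm_offDiag_le hU hUP s hsJ hsc)
    calc ∑ x ∈ I.diag, w x ≤ ∑ x ∈ I.diag, Y :=
          Finset.sum_le_sum fun x _ => norm_sum_e_le_of_subset hY0.le _ (hsJ _ _) _
      _ = U * Y := by
          rw [Finset.sum_const, Finset.diag_card, hI, Nat.card_Ico, nsmul_eq_mul,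
            show 2 * U - U = U by omega]
  have hfin : ‖∑ v ∈ J, B v * X v‖ ^ 2 ≤ (10 * D ^ 3 * (N / P)) ^ 2 := by
    have h1 : ‖∑ v ∈ J, B v * X v‖ ≤ D * ∑ v ∈ J, ‖X v‖ := by
      rw [Finset.mul_sum]
      refine (norm_sum_le _ _).trans (Finset.sum_le_sum fun v _ => ?_)
      rw [norm_mul]
      exact mul_le_mul_of_nonneg_right (hB v) (norm_nonneg _)
    have h2 : (∑ v ∈ J, ‖X v‖) ^ 2 ≤ Y * ∑ v ∈ J, ‖X v‖ ^ 2 := by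
      refine sq_sum_le_card_mul_sum_sq.trans ?_
      refine mul_le_mul_of_nonneg_right ?_ (Finset.sum_nonneg fun _ _ => by positivity)
      rw [hJ, Nat.card_Icc, Nat.add_sub_cancel]
      exact Nat.floor_le hY0.le
    have h3 : Y * (U * Y) ≤ 2 * D * (N ^ 2 / P ^ 2) := by
      have : Y * (U * Y) * U = N ^ 2 := by rw [← hYU]; ring
      rw [mul_div_assoc' (2 * D), le_div_iff₀ (by positivity)]
      calc Y * (U * Y) * P ^ 2 ≤ Y * (U * Y) * (D * (2 * U)) := by gcongr
        _ = 2 * D * (Y * (U * Y) * U) := by ring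
        _ = _ := by rw [this]
    calc ‖∑ v ∈ J, B v * X v‖ ^ 2 ≤ (D * ∑ v ∈ J, ‖X v‖) ^ 2 := by gcongr
      _ = D ^ 2 * (∑ v ∈ J, ‖X v‖) ^ 2 := by ring
      _ ≤ D ^ 2 * (Y * (D ^ 2 * (U * Y + 80 * D ^ 2 * (U * N / P ^ 2)))) := by
          gcongr
          refine h2.trans ?_
          gcongr
          exact hsq.trans (by gcongr)
      _ = D ^ 4 * (Y * (U * Y)) + 80 * D ^ 6 * (N ^ 2 / P ^ 2) := by
          rw [← hYU]; ring
      _ ≤ D ^ 4 * (2 * D * (N ^ 2 / P ^ 2)) + 80 * D ^ 6 * (N ^ 2 / P ^ 2) := by gcongr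
      _ = 2 * D ^ 5 * (N ^ 2 / P ^ 2) + 80 * D ^ 6 * (N ^ 2 / P ^ 2) := by ring
      _ ≤ 2 * D ^ 6 * (N ^ 2 / P ^ 2) + 98 * D ^ 6 * (N ^ 2 / P ^ 2) := by
          have : 1 ≤ D := by linarith
          gcongr <;> norm_num
      _ = _ := by field_simp; ring
  exact (abs_le_of_sq_le_sq' hfin (by positivity)).2

end MinorArc

/-- A sharp form of Weyl's inequality for quadratic sums. -/
theorem norm_sq_sum_e_sq_le_of_no_approx {Y D : ℝ} {I : ℕ} (hI : Y ≤ 2 ^ I) (hID : (I : ℝ) + 2 ≤ D)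
    {H : ℝ} (hH : 1 ≤ H) (hHY : H ≤ Y) (s : Finset ℕ) (hs : s ⊆ Finset.Icc 1 ⌊Y⌋₊)
    (hc : ∀ x ∈ s, ∀ z ∈ s, ∀ y, x ≤ y → y ≤ z → y ∈ s) (β : ℝ)
    (hβ : ∀ r : ℕ, 1 ≤ r → (r : ℝ) ≤ H → H / Y ^ 2 < distInt (r * (2 * β))) :
    ‖∑ n ∈ s, e ((n : ℝ) ^ 2 * β)‖ ^ 2 ≤ 200 * D * (Y ^ 2 / H) := by
  have hY1 : 1 ≤ Y := hH.trans hHY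
  have hY : 0 < Y := by linarith
  have hH0 : 0 < H := by linarith
  have hD : 2 ≤ D := by
    have : (0 : ℝ) ≤ I := Nat.cast_nonneg _
    linarith
  set Q : ℝ := Y ^ 2 / H with hQ
  have hYQ : Y ≤ Q := by
    rw [hQ, le_div_iff₀ hH0, sq]
    gcongr
  have hQ0 : 0 < Q := by linarith
  have hn : 0 < ⌊Q⌋₊ := Nat.floor_pos.mpr (hY1.trans hYQ)
  obtain ⟨x, hx, hxQ⟩ := Real.exists_rat_abs_sub_le_and_den_le (2 * β) hn
  set r := x.den with hr
  have hr0 : 0 < r := x.den_pos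
  have hr0' : (0 : ℝ) < r := by exact_mod_cast hr0
  have hrQ : (r : ℝ) ≤ Q := (Nat.cast_le.mpr hxQ).trans (Nat.floor_le hQ0.le)
  have happ : |(r : ℝ) * (2 * β) - x.num| ≤ 1 / Q := by
    have h1 : (r : ℝ) * (2 * β) - x.num = r * (2 * β - x) := by
      rw [mul_sub]; congr 1
      rw [Rat.cast_def x, ← hr]; field_simp
    rw [h1, abs_mul, abs_of_pos hr0']
    calc r * |2 * β - x| ≤ r * (1 / ((⌊Q⌋₊ + 1) * r)) := by gcongr
      _ = 1 / (⌊Q⌋₊ + 1) := by field_simp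
      _ ≤ 1 / Q := one_div_le_one_div_of_le hQ0 (Nat.lt_floor_add_one Q).le
  have hap : IsApproxDenom (2 * β) r := by
    refine ⟨hr0, x.num, ?_, happ.trans (one_div_le_one_div_of_le hr0' hrQ)⟩
    rw [Int.isCoprime_iff_gcd_eq_one, Int.gcd_eq_natAbs]
    exact x.reduced
  have hrH : H < r := by
    by_contra hcon
    have h1 := hβ r hr0 (not_lt.mp hcon)
    have h2 := (distInt_le_abs_sub ((r : ℝ) * (2 * β)) x.num).trans happ
    rw [hQ, one_div_div] at h2
    linarith
  have hK : ((⌊Y⌋₊ : ℕ) : ℝ) ≤ Y := Nat.floor_le hY.le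
  have hYr : Y ^ 2 / r ≤ Q := by rw [hQ]; gcongr
  calc ‖∑ n ∈ s, e ((n : ℝ) ^ 2 * β)‖ ^ 2
      ≤ Y + 2 * ∑ j ∈ Finset.Icc 1 ⌊Y⌋₊, geomBound Y (j * (2 * β)) :=
        norm_sq_sum_e_sq_le_of_convex hY.le s hs hc β
    _ ≤ Q * D + 2 * ((2 * Y / r + 1) * (16 * r * D + 16 * Y * D)) := by
        have h1 : (I : ℝ) + 1 ≤ D := by linarith
        have h2 : 16 * Y ≤ 16 * Y * D := by nlinarith
        have h3 : Y ≤ Q * D := by nlinarith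
        refine add_le_add h3 (mul_le_mul_of_nonneg_left ?_ (by norm_num))
        refine (hap.sum_geomBound_le _ hY hI).trans ?_
        gcongr
    _ = D * (Q + 96 * Y + 64 * (Y ^ 2 / r) + 32 * r) := by field_simp; ring
    _ ≤ D * (Q + 96 * Q + 64 * Q + 32 * Q) := by gcongr
    _ ≤ _ := by nlinarith

theorem card_sq_le_mul_card_filter_eq (A : Finset ℕ) (r : ℕ → ℕ) (H : ℕ)
    (hr : ∀ m ∈ A, r m ∈ Finset.Icc 1 H) :
    (A.card : ℝ) ^ 2 ≤ H * (A.card + (A.offDiag.filter (fun x => r x.1 = r x.2)).card) := by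
  have h1 : A.card = ∑ i ∈ Finset.Icc 1 H, (A.filter (fun m => r m = i)).card :=
    Finset.card_eq_sum_card_fiberwise hr
  have h2 : ((A ×ˢ A).filter (fun x => r x.1 = r x.2)).card =
      ∑ i ∈ Finset.Icc 1 H, (A.filter (fun m => r m = i)).card ^ 2 := by
    rw [Finset.card_eq_sum_card_fiberwise (f := fun x => r x.1) (t := Finset.Icc 1 H)]
    · refine Finset.sum_congr rfl fun i _ => ?_
      rw [sq, ← Finset.card_product]
      congr 1
      ext x
      simp only [Finset.mem_filter, Finset.mem_product]
      constructor
      · rintro ⟨⟨⟨a, b⟩, c⟩, d⟩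
        exact ⟨⟨a, d⟩, b, c.symm.trans d⟩
      · rintro ⟨⟨a, d⟩, b, c⟩
        exact ⟨⟨⟨a, b⟩, d.trans c.symm⟩, d⟩
    · intro x hx
      simp only [Finset.coe_filter, Finset.mem_product, Set.mem_ofPred_eq] at hx
      exact hr _ hx.1.1
  have h3 : ((A ×ˢ A).filter (fun x => r x.1 = r x.2)).card =
      A.card + (A.offDiag.filter (fun x => r x.1 = r x.2)).card := by
    rw [← Finset.diag_union_offDiag, Finset.filter_union, Finset.card_union_of_disjoint
      (Finset.disjoint_filter_filter (Finset.disjoint_diag_offDiag A)), Finset.filter_true_of_mem,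
      Finset.diag_card]
    intro x hx
    rw [(Finset.mem_diag.mp hx).2]
  have h4 := sq_sum_le_card_mul_sum_sq (s := Finset.Icc 1 H)
    (f := fun i => ((A.filter (fun m => r m = i)).card : ℝ))
  rw [Nat.card_Icc, Nat.add_sub_cancel] at h4
  have h5 : (A.card : ℝ) = ∑ i ∈ Finset.Icc 1 H, ((A.filter (fun m => r m = i)).card : ℝ) := by
    exact_mod_cast h1
  have h6 : (A.card : ℝ) + (A.offDiag.filter (fun x => r x.1 = r x.2)).card =
      ∑ i ∈ Finset.Icc 1 H, ((A.filter (fun m => r m = i)).card : ℝ) ^ 2 := by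
    exact_mod_cast h3.symm.trans h2
  rw [h6, h5]
  exact h4

namespace MinorArc
variable {N P D α : ℝ} {q : ℕ}

/-- The multipliers `m` for which `2 m² α` has a very good rational approximation are rare. -/
theorem card_goodApprox_le (h : MinorArc N P D α q) {M : ℕ} (hPM : P ^ 2 ≤ M)
    (hMP : M * P ^ 3 ≤ N) {H : ℕ} (hH : 1 ≤ H) (hHP : (H : ℝ) ≤ P ^ 2) :
    (((Finset.Ico M (2 * M)).filter (fun m : ℕ => ∃ r : ℕ, 1 ≤ r ∧ r ≤ H ∧
      distInt (r * (2 * ((m : ℝ) ^ 2 * α))) ≤ H / (N / M) ^ 2)).card : ℝ) ^ 2 ≤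
      1600 * D ^ 2 * (H * (M / P) ^ 2) := by
  have hN := h.N_pos
  have hP := h.one_le_P
  have hP0 := h.P_pos
  have hq := h.q_pos
  have hD := h.two_le_D
  have hMpos : (0 : ℝ) < M := lt_of_lt_of_le (by positivity) hPM
  set A := (Finset.Ico M (2 * M)).filter (fun m : ℕ => ∃ r : ℕ, 1 ≤ r ∧ r ≤ H ∧
      distInt (r * (2 * ((m : ℝ) ^ 2 * α))) ≤ H / (N / M) ^ 2) with hA
  set Y : ℝ := N / M with hY
  have hYM : M * Y = N := by rw [hY]; field_simp
  have hYP : P ^ 3 ≤ Y := by rw [hY, le_div_iff₀ hMpos]; linarith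
  have hY0 : 0 < Y := by positivity
  have hH0 : (0 : ℝ) < H := by exact_mod_cast hH
  have hex : ∀ m ∈ A, ∃ r : ℕ, 1 ≤ r ∧ r ≤ H ∧
      distInt (r * (2 * ((m : ℝ) ^ 2 * α))) ≤ H / Y ^ 2 := fun m hm => (Finset.mem_filter.mp hm).2
  choose! r hr1 hr2 hr3 using hex
  have hcard := card_sq_le_mul_card_filter_eq A r H
    (fun m hm => Finset.mem_Icc.mpr ⟨hr1 m hm, hr2 m hm⟩)
  set E := A.offDiag.filter (fun x => r x.1 = r x.2) with hE
  set η : ℝ := 2 * H / Y ^ 2 with hη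
  have hη0 : 0 ≤ η := by positivity
  set K := ⌊8 * (H * (M : ℝ) ^ 2)⌋₊ with hK
  have hK1 : (K : ℝ) ≤ 8 * (H * M ^ 2) := Nat.floor_le (by positivity)
  have hK2 : 8 * (H * (M : ℝ) ^ 2) ≤ 16 * N ^ 2 := by
    have h1 : (M * P : ℝ) ≤ N := by
      refine le_trans ?_ hMP
      gcongr
      exact le_self_pow₀ hP (by norm_num)
    calc 8 * (H * (M : ℝ) ^ 2) ≤ 8 * (P ^ 2 * M ^ 2) := by gcongr
      _ = 8 * (M * P) ^ 2 := by ring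
      _ ≤ 8 * N ^ 2 := by gcongr
      _ ≤ _ := by nlinarith [sq_nonneg N]
  have hEcard : (E.card : ℝ) ≤ 2 * D ^ 2 * (64 * (H * M ^ 2 * η + H * M ^ 2 / q + q * η + 1)) := by
    set E' : Finset (ℕ × ℕ × ℕ) := E.image (fun x => (x.1, x.2, r x.1)) with hE'
    have hmem : ∀ y ∈ E', y.1 ∈ A ∧ y.2.1 ∈ A ∧ y.1 ≠ y.2.1 ∧ y.2.2 = r y.1 ∧
        y.2.2 = r y.2.1 := by
      intro y hy
      simp only [hE', Finset.mem_image, hE, Finset.mem_filter, Finset.mem_offDiag] at hy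
      obtain ⟨x, ⟨⟨h1, h2, h3⟩, h4⟩, rfl⟩ := hy
      exact ⟨h1, h2, h3, rfl, h4⟩
    have hE'card : E.card = E'.card := by
      rw [hE', Finset.card_image_of_injective]
      rintro ⟨a, b⟩ ⟨a', b'⟩ hh
      simp only [Prod.mk.injEq] at hh ⊢
      exact ⟨hh.1, hh.2.1⟩
    have h1 : (E'.card : ℝ) = ∑ y ∈ E',
        (if distInt ((pairFreq y.1 y.2.1 y.2.2 : ℕ) * α) ≤ η then (1 : ℝ) else 0) := by
      rw [Finset.card_eq_sum_ones, Nat.cast_sum]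
      refine Finset.sum_congr rfl fun y hy => ?_
      obtain ⟨h1, h2, h3, h4, h5⟩ := hmem y hy
      rw [if_pos]
      · simp
      rw [← distInt_pairFreq]
      have h6 := hr3 _ h1
      have h7 := hr3 _ h2
      rw [← h4] at h6
      rw [← h5] at h7
      calc distInt (y.2.2 * (2 * (((y.1 : ℝ) ^ 2 - (y.2.1 : ℝ) ^ 2) * α)))
          = distInt (y.2.2 * (2 * ((y.1 : ℝ) ^ 2 * α)) - y.2.2 * (2 * ((y.2.1 : ℝ) ^ 2 * α))) := by
            congr 1; ring
        _ ≤ H / Y ^ 2 + H / Y ^ 2 := (distInt_sub_le _ _).trans (add_le_add h6 h7)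
        _ = η := by rw [hη]; ring
    rw [hE'card, h1]
    refine (sum_comp_le_mul_sum E' (fun y => pairFreq y.1 y.2.1 y.2.2) K
      (fun k => if distInt (k * α) ≤ η then (1 : ℝ) else 0) (fun n => by positivity) ?_
      (2 * D ^ 2) ?_).trans ?_
    · intro y hy
      obtain ⟨h1, h2, h3, h4, h5⟩ := hmem y hy
      rw [Finset.mem_Icc]
      refine ⟨pairFreq_pos h3 (h4 ▸ hr1 _ h1), Nat.le_floor ?_⟩
      have h9 : y.2.2 ≤ H := h4 ▸ hr2 _ h1
      have h10 := pairFreq_le (j := y.2.2) (Finset.mem_filter.mp h1).1 (Finset.mem_filter.mp h2).1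
      calc ((pairFreq y.1 y.2.1 y.2.2 : ℕ) : ℝ) ≤ ((8 * M ^ 2 * y.2.2 : ℕ) : ℝ) := by
            exact_mod_cast h10
        _ = 8 * (y.2.2 * M ^ 2) := by push_cast; ring
        _ ≤ _ := by gcongr
    · intro n hn
      rw [Finset.mem_Icc] at hn
      refine h.card_fiber_le E' (fun y hy => ⟨(hmem y hy).2.2.1, ?_⟩) n hn.1
        ((Nat.cast_le.mpr hn.2).trans (hK1.trans hK2))
      exact (hmem y hy).2.2.2.1 ▸ hr1 _ (hmem y hy).1
    · rw [Finset.sum_boole]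
      exact mul_le_mul_of_nonneg_left (h.card_le hK1 hη0) (by positivity)
  set G : ℝ := H * (M / P) ^ 2 with hG
  have hG0 : 0 ≤ G := by positivity
  have hGP : G * P ^ 2 = H * M ^ 2 := by rw [hG]; field_simp
  have hP2 : 0 < P ^ 2 := by positivity
  have hle : ∀ x : ℝ, x * P ^ 2 ≤ H * M ^ 2 → x ≤ G := fun x hx => by
    rw [← hGP] at hx
    exact le_of_mul_le_mul_right hx hP2
  have t1 : (H : ℝ) ^ 2 ≤ G := hle _ <| by
    calc (H : ℝ) ^ 2 * P ^ 2 = H * ((H : ℝ) * P ^ 2) := by ring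
      _ ≤ H * ((M : ℝ) * M) := by
          have : H * P ^ 2 ≤ (M : ℝ) * M := mul_le_mul (hHP.trans hPM) hPM hP2.le hMpos.le
          gcongr
      _ = _ := by ring
  have hY2 : P ^ 6 ≤ Y ^ 2 := by
    calc P ^ 6 = (P ^ 3) ^ 2 := by ring
      _ ≤ _ := by gcongr
  have t2 : H * (H * (M : ℝ) ^ 2 * η) ≤ 2 * G := by
    have h1 : H * (H * (M : ℝ) ^ 2 * η) = 2 * (H ^ 3 * M ^ 2 / Y ^ 2) := by rw [hη]; ring
    rw [h1]
    refine mul_le_mul_of_nonneg_left (hle _ ?_) (by norm_num)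
    rw [div_mul_eq_mul_div, div_le_iff₀ (by positivity)]
    calc (H : ℝ) ^ 3 * M ^ 2 * P ^ 2 = H * M ^ 2 * (H * H * P ^ 2) := by ring
      _ ≤ H * M ^ 2 * (P ^ 2 * P ^ 2 * P ^ 2) := by gcongr
      _ = H * M ^ 2 * P ^ 6 := by ring
      _ ≤ _ := by gcongr
  have t3 : H * (H * (M : ℝ) ^ 2 / q) ≤ G := by
    refine hle _ ?_
    rw [mul_div_assoc', div_mul_eq_mul_div, div_le_iff₀ hq]
    calc H * (H * (M : ℝ) ^ 2) * P ^ 2 ≤ P ^ 2 * (H * M ^ 2) * P ^ 2 := by gcongr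
      _ = H * M ^ 2 * P ^ 4 := by ring
      _ ≤ _ := by gcongr; exact h.le_q
  have t4 : H * (q * η) ≤ 2 * G := by
    have h1 : H * (q * η) = 2 * (H ^ 2 * q / Y ^ 2) := by rw [hη]; ring
    rw [h1]
    refine mul_le_mul_of_nonneg_left (hle _ ?_) (by norm_num)
    rw [div_mul_eq_mul_div, div_le_iff₀ (by positivity)]
    calc (H : ℝ) ^ 2 * q * P ^ 2 = H * (H * q * P ^ 2) := by ring
      _ ≤ H * (P ^ 2 * q * P ^ 2) := by gcongr
      _ = H * (q * P ^ 4) := by ring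
      _ ≤ H * N ^ 2 := by gcongr; exact h.q_le
      _ = _ := by rw [← hYM]; ring
  have t5 : (H : ℝ) ≤ G := hle _ <| by
    have : P ^ 2 ≤ (M : ℝ) ^ 2 := by
      gcongr
      exact (le_self_pow₀ hP (by norm_num)).trans hPM
    gcongr
  have hcard' : (A.card : ℝ) ^ 2 ≤ H * A.card + 768 * D ^ 2 * G := by
    calc (A.card : ℝ) ^ 2 ≤ H * (A.card + E.card) := hcard
      _ = H * A.card + H * E.card := by ring
      _ ≤ H * A.card +
          H * (2 * D ^ 2 * (64 * (H * M ^ 2 * η + H * M ^ 2 / q + q * η + 1))) := by gcongr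
      _ = H * A.card + 128 * D ^ 2 * (H * (H * M ^ 2 * η) + H * (H * M ^ 2 / q) + H * (q * η) + H) := by
          ring
      _ ≤ H * A.card + 128 * D ^ 2 * (2 * G + G + 2 * G + G) := by gcongr
      _ = _ := by ring
  have hGD : G * 64 ≤ G * (16 * D ^ 2) := by
    gcongr
    nlinarith
  nlinarith [sq_nonneg ((A.card : ℝ) - H)]

end MinorArc

namespace MinorArc
variable {N P D α : ℝ} {q : ℕ}

theorem sum_norm_linear_le_of_le (h : MinorArc N P D α q) {M : ℕ} (hM : 1 ≤ M)
    (hMP : (M : ℝ) ≤ P ^ 2) (s : ℕ → Finset ℕ) (hs : ∀ m, s m ⊆ Finset.Icc 1 ⌊N / M⌋₊)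
    (hc : ∀ m, ∀ x ∈ s m, ∀ z ∈ s m, ∀ y, x ≤ y → y ≤ z → y ∈ s m) :
    ∑ m ∈ Finset.Ico M (2 * M), ‖∑ n ∈ s m, e ((n : ℝ) ^ 2 * ((m : ℝ) ^ 2 * α))‖ ≤
      50 * D * (N / P) := by
  have hN := h.N_pos
  have hP := h.one_le_P
  have hP0 := h.P_pos
  have hq := h.q_pos
  have hD := h.two_le_D
  have hM0 : (1 : ℝ) ≤ M := by exact_mod_cast hM
  have hMpos : (0 : ℝ) < M := by linarith
  set Y : ℝ := N / M with hY
  have hYM : M * Y = N := by rw [hY]; field_simp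
  have hY0 : 0 < Y := by positivity
  have hYN : Y ≤ N := by rw [← hYM]; nlinarith
  have hMN : (M : ℝ) ≤ N := by
    refine hMP.trans (le_trans ?_ h.P_pow_le)
    exact pow_le_pow_right₀ hP (by norm_num)
  set I := Finset.Ico M (2 * M) with hI
  set J := Finset.Icc 1 ⌊Y⌋₊ with hJ
  set K := ⌊8 * ((M : ℝ) * N)⌋₊ with hK
  have hK1 : (K : ℝ) ≤ 8 * (M * N) := Nat.floor_le (by positivity)
  have hIcard : I.card = M := by
    rw [hI, Nat.card_Ico]
    omega
  have h2 : ∑ m ∈ I, ∑ j ∈ J, geomBound Y (j * (2 * ((m : ℝ) ^ 2 * α))) ≤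
      D * (256 * D * (M * N * Y / q + M * N + Y + q)) := by
    have h3 : ∀ m j : ℕ, (j : ℝ) * (2 * ((m : ℝ) ^ 2 * α)) = ((2 * m ^ 2 * j : ℕ) : ℝ) * α := by
      intro m j
      push_cast; ring
    simp only [h3]
    rw [← Finset.sum_product']
    refine (sum_comp_le_mul_sum (I ×ˢ J) (fun y => 2 * y.1 ^ 2 * y.2) K
      (fun k => geomBound Y (k * α)) (fun n => geomBound_nonneg hY0.le _) ?_ D ?_).trans ?_
    · rintro ⟨m, j⟩ hy
      simp only [Finset.mem_product, hI, hJ, Finset.mem_Ico, Finset.mem_Icc] at hy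
      obtain ⟨⟨h4, h5⟩, h6, h7⟩ := hy
      rw [Finset.mem_Icc]
      have hm : 0 < m := by omega
      have h8 : 0 < 2 * m ^ 2 * j := by positivity
      refine ⟨h8, Nat.le_floor ?_⟩
      have h9 : (j : ℝ) ≤ Y := (Nat.cast_le.mpr h7).trans (Nat.floor_le hY0.le)
      have h10 : (m : ℝ) ≤ 2 * M := by exact_mod_cast h5.le
      push_cast
      calc 2 * (m : ℝ) ^ 2 * j ≤ 2 * (2 * M) ^ 2 * Y := by gcongr
        _ = 8 * (M * (M * Y)) := by ring
        _ = _ := by rw [hYM]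
    · intro n hn
      rw [Finset.mem_Icc] at hn
      refine le_trans ?_ (h.divisors_le n hn.1 ((Nat.cast_le.mpr hn.2).trans (hK1.trans ?_)))
      · rw [Nat.cast_le]
        refine Finset.card_le_card_of_injOn (fun y => y.1) ?_ ?_
        · rintro ⟨m, j⟩ hy
          simp only [Finset.coe_filter, Set.mem_ofPred_eq] at hy
          simp only [Finset.mem_coe, Nat.mem_divisors]
          exact ⟨⟨2 * m * j, by rw [← hy.2]; ring⟩, by omega⟩
        · rintro ⟨m, j⟩ hy ⟨m', j'⟩ hy' hh
          simp only [Finset.coe_filter, Set.mem_ofPred_eq, Finset.mem_product, hI,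
            Finset.mem_Ico] at hy hy' hh
          subst hh
          have hm : 0 < m := by omega
          have := Nat.eq_of_mul_eq_mul_left (by positivity) (hy.2.trans hy'.2.symm)
          rw [this]
      · nlinarith
    · exact mul_le_mul_of_nonneg_left (h.sum_geomBound_le hK1 (by nlinarith [h.one_le_N]) hY0 hYN)
        (by linarith)
  set G : ℝ := N ^ 2 / P ^ 2 with hG
  have hG0 : 0 ≤ G := by positivity
  have hP2 : 0 < P ^ 2 := by positivity
  have hle : ∀ x : ℝ, x * P ^ 2 ≤ N ^ 2 → x ≤ G := fun x hx => (le_div_iff₀ hP2).mpr hx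
  have hPN : P ^ 6 ≤ N := (pow_le_pow_right₀ hP (by norm_num)).trans h.P_pow_le
  have t1 : (M : ℝ) * (M * N) ≤ G := hle _ <| by
    calc (M : ℝ) * (M * N) * P ^ 2 ≤ P ^ 2 * (P ^ 2 * N) * P ^ 2 := by gcongr
      _ = P ^ 6 * N := by ring
      _ ≤ N * N := by gcongr
      _ = N ^ 2 := by ring
  have t0 : (M : ℝ) * N ≤ G := le_trans (by nlinarith [mul_pos hMpos hN]) t1
  have t2 : (M : ℝ) * (M * N * Y / q) ≤ G := hle _ <| by
    rw [mul_div_assoc', div_mul_eq_mul_div, div_le_iff₀ hq]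
    calc (M : ℝ) * (M * N * Y) * P ^ 2 = N * (M * Y) * (M * P ^ 2) := by ring
      _ ≤ N * (M * Y) * (P ^ 2 * P ^ 2) := by gcongr
      _ = N ^ 2 * P ^ 4 := by rw [hYM]; ring
      _ ≤ _ := by gcongr; exact h.le_q
  have t3 : (M : ℝ) * Y ≤ G := le_trans (by rw [hYM]; nlinarith) t0
  have t4 : (M : ℝ) * q ≤ G := hle _ <| by
    calc (M : ℝ) * q * P ^ 2 ≤ P ^ 2 * q * P ^ 2 := by gcongr
      _ = q * P ^ 4 := by ring
      _ ≤ _ := h.q_le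
  have h5 : (∑ m ∈ I, ‖∑ n ∈ s m, e ((n : ℝ) ^ 2 * ((m : ℝ) ^ 2 * α))‖) ^ 2 ≤
      (50 * D * (N / P)) ^ 2 := by
    calc _ ≤ (I.card : ℝ) * ∑ m ∈ I, ‖∑ n ∈ s m, e ((n : ℝ) ^ 2 * ((m : ℝ) ^ 2 * α))‖ ^ 2 :=
          sq_sum_le_card_mul_sum_sq
      _ ≤ M * ∑ m ∈ I, (Y + 2 * ∑ j ∈ J, geomBound Y (j * (2 * ((m : ℝ) ^ 2 * α)))) := by
          rw [hIcard]
          gcongr with m _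
          exact norm_sq_sum_e_sq_le_of_convex hY0.le _ (hs m) (hc m) _
      _ = M * (M * Y) + 2 * (M * ∑ m ∈ I, ∑ j ∈ J, geomBound Y (j * (2 * ((m : ℝ) ^ 2 * α)))) := by
          rw [Finset.sum_add_distrib, Finset.sum_const, nsmul_eq_mul, ← Finset.mul_sum, hIcard]
          ring
      _ ≤ M * N + 2 * (M * (D * (256 * D * (M * N * Y / q + M * N + Y + q)))) := by
          rw [hYM]; gcongr
      _ = M * N + 512 * D ^ 2 * (M * (M * N * Y / q) + M * (M * N) + M * Y + M * q) := by ring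
      _ ≤ G + 512 * D ^ 2 * (G + G + G + G) := by gcongr
      _ ≤ 2500 * D ^ 2 * G := by
          have : 1 * G ≤ D ^ 2 * G := by
            gcongr
            nlinarith
          linarith
      _ = _ := by rw [hG]; field_simp; norm_num
  exact (abs_le_of_sq_le_sq' h5 (by positivity)).2

theorem sum_norm_linear_le_of_ge (h : MinorArc N P D α q) {M : ℕ} (hPM : P ^ 2 ≤ M)
    (hMP : M * P ^ 3 ≤ N) (s : ℕ → Finset ℕ) (hs : ∀ m, s m ⊆ Finset.Icc 1 ⌊N / M⌋₊)
    (hc : ∀ m, ∀ x ∈ s m, ∀ z ∈ s m, ∀ y, x ≤ y → y ≤ z → y ∈ s m) :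
    ∑ m ∈ Finset.Ico M (2 * M), ‖∑ n ∈ s m, e ((n : ℝ) ^ 2 * ((m : ℝ) ^ 2 * α))‖ ≤
      1500 * D ^ 3 * (N / P) := by
  have hN := h.N_pos
  have hP := h.one_le_P
  have hP0 := h.P_pos
  have hD := h.two_le_D
  have hM0 : (1 : ℝ) ≤ M := (one_le_pow₀ hP).trans hPM
  have hMpos : (0 : ℝ) < M := by linarith
  obtain ⟨I, hNI, hID⟩ := h.log_le
  set Y : ℝ := N / M with hY
  have hYM : M * Y = N := by rw [hY]; field_simp
  have hYP : P ^ 3 ≤ Y := by rw [hY, le_div_iff₀ hMpos]; linarith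
  have hY0 : 0 < Y := by positivity
  have hYN : Y ≤ N := by rw [← hYM]; nlinarith
  obtain ⟨i₀, hi₀, hi₀'⟩ := exists_nat_pow_near hP (one_lt_two : (1 : ℝ) < 2)
  have hPY : P ^ 2 ≤ Y := (pow_le_pow_right₀ hP (by norm_num)).trans hYP
  set A : ℕ → Finset ℕ := fun i => (Finset.Ico M (2 * M)).filter (fun m : ℕ => ∃ r : ℕ, 1 ≤ r ∧
    r ≤ 4 ^ i ∧ distInt (r * (2 * ((m : ℝ) ^ 2 * α))) ≤ ((4 ^ i : ℕ) : ℝ) / Y ^ 2) with hA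
  set W : ℕ → ℝ := fun m => ‖∑ n ∈ s m, e ((n : ℝ) ^ 2 * ((m : ℝ) ^ 2 * α))‖ with hW
  have h4 : ∀ i ≤ i₀, ((4 ^ i : ℕ) : ℝ) ≤ P ^ 2 := by
    intro i hi
    calc ((4 ^ i : ℕ) : ℝ) = (2 ^ i) ^ 2 := by push_cast; rw [← pow_mul, mul_comm, pow_mul]; norm_num
      _ ≤ (2 ^ i₀) ^ 2 := by gcongr; norm_num
      _ ≤ P ^ 2 := by gcongr
  have hAcard : ∀ i ≤ i₀, ((A i).card : ℝ) ≤ 40 * D * (2 ^ i * (M / P)) := by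
    intro i hi
    have h5 := h.card_goodApprox_le hPM hMP (Nat.one_le_pow i 4 (by norm_num)) (h4 i hi)
    refine (abs_le_of_sq_le_sq' (h5.trans_eq ?_) (by positivity)).2
    push_cast
    rw [show (4 : ℝ) = 2 ^ 2 by norm_num, ← pow_mul, mul_comm 2 i, pow_mul]
    ring
  have hnot : ∀ i ≤ i₀, ∀ m ∈ Finset.Ico M (2 * M), m ∉ A i → W m ≤ 15 * D * (Y / 2 ^ i) := by
    intro i hi m hm hmA
    have h5 := norm_sq_sum_e_sq_le_of_no_approx (hYN.trans hNI) hID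
      (H := ((4 ^ i : ℕ) : ℝ)) (by exact_mod_cast Nat.one_le_pow i 4 (by norm_num))
      ((h4 i hi).trans hPY) (s m) (hs m) (hc m) ((m : ℝ) ^ 2 * α) (by
        intro r hr1 hr2
        by_contra hcon
        exact hmA (Finset.mem_filter.mpr ⟨hm, r, hr1, by exact_mod_cast hr2, not_lt.mp hcon⟩))
    refine (abs_le_of_sq_le_sq' (h5.trans ?_) (by positivity)).2
    have h6 : (15 * D * (Y / 2 ^ i)) ^ 2 = 225 * D ^ 2 * (Y ^ 2 / ((4 ^ i : ℕ) : ℝ)) := by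
      push_cast
      rw [show (4 : ℝ) = 2 ^ 2 by norm_num, ← pow_mul, mul_comm 2 i, pow_mul]
      ring
    rw [h6]
    gcongr ?_ * _
    nlinarith
  have hpoint : ∀ m ∈ Finset.Ico M (2 * M), W m ≤ 30 * D * (Y / P) +
      ∑ i ∈ Finset.range (i₀ + 1), 30 * D * (Y / 2 ^ i) * (if m ∈ A i then 1 else 0) := by
    intro m hm
    have hterm : ∀ i, 0 ≤ 30 * D * (Y / 2 ^ i) * (if m ∈ A i then (1 : ℝ) else 0) := by
      intro i
      split_ifs <;> positivity
    by_cases hex : ∃ i, i ≤ i₀ ∧ m ∈ A i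
    · have h5 := Nat.find_spec hex
      set i := Nat.find hex with hi
      have h6 : W m ≤ 30 * D * (Y / 2 ^ i) := by
        rcases Nat.eq_zero_or_pos i with h0 | h0
        · rw [h0, pow_zero, div_one]
          refine (norm_sum_e_le_of_subset hY0.le (s m) (hs m) _).trans ?_
          nlinarith
        · obtain ⟨j, hj⟩ := Nat.exists_eq_succ_of_ne_zero h0.ne'
          have h7 := Nat.find_min hex (m := j) (by omega)
          have h8 := hnot j (by omega) m hm (fun hmj => h7 ⟨by omega, hmj⟩)
          refine h8.trans_eq ?_
          rw [hj, pow_succ]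
          field_simp; norm_num
      have h7 : 30 * D * (Y / 2 ^ i) * (if m ∈ A i then (1 : ℝ) else 0) ≤
          ∑ i ∈ Finset.range (i₀ + 1), 30 * D * (Y / 2 ^ i) * (if m ∈ A i then 1 else 0) :=
        Finset.single_le_sum (fun i _ => hterm i) (Finset.mem_range.mpr (by omega))
      rw [if_pos h5.2, mul_one] at h7
      have : 0 ≤ 30 * D * (Y / P) := by positivity
      linarith
    · push Not at hex
      have h5 := hnot i₀ le_rfl m hm (hex i₀ le_rfl)
      have h6 : Y / 2 ^ i₀ ≤ 2 * (Y / P) := by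
        rw [div_le_iff₀ (by positivity), mul_div_assoc', div_mul_eq_mul_div, le_div_iff₀ hP0]
        rw [pow_succ] at hi₀'
        nlinarith
      have h7 : 15 * D * (Y / 2 ^ i₀) ≤ 15 * D * (2 * (Y / P)) := by gcongr
      have := Finset.sum_nonneg (s := Finset.range (i₀ + 1)) (fun i _ => hterm i)
      linarith
  have hi₀D : (i₀ : ℝ) + 1 ≤ D := by
    have h5 : (2 : ℝ) ^ i₀ ≤ 2 ^ I :=
      hi₀.trans ((le_self_pow₀ hP (by norm_num)).trans (h.P_pow_le.trans hNI))
    have h6 : i₀ ≤ I := (pow_le_pow_iff_right₀ (by norm_num)).mp h5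
    have : (i₀ : ℝ) ≤ I := by exact_mod_cast h6
    linarith
  have hNP : (M : ℝ) * (Y / P) = N / P := by rw [← hYM]; ring
  have hAsum : ∀ i ∈ Finset.range (i₀ + 1), ∑ m ∈ Finset.Ico M (2 * M),
      30 * D * (Y / 2 ^ i) * (if m ∈ A i then (1 : ℝ) else 0) ≤ 1200 * D ^ 2 * (N / P) := by
    intro i hi
    rw [← Finset.mul_sum, Finset.sum_boole, Finset.filter_mem_eq_inter,
      Finset.inter_eq_right.mpr (Finset.filter_subset _ _)]
    calc 30 * D * (Y / 2 ^ i) * ((A i).card : ℝ)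
        ≤ 30 * D * (Y / 2 ^ i) * (40 * D * (2 ^ i * (M / P))) := by
          gcongr
          exact hAcard i (by rw [Finset.mem_range] at hi; omega)
      _ = 1200 * D ^ 2 * (M * (Y / P)) := by field_simp; norm_num
      _ = _ := by rw [hNP]
  have hG : 0 ≤ N / P := by positivity
  calc ∑ m ∈ Finset.Ico M (2 * M), W m
      ≤ ∑ m ∈ Finset.Ico M (2 * M), (30 * D * (Y / P) +
        ∑ i ∈ Finset.range (i₀ + 1), 30 * D * (Y / 2 ^ i) * (if m ∈ A i then 1 else 0)) :=
        Finset.sum_le_sum hpoint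
    _ = M * (30 * D * (Y / P)) + ∑ i ∈ Finset.range (i₀ + 1), ∑ m ∈ Finset.Ico M (2 * M),
        30 * D * (Y / 2 ^ i) * (if m ∈ A i then 1 else 0) := by
        rw [Finset.sum_add_distrib, Finset.sum_comm, Finset.sum_const, Nat.card_Ico, nsmul_eq_mul,
          show 2 * M - M = M by omega]
    _ ≤ 30 * D * (N / P) + ∑ i ∈ Finset.range (i₀ + 1), 1200 * D ^ 2 * (N / P) := by
        refine add_le_add (le_of_eq ?_) (Finset.sum_le_sum hAsum)
        rw [← hNP]; ring
    _ = 30 * D * (N / P) + (i₀ + 1) * (1200 * D ^ 2 * (N / P)) := by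
        rw [Finset.sum_const, Finset.card_range, nsmul_eq_mul]; push_cast; ring
    _ ≤ 30 * D ^ 3 * (N / P) + D * (1200 * D ^ 2 * (N / P)) := by
        have : D ≤ D ^ 3 := le_self_pow₀ (by linarith) (by norm_num)
        gcongr
    _ = 1230 * D ^ 3 * (N / P) := by ring
    _ ≤ _ := by gcongr; norm_num

/-- The linear (Type I) estimate over a dyadic block. -/
theorem sum_norm_linear_dyadic_le (h : MinorArc N P D α q) {M : ℕ} (hM : 1 ≤ M)
    (hMP : M * P ^ 3 ≤ N) {lo hi : ℕ} (hhi : (hi : ℝ) ≤ N) :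
    ∑ m ∈ Finset.Ico M (2 * M), ‖∑ n ∈ Finset.Icc 1 hi,
      if lo ≤ m * n ∧ m * n ≤ hi then e (((m * n : ℕ) : ℝ) ^ 2 * α) else 0‖ ≤
      1500 * D ^ 3 * (N / P) := by
  have hD := h.two_le_D
  have hP0 := h.P_pos
  have hN := h.N_pos
  have hMpos : (0 : ℝ) < M := by exact_mod_cast hM
  set s : ℕ → Finset ℕ := fun m => (Finset.Icc 1 ⌊N / M⌋₊).filter
    (fun n => lo ≤ m * n ∧ m * n ≤ hi) with hs
  have hconv : ∀ m, ∀ x ∈ s m, ∀ z ∈ s m, ∀ y, x ≤ y → y ≤ z → y ∈ s m := by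
    intro m x hx z hz y hxy hyz
    simp only [hs, Finset.mem_filter, Finset.mem_Icc] at hx hz ⊢
    have := Nat.mul_le_mul_left m hxy
    have := Nat.mul_le_mul_left m hyz
    omega
  have hsum : ∀ m ∈ Finset.Ico M (2 * M), (∑ n ∈ Finset.Icc 1 hi,
      if lo ≤ m * n ∧ m * n ≤ hi then e (((m * n : ℕ) : ℝ) ^ 2 * α) else 0) =
      ∑ n ∈ s m, e ((n : ℝ) ^ 2 * ((m : ℝ) ^ 2 * α)) := by
    intro m hm
    have hm1 := (Finset.mem_Ico.mp hm).1
    rw [← Finset.sum_filter]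
    refine Finset.sum_congr ?_ fun n _ => ?_
    · ext n
      simp only [hs, Finset.mem_filter, Finset.mem_Icc]
      constructor
      · rintro ⟨⟨h1, h2⟩, h3, h4⟩
        refine ⟨⟨h1, Nat.le_floor ?_⟩, h3, h4⟩
        rw [le_div_iff₀ hMpos]
        calc (n : ℝ) * M ≤ n * m := by gcongr
          _ = ((m * n : ℕ) : ℝ) := by push_cast; ring
          _ ≤ hi := by exact_mod_cast h4
          _ ≤ N := hhi
      · rintro ⟨⟨h1, h2⟩, h3, h4⟩
        exact ⟨⟨h1, by nlinarith⟩, h3, h4⟩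
    · congr 1
      push_cast; ring
  rw [Finset.sum_congr rfl (fun m hm => by rw [hsum m hm])]
  rcases le_total (M : ℝ) (P ^ 2) with hcase | hcase
  · refine (h.sum_norm_linear_le_of_le hM hcase s (fun _ => Finset.filter_subset _ _) hconv).trans ?_
    have : D ≤ D ^ 3 := le_self_pow₀ (by linarith) (by norm_num)
    gcongr
    norm_num
  · exact h.sum_norm_linear_le_of_ge hcase hMP s (fun _ => Finset.filter_subset _ _) hconv

end MinorArc

section Separation
variable {ι κ : Type*} (I : Finset ι) (J : Finset κ) (Φ : ι → κ → ℂ) (B : ℝ)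

theorem norm_sum_ite_eq_le
    (hB : ∀ (a : ι → ℂ) (b : κ → ℂ), (∀ i, ‖a i‖ ≤ 1) → (∀ j, ‖b j‖ ≤ 1) →
      ‖∑ i ∈ I, ∑ j ∈ J, a i * b j * Φ i j‖ ≤ B) (K : ℕ) :
    ∀ (x : ι → ℕ) (y : κ → ℕ), (∀ i ∈ I, x i < 2 ^ K) → (∀ j ∈ J, y j < 2 ^ K) →
    ∀ (a : ι → ℂ) (b : κ → ℂ), (∀ i, ‖a i‖ ≤ 1) → (∀ j, ‖b j‖ ≤ 1) →
    ‖∑ i ∈ I, ∑ j ∈ J, (if x i = y j then a i * b j * Φ i j else 0)‖ ≤ B := by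
  induction K with
  | zero =>
    intro x y hx hy a b ha hb
    refine (le_of_eq ?_).trans (hB a b ha hb)
    congr 1
    refine Finset.sum_congr rfl fun i hi => Finset.sum_congr rfl fun j hj => ?_
    have := hx i hi
    have := hy j hj
    rw [if_pos (by omega)]
  | succ K ih =>
    intro x y hx hy a b ha hb
    have hx' : ∀ i ∈ I, x i / 2 < 2 ^ K := fun i hi => by have := hx i hi; omega
    have hy' : ∀ j ∈ J, y j / 2 < 2 ^ K := fun j hj => by have := hy j hj; omega
    have h1 := ih (fun i => x i / 2) (fun j => y j / 2) hx' hy' a b ha hb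
    have h2 := ih (fun i => x i / 2) (fun j => y j / 2) hx' hy' (fun i => a i * (-1) ^ x i)
      (fun j => b j * (-1) ^ y j) (by simpa using ha) (by simpa using hb)
    have h3 : ∑ i ∈ I, ∑ j ∈ J, (if x i = y j then a i * b j * Φ i j else 0) =
        1 / 2 * ∑ i ∈ I, ∑ j ∈ J, (if x i / 2 = y j / 2 then a i * b j * Φ i j else 0) +
        1 / 2 * ∑ i ∈ I, ∑ j ∈ J, (if x i / 2 = y j / 2 then
          a i * (-1) ^ x i * (b j * (-1) ^ y j) * Φ i j else 0) := by
      simp only [Finset.mul_sum, ← Finset.sum_add_distrib]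
      refine Finset.sum_congr rfl fun i _ => Finset.sum_congr rfl fun j _ => ?_
      by_cases h4 : x i / 2 = y j / 2
      · rw [if_pos h4, if_pos h4]
        by_cases h5 : x i = y j
        · rw [if_pos h5, h5]
          have : ((-1 : ℂ) ^ y j) * (-1) ^ y j = 1 := by rw [← mul_pow]; norm_num
          linear_combination (-(1 / 2) * a i * b j * Φ i j) * this
        · rw [if_neg h5]
          have h6 : Odd (x i + y j) := by rw [Nat.odd_iff]; omega
          have : ((-1 : ℂ) ^ x i) * (-1) ^ y j = -1 := by rw [← pow_add]; exact h6.neg_one_pow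
          linear_combination (-(1 / 2) * a i * b j * Φ i j) * this
      · rw [if_neg h4, if_neg h4, if_neg (fun h => h4 (by rw [h]))]
        ring
    rw [h3]
    refine (norm_add_le _ _).trans ?_
    rw [norm_mul, norm_mul]
    norm_num
    linarith

theorem norm_sum_ite_lt_le
    (hB : ∀ (a : ι → ℂ) (b : κ → ℂ), (∀ i, ‖a i‖ ≤ 1) → (∀ j, ‖b j‖ ≤ 1) →
      ‖∑ i ∈ I, ∑ j ∈ J, a i * b j * Φ i j‖ ≤ B) (K : ℕ) :
    ∀ (x : ι → ℕ) (y : κ → ℕ), (∀ i ∈ I, x i < 2 ^ K) → (∀ j ∈ J, y j < 2 ^ K) →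
    ∀ (a : ι → ℂ) (b : κ → ℂ), (∀ i, ‖a i‖ ≤ 1) → (∀ j, ‖b j‖ ≤ 1) →
    ‖∑ i ∈ I, ∑ j ∈ J, (if x i < y j then a i * b j * Φ i j else 0)‖ ≤ K * B := by
  induction K with
  | zero =>
    intro x y hx hy a b ha hb
    rw [Finset.sum_eq_zero, norm_zero]
    · simp
    · intro i hi
      refine Finset.sum_eq_zero fun j hj => ?_
      have := hx i hi
      have := hy j hj
      rw [if_neg (by omega)]
  | succ K ih =>
    intro x y hx hy a b ha hb
    have hx' : ∀ i ∈ I, x i / 2 < 2 ^ K := fun i hi => by have := hx i hi; omega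
    have hy' : ∀ j ∈ J, y j / 2 < 2 ^ K := fun j hj => by have := hy j hj; omega
    have h1 := ih (fun i => x i / 2) (fun j => y j / 2) hx' hy' a b ha hb
    have h2 := norm_sum_ite_eq_le I J Φ B hB K (fun i => x i / 2) (fun j => y j / 2) hx' hy'
      (fun i => if x i % 2 = 0 then a i else 0) (fun j => if y j % 2 = 1 then b j else 0)
      (fun i => by split_ifs <;> simp [ha])
      (fun j => by split_ifs <;> simp [hb])
    have h3 : ∑ i ∈ I, ∑ j ∈ J, (if x i < y j then a i * b j * Φ i j else 0) =
        ∑ i ∈ I, ∑ j ∈ J, (if x i / 2 < y j / 2 then a i * b j * Φ i j else 0) +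
        ∑ i ∈ I, ∑ j ∈ J, (if x i / 2 = y j / 2 then
          (if x i % 2 = 0 then a i else 0) * (if y j % 2 = 1 then b j else 0) * Φ i j else 0) := by
      simp only [← Finset.sum_add_distrib]
      refine Finset.sum_congr rfl fun i _ => Finset.sum_congr rfl fun j _ => ?_
      rcases lt_trichotomy (x i / 2) (y j / 2) with h4 | h4 | h4
      · rw [if_pos (by omega), if_pos h4, if_neg (by omega), add_zero]
      · rw [if_neg (show ¬ x i / 2 < y j / 2 by omega), if_pos h4, zero_add]
        by_cases h5 : x i % 2 = 0
        · by_cases h6 : y j % 2 = 1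
          · rw [if_pos (by omega), if_pos h5, if_pos h6]
          · rw [if_neg (by omega), if_neg h6]; simp
        · rw [if_neg (by omega), if_neg h5]; simp
      · rw [if_neg (by omega), if_neg (by omega), if_neg (by omega), add_zero]
    rw [h3]
    refine (norm_add_le _ _).trans ?_
    push_cast
    linarith

end Separation

/-- No final segment of `s` satisfies the stopping rule. -/
def NeverStops (Stop : Finset ℕ → Prop) (s : Finset ℕ) : Prop :=
  ∀ p, ¬ Stop (s.filter (p ≤ ·))

/-- The whole set `s` is the shortest final segment satisfying the stopping rule. -/
def FirstStop (Stop : Finset ℕ → Prop) (s : Finset ℕ) : Prop :=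
  Stop s ∧ ∀ p, s.filter (p ≤ ·) ≠ s → ¬ Stop (s.filter (p ≤ ·))

/-- Buchstab's identity, iterated by removing primes in decreasing order until a stopping rule
is met. -/
theorem ite_empty_eq_sum_stopping (S : Finset ℕ) (Stop : Finset ℕ → Prop) :
    (if S = ∅ then (1 : ℂ) else 0) = ∑ s ∈ S.powerset, (-1) ^ s.card *
      ((if NeverStops Stop s then 1 else 0) +
        if FirstStop Stop s ∧ ∀ x ∈ S, ∃ y ∈ s, y ≤ x then 1 else 0) := by
  rcases S.eq_empty_or_nonempty with rfl | hne
  · by_cases h : Stop ∅ <;> simp [NeverStops, FirstStop, h]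
  · set x := S.min' hne with hx
    have hxS : x ∈ S := S.min'_mem hne
    rw [if_neg hne.ne_empty]
    rw [← Finset.insert_erase hxS, Finset.sum_powerset_insert (Finset.notMem_erase x S),
      ← Finset.sum_add_distrib, eq_comm]
    refine Finset.sum_eq_zero fun s hs => ?_
    rw [Finset.insert_erase hxS]
    have hlt : ∀ y ∈ s, x < y := by
      intro y hy
      have h1 := Finset.mem_erase.mp (Finset.mem_powerset.mp hs hy)
      exact lt_of_le_of_ne (S.min'_le y h1.2) h1.1.symm
    have hxs : x ∉ s := fun h => lt_irrefl _ (hlt x h)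
    have hfs : ∀ p, p ≤ x → s.filter (p ≤ ·) = s := fun p hp =>
      Finset.filter_true_of_mem fun y hy => hp.trans (hlt y hy).le
    have hfi : ∀ p, p ≤ x → (insert x s).filter (p ≤ ·) = insert x s := fun p hp =>
      Finset.filter_true_of_mem fun y hy => by
        rcases Finset.mem_insert.mp hy with rfl | hy
        · exact hp
        · exact hp.trans (hlt y hy).le
    have hfi' : ∀ p, x < p → (insert x s).filter (p ≤ ·) = s.filter (p ≤ ·) := fun p hp => by
      rw [Finset.filter_insert, if_neg (not_le.mpr hp)]
    have hfx : s.filter (x + 1 ≤ ·) = s := Finset.filter_true_of_mem fun y hy => hlt y hy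
    have hT : NeverStops Stop (insert x s) ↔ NeverStops Stop s ∧ ¬ Stop (insert x s) := by
      constructor
      · intro h
        refine ⟨fun p => ?_, hfi x le_rfl ▸ h x⟩
        rcases le_or_gt p x with hp | hp
        · rw [hfs p hp]
          have h1 := h (x + 1)
          rwa [hfi' _ (Nat.lt_succ_self x), Nat.succ_eq_add_one, hfx] at h1
        · exact hfi' p hp ▸ h p
      · rintro ⟨h1, h2⟩ p
        rcases le_or_gt p x with hp | hp
        · rwa [hfi p hp]
        · rw [hfi' p hp]; exact h1 p
    have hF : FirstStop Stop (insert x s) ↔ NeverStops Stop s ∧ Stop (insert x s) := by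
      constructor
      · rintro ⟨h1, h2⟩
        refine ⟨fun p => ?_, h1⟩
        have h3 : ∀ p, x < p → ¬ Stop (s.filter (p ≤ ·)) := by
          intro p hp
          rw [← hfi' p hp]
          refine h2 p fun h => ?_
          have h4 : x ∈ (insert x s).filter (p ≤ ·) := by rw [h]; exact Finset.mem_insert_self x s
          exact absurd (Finset.mem_filter.mp h4).2 (not_le.mpr hp)
        rcases le_or_gt p x with hp | hp
        · rw [hfs p hp]
          have h4 := h3 (x + 1) (Nat.lt_succ_self x)
          rwa [hfx] at h4
        · exact h3 p hp
      · rintro ⟨h1, h2⟩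
        refine ⟨h2, fun p hp => ?_⟩
        rcases le_or_gt p x with hp' | hp'
        · exact absurd (hfi p hp') hp
        · rw [hfi' p hp']; exact h1 p
    have hR : ∀ y ∈ S, ∃ z ∈ insert x s, z ≤ y := fun y hy =>
      ⟨x, Finset.mem_insert_self x s, S.min'_le y hy⟩
    have hR' : ¬ ∀ y ∈ S, ∃ z ∈ s, z ≤ y := fun h => by
      obtain ⟨z, hz, hzx⟩ := h x hxS
      exact absurd (hlt z hz) (not_lt.mpr hzx)
    have hR1 := iff_true_intro hR
    have hR2 := iff_false_intro hR'
    simp only [Finset.card_insert_of_notMem hxs, pow_succ, hT, hF, hR1, hR2]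
    by_cases h1 : NeverStops Stop s <;> by_cases h2 : Stop (insert x s) <;>
      simp [h1, h2]

/-- The product of the elements of `s` that are at least `a`. -/
def tailProd (s : Finset ℕ) (a : ℕ) : ℕ := ∏ x ∈ s.filter (a ≤ ·), x

theorem tailProd_of_mem {s : Finset ℕ} {a : ℕ} (ha : a ∈ s) :
    tailProd s a = a * tailProd s (a + 1) := by
  have h1 : s.filter (a ≤ ·) = insert a (s.filter (a + 1 ≤ ·)) := by
    ext y
    simp only [Finset.mem_filter, Finset.mem_insert]
    constructor
    · rintro ⟨h1, h2⟩
      rcases eq_or_lt_of_le h2 with h2 | h2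
      · exact Or.inl h2.symm
      · exact Or.inr ⟨h1, h2⟩
    · rintro (rfl | hy)
      · exact ⟨ha, le_rfl⟩
      · exact ⟨hy.1, by omega⟩
  rw [tailProd, h1, Finset.prod_insert (by simp), tailProd]

theorem tailProd_of_notMem {s : Finset ℕ} {a : ℕ} (ha : a ∉ s) :
    tailProd s a = tailProd s (a + 1) := by
  rw [tailProd, tailProd]
  congr 1
  refine Finset.filter_congr fun x hx => ⟨fun h => ?_, fun h => by omega⟩
  have : x ≠ a := fun h' => ha (h' ▸ hx)
  omega

theorem tailProd_eq_one {s : Finset ℕ} {a : ℕ} (ha : ∀ x ∈ s, x < a) : tailProd s a = 1 := by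
  rw [tailProd, Finset.filter_false_of_mem (fun x hx => not_le.mpr (ha x hx)), Finset.prod_empty]

theorem tailProd_peel (s : Finset ℕ) (a : ℕ) :
    tailProd s a = 1 ∨ ∃ p ∈ s, a ≤ p ∧ tailProd s a = p * tailProd s (p + 1) := by
  by_cases hex : ∃ p, p ∈ s ∧ a ≤ p
  · right
    obtain ⟨hp, hap⟩ := Nat.find_spec hex
    refine ⟨Nat.find hex, hp, hap, ?_⟩
    rw [← tailProd_of_mem hp, tailProd, tailProd]
    congr 1
    exact Finset.filter_congr fun x hx => ⟨fun h => Nat.find_min' hex ⟨hx, h⟩, hap.trans⟩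
  · push Not at hex
    exact Or.inl (tailProd_eq_one hex)

/-- The ranges in which a divisor can be used for the bilinear estimate. -/
def IsTypeII (w x : ℝ) : Prop := (w ^ 2 ≤ x ∧ x ≤ w ^ 3) ∨ (w ^ 4 ≤ x ∧ x ≤ w ^ 5)

/-- If no final segment of `s` gives a Type II divisor, then `d ∏ s` is small enough for the
linear estimate. -/
theorem mul_prod_lt_of_neverStops {w z y : ℝ} (hw : 1 ≤ w) (hz0 : 0 < z) (hz : z ^ 3 = w ^ 5)
    {d : ℕ} (hd4 : (d : ℝ) < w ^ 4)
    (hd : (d = 1 ∧ y = z) ∨ (z ≤ d ∧ (d : ℝ) < w ^ 2 ∧ 0 ≤ y ∧ y ≤ z ∧ y ^ 2 * d = w ^ 5) ∨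
      (w ^ 2 ≤ (d : ℝ) ∧ (d : ℝ) ≤ w ^ 3) ∨ (w ^ 3 < (d : ℝ) ∧ y * d = w ^ 5))
    (s : Finset ℕ) (hs : ∀ p ∈ s, 0 < p ∧ (p : ℝ) < y)
    (hT : NeverStops (fun t => IsTypeII w ((d * ∏ p ∈ t, p : ℕ) : ℝ)) s) :
    ((d * ∏ p ∈ s, p : ℕ) : ℝ) < w ^ 4 := by
  have hw0 : 0 < w := by linarith
  have hgpos : ∀ a, (1 : ℝ) ≤ tailProd s a := by
    intro a
    have : 0 < tailProd s a := Finset.prod_pos fun p hp => (hs p (Finset.mem_filter.mp hp).1).1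
    exact_mod_cast this
  have hT' : ∀ a, ¬ IsTypeII w (d * tailProd s a) := by
    intro a
    have h1 := hT a
    push_cast at h1
    rw [tailProd]
    push_cast
    exact h1
  have hII : ∀ a, ¬ (w ^ 2 ≤ (d : ℝ) * tailProd s a ∧ (d : ℝ) * tailProd s a ≤ w ^ 3) :=
    fun a h => hT' a (Or.inl h)
  have hII' : ∀ a, ¬ (w ^ 4 ≤ (d : ℝ) * tailProd s a ∧ (d : ℝ) * tailProd s a ≤ w ^ 5) :=
    fun a h => hT' a (Or.inr h)
  have hd1 : (1 : ℝ) ≤ d := by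
    rcases hd with h | h | h | h
    · simp [h.1]
    · have : (0 : ℝ) < d := by linarith
      exact_mod_cast this
    · exact (one_le_pow₀ hw).trans h.1
    · exact (one_le_pow₀ hw).trans h.1.le
  by_contra hcon
  rw [not_lt] at hcon
  have h0 : w ^ 4 ≤ (d : ℝ) * tailProd s 0 := by
    refine hcon.trans_eq ?_
    rw [tailProd, Finset.filter_true_of_mem (by simp)]
    push_cast; ring
  have hbig : tailProd s (s.sup id + 1) = 1 := by
    rcases tailProd_peel s (s.sup id + 1) with h | ⟨p, hp, hp1, -⟩
    · exact h
    · have : id p ≤ s.sup id := Finset.le_sup hp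
      simp only [id] at this
      omega
  have hex : ∃ a, (d : ℝ) * tailProd s a < w ^ 4 := ⟨s.sup id + 1, by rw [hbig]; simpa using hd4⟩
  have hspec := Nat.find_spec hex
  have hpos : Nat.find hex ≠ 0 := fun h => by rw [h] at hspec; linarith
  obtain ⟨a, ha⟩ := Nat.exists_eq_succ_of_ne_zero hpos
  have hmin := Nat.find_min hex (m := a) (by omega)
  rw [ha] at hspec
  rw [not_lt] at hmin
  rw [Nat.succ_eq_add_one] at hspec
  have has : a ∈ s := by
    by_contra h
    rw [tailProd_of_notMem h] at hmin
    linarith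
  have haa := tailProd_of_mem has
  set G : ℝ := (tailProd s (a + 1) : ℝ) with hG
  have hmul : (tailProd s a : ℝ) = a * G := by rw [haa]; push_cast; rfl
  have hay : (a : ℝ) < y := (hs a has).2
  have ha0 : (0 : ℝ) < a := by exact_mod_cast (hs a has).1
  have hG1 : 1 ≤ G := hgpos _
  have hbig5 : w ^ 5 < d * (a * G) := by
    rw [← hmul]
    by_contra h
    exact hII' a ⟨hmin, not_lt.mp h⟩
  have haw : w < a := by
    by_contra h
    rw [not_lt] at h
    have h1 : d * (a * G) ≤ w * w ^ 4 := by
      calc d * (a * G) = a * (d * G) := by ring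
        _ ≤ w * w ^ 4 := mul_le_mul h hspec.le (by positivity) hw0.le
    have h2 : w * w ^ 4 = w ^ 5 := by ring
    linarith
  have hw12 : w ≤ w ^ 2 := le_self_pow₀ hw (by norm_num)
  have hw23 : w ^ 2 ≤ w ^ 3 := pow_le_pow_right₀ hw (by norm_num)
  have hdy : y * d = w ^ 5 → G ≠ 1 := by
    intro h hG1
    rw [hG1, mul_one] at hbig5
    nlinarith
  have hcaseA : (d : ℝ) < w ^ 2 → y ≤ z → ∃ p ∈ s, a + 1 ≤ p ∧ ∃ b : ℕ, p + 1 = b ∧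
      G = p * tailProd s b ∧ (d : ℝ) * tailProd s b < w ^ 2 ∧ w < p := by
    intro hdw hyz
    have hz2 : z ≤ w ^ 2 := by
      refine le_of_pow_le_pow_left₀ (n := 3) (by norm_num) (by positivity) ?_
      rw [hz, ← pow_mul]
      exact pow_le_pow_right₀ hw (by norm_num)
    have hdG : w ^ 3 < d * G := by
      by_contra h
      rw [not_lt] at h
      have h1 : d * (a * G) ≤ w ^ 2 * w ^ 3 := by
        calc d * (a * G) = a * (d * G) := by ring
          _ ≤ w ^ 2 * w ^ 3 := mul_le_mul (by linarith) h (by positivity) (by positivity)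
      have h2 : w ^ 2 * w ^ 3 = w ^ 5 := by ring
      linarith
    rcases tailProd_peel s (a + 1) with h | ⟨p, hp, hap, hpp⟩
    · rw [hG, h] at hdG
      push_cast at hdG
      linarith
    · have hap' : (a : ℝ) ≤ p := by exact_mod_cast (Nat.le_succ a).trans hap
      have hpG : G = p * tailProd s (p + 1) := by rw [hG, hpp]; push_cast; rfl
      refine ⟨p, hp, hap, p + 1, rfl, hpG, ?_, by linarith⟩
      by_contra h
      rw [not_lt] at h
      refine hII (p + 1) ⟨h, ?_⟩
      by_contra h3
      rw [not_le] at h3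
      have h1 : w * w ^ 3 ≤ p * (d * tailProd s (p + 1)) :=
        mul_le_mul (by linarith) h3.le (by positivity) (by positivity)
      rw [hpG] at hspec
      have h2 : w * w ^ 3 = w ^ 4 := by ring
      linarith
  rcases hd with ⟨h1, h2⟩ | ⟨h1, h2, h3, h4, h5⟩ | ⟨h1, h2⟩ | ⟨h1, h2⟩
  · have hz1 : 1 ≤ z := by
      by_contra h
      have h4 : z ^ 3 < 1 := pow_lt_one₀ hz0.le (not_le.mp h) (by norm_num)
      have h5 : 1 ≤ w ^ 5 := one_le_pow₀ hw
      linarith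
    have hdR : (d : ℝ) = 1 := by exact_mod_cast h1
    rw [h2] at hay
    by_cases hw1 : w = 1
    · subst hw1
      rw [hdR] at hd4
      norm_num at hd4
    have hwgt : 1 < w := lt_of_le_of_ne hw (Ne.symm hw1)
    have hd2 : (d : ℝ) < w ^ 2 := by rw [hdR]; exact one_lt_pow₀ hwgt (by norm_num)
    obtain ⟨p, hp, hap, b, hb, hpG, hsmall, hwp⟩ := hcaseA hd2 h2.le
    have hpz : (p : ℝ) < z := h2 ▸ (hs p hp).2
    rw [hdR, one_mul] at hbig5 hsmall
    rw [hpG] at hbig5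
    rcases tailProd_peel s b with h | ⟨p', hp', hap', hpp'⟩
    · rw [h, Nat.cast_one, mul_one] at hbig5
      have h6 : (a : ℝ) * p ≤ z * z := mul_le_mul hay.le hpz.le (by positivity) hz0.le
      nlinarith
    · have hp'z : (p' : ℝ) < z := h2 ▸ (hs p' hp').2
      have hpp'' : (p : ℝ) ≤ p' := by exact_mod_cast (show p ≤ p' by omega)
      rw [hpp'] at hbig5 hsmall
      push_cast at hbig5 hsmall
      rcases tailProd_peel s (p' + 1) with h | ⟨r, hr, har, hrr⟩
      · rw [h, Nat.cast_one, mul_one] at hbig5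
        have h6 : (a : ℝ) * (p * p') ≤ z * (z * z) := by gcongr
        have h7 : z * (z * z) = w ^ 5 := by rw [← hz]; ring
        linarith
      · have hr' : (p' : ℝ) ≤ r := by exact_mod_cast (show p' ≤ r by omega)
        have h6 : (r : ℝ) ≤ tailProd s (p' + 1) := by
          rw [hrr]; push_cast
          exact le_mul_of_one_le_right (by positivity) (hgpos _)
        have h7 : w * w ≤ p' * tailProd s (p' + 1) := by
          apply mul_le_mul <;> linarith
        nlinarith
  · obtain ⟨p, hp, hap, b, hb, hpG, hsmall, hwp⟩ := hcaseA h2 h4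
    have hpy : (p : ℝ) < y := (hs p hp).2
    have hwz : w ≤ z := by
      refine le_of_pow_le_pow_left₀ (n := 3) (by norm_num) (by positivity) ?_
      rw [hz]
      exact pow_le_pow_right₀ hw (by norm_num)
    rcases tailProd_peel s b with h | ⟨p', hp', hap', hpp'⟩
    · rw [hpG, h, Nat.cast_one, mul_one] at hbig5
      have h6 : (a : ℝ) * p ≤ y * y := mul_le_mul hay.le hpy.le (by positivity) (by linarith)
      have h7 : d * ((a : ℝ) * p) ≤ d * (y * y) := by gcongr
      linarith
    · have hpp'' : (p : ℝ) ≤ p' := by exact_mod_cast (show p ≤ p' by omega)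
      have h6 : (p' : ℝ) ≤ tailProd s b := by
        rw [hpp']; push_cast
        exact le_mul_of_one_le_right (by positivity) (hgpos _)
      have h7 : w * w ≤ d * tailProd s b := by
        apply mul_le_mul <;> linarith
      linarith
  · refine hII (s.sup id + 1) ?_
    rw [hbig]
    simpa using ⟨h1, h2⟩
  · have hGne := hdy h2
    rcases tailProd_peel s (a + 1) with h | ⟨p, hp, hap, hpp⟩
    · exact hGne (by rw [hG, h]; simp)
    · have hap' : (a : ℝ) ≤ p := by exact_mod_cast (Nat.le_succ a).trans hap
      have h6 : (p : ℝ) ≤ G := by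
        rw [hG, hpp]; push_cast
        exact le_mul_of_one_le_right (by positivity) (hgpos _)
      have h7 : w ^ 3 * w ≤ d * G := mul_le_mul h1.le (by linarith) hw0.le (by linarith)
      have h8 : w ^ 3 * w = w ^ 4 := by ring
      linarith

theorem sum_Icc_eq_sum_dyadic {M : Type*} [AddCommMonoid M] (f : ℕ → M) {hi I : ℕ}
    (hI : hi < 2 ^ I) (hf : ∀ u, hi < u → f u = 0) :
    ∑ u ∈ Finset.Icc 1 hi, f u = ∑ i ∈ Finset.range I, ∑ u ∈ Finset.Ico (2 ^ i) (2 * 2 ^ i), f u := by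
  have h1 : ∀ J : ℕ, ∑ i ∈ Finset.range J, ∑ u ∈ Finset.Ico (2 ^ i) (2 * 2 ^ i), f u =
      ∑ u ∈ Finset.Ico 1 (2 ^ J), f u := by
    intro J
    induction J with
    | zero => simp
    | succ J ih =>
      rw [Finset.sum_range_succ, ih, ← pow_succ', Finset.sum_Ico_consecutive _ Nat.one_le_two_pow
        (Nat.pow_le_pow_right (by norm_num) (Nat.le_succ J))]
  rw [h1]
  refine Finset.sum_subset (fun u hu => ?_) fun u _ hu => hf u ?_
  · rw [Finset.mem_Icc] at hu
    exact Finset.mem_Ico.mpr ⟨hu.1, by omega⟩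
  · rw [Finset.mem_Icc] at hu
    rename_i h
    have := (Finset.mem_Ico.mp h).1
    omega

/-- The summand of `∑ e (m² α)` over `m = u v` in `[lo, hi]`. -/
def rangePhase (lo hi : ℕ) (α : ℝ) (u v : ℕ) : ℂ :=
  if lo ≤ u * v ∧ u * v ≤ hi then e (((u * v : ℕ) : ℝ) ^ 2 * α) else 0

theorem rangePhase_comm (lo hi : ℕ) (α : ℝ) (u v : ℕ) :
    rangePhase lo hi α u v = rangePhase lo hi α v u := by
  rw [rangePhase, rangePhase, mul_comm]

theorem rangePhase_eq_zero {lo hi : ℕ} {α : ℝ} {u v : ℕ} (hv : 1 ≤ v) (hu : hi < u) :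
    rangePhase lo hi α u v = 0 := by
  rw [rangePhase, if_neg]
  rintro ⟨_, h⟩
  have := Nat.le_mul_of_pos_right u hv
  omega

namespace MinorArc
variable {N P D α : ℝ} {q : ℕ}

theorem sum_norm_linear_le (h : MinorArc N P D α q) {lo hi : ℕ} (hhi : (hi : ℝ) ≤ N) :
    ∑ k ∈ Finset.Icc 1 hi, (if k * P ^ 3 ≤ N then
      ‖∑ v ∈ Finset.Icc 1 hi, rangePhase lo hi α k v‖ else 0) ≤ 1500 * D ^ 4 * (N / P) := by
  obtain ⟨I, hI1, hI2⟩ := h.log_le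
  have hD := h.two_le_D
  have hN := h.N_pos
  have hP := h.P_pos
  have hI : hi < 2 ^ (I + 1) := by
    have h1 : (hi : ℝ) ≤ ((2 ^ I : ℕ) : ℝ) := by push_cast; linarith
    have h2 : hi ≤ 2 ^ I := by exact_mod_cast h1
    rw [pow_succ]
    have := Nat.one_le_two_pow (n := I)
    omega
  rw [sum_Icc_eq_sum_dyadic _ hI]
  · refine (Finset.sum_le_card_nsmul _ _ (1500 * D ^ 3 * (N / P)) fun i _ => ?_).trans ?_
    · by_cases hi' : ((2 ^ i : ℕ) : ℝ) * P ^ 3 ≤ N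
      · refine le_trans (Finset.sum_le_sum fun k _ => ?_)
          (h.sum_norm_linear_dyadic_le Nat.one_le_two_pow hi' hhi (lo := lo))
        split_ifs
        · exact le_of_eq rfl
        · exact norm_nonneg _
      · rw [Finset.sum_eq_zero]
        · positivity
        · intro k hk
          rw [if_neg]
          intro hk'
          apply hi'
          refine le_trans ?_ hk'
          have : ((2 ^ i : ℕ) : ℝ) ≤ k := by exact_mod_cast (Finset.mem_Ico.mp hk).1
          gcongr
    · rw [Finset.card_range, nsmul_eq_mul]
      push_cast
      calc ((I : ℝ) + 1) * (1500 * D ^ 3 * (N / P)) ≤ D * (1500 * D ^ 3 * (N / P)) := by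
            gcongr; linarith
        _ = 1500 * D ^ 4 * (N / P) := by ring
  · intro k hk
    rw [Finset.sum_eq_zero fun v hv => rangePhase_eq_zero (Finset.mem_Icc.mp hv).1 hk]
    simp

theorem norm_bilinear_le (h : MinorArc N P D α q) {lo hi : ℕ} (hhi : (hi : ℝ) ≤ N) (A B : ℕ → ℂ)
    (hA : ∀ u, ‖A u‖ ≤ D) (hB : ∀ v, ‖B v‖ ≤ D)
    (hA' : ∀ u, A u ≠ 0 → P ^ 2 ≤ D * u ∧ u * P ^ 4 ≤ N) :
    ‖∑ u ∈ Finset.Icc 1 hi, ∑ v ∈ Finset.Icc 1 hi, A u * B v * rangePhase lo hi α u v‖ ≤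
      10 * D ^ 4 * (N / P) := by
  obtain ⟨I, hI1, hI2⟩ := h.log_le
  have hD := h.two_le_D
  have hN := h.N_pos
  have hP := h.P_pos
  have hI : hi < 2 ^ (I + 1) := by
    have h1 : (hi : ℝ) ≤ ((2 ^ I : ℕ) : ℝ) := by push_cast; linarith
    have h2 : hi ≤ 2 ^ I := by exact_mod_cast h1
    rw [pow_succ]
    have := Nat.one_le_two_pow (n := I)
    omega
  rw [sum_Icc_eq_sum_dyadic _ hI]
  · refine (norm_sum_le _ _).trans ?_
    refine (Finset.sum_le_card_nsmul _ _ (10 * D ^ 3 * (N / P)) fun i _ => ?_).trans ?_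
    · by_cases hex : ∃ u ∈ Finset.Ico (2 ^ i) (2 * 2 ^ i), A u ≠ 0
      · obtain ⟨u, hu, hu0⟩ := hex
        obtain ⟨h1, h2⟩ := hA' u hu0
        rw [Finset.mem_Ico] at hu
        have h3 : ((2 ^ i : ℕ) : ℝ) ≤ u := by exact_mod_cast hu.1
        have h4 : (u : ℝ) ≤ 2 * (2 ^ i : ℕ) := by exact_mod_cast hu.2.le
        refine le_trans (le_of_eq ?_) (h.norm_bilinear_dyadic_le (U := 2 ^ i) Nat.one_le_two_pow
          (le_trans (by gcongr) h2) (h1.trans (by gcongr)) hhi A B hA hB (lo := lo))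
        congr 1
        refine Finset.sum_congr rfl fun u _ => Finset.sum_congr rfl fun v _ => ?_
        rw [rangePhase, mul_ite, mul_zero]
      · push Not at hex
        rw [Finset.sum_eq_zero, norm_zero]
        · positivity
        · intro u hu
          refine Finset.sum_eq_zero fun v _ => ?_
          rw [hex u hu, zero_mul, zero_mul]
    · rw [Finset.card_range, nsmul_eq_mul]
      push_cast
      calc ((I : ℝ) + 1) * (10 * D ^ 3 * (N / P)) ≤ D * (10 * D ^ 3 * (N / P)) := by
            gcongr; linarith
        _ = 10 * D ^ 4 * (N / P) := by ring
  · intro u hu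
    refine Finset.sum_eq_zero fun v hv => ?_
    rw [rangePhase_eq_zero (Finset.mem_Icc.mp hv).1 hu, mul_zero]

end MinorArc

/-- The primes dividing `n` below `y`. -/
def smallPrimes (n : ℕ) (y : ℝ) : Finset ℕ := n.primeFactors.filter fun p => (p : ℝ) < y

theorem psi_eq_ite_smallPrimes {n : ℕ} (hn : n ≠ 0) (y : ℝ) :
    (psi n y : ℂ) = if smallPrimes n y = ∅ then 1 else 0 := by
  have h : (∀ p : ℕ, p.Prime → p ∣ n → y ≤ (p : ℝ)) ↔ smallPrimes n y = ∅ := by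
    rw [smallPrimes, Finset.filter_eq_empty_iff]
    constructor
    · intro h p hp
      exact not_lt.mpr (h p (Nat.prime_of_mem_primeFactors hp) (Nat.dvd_of_mem_primeFactors hp))
    · intro h p hp hpn
      exact not_lt.mp (h (Nat.mem_primeFactors.mpr ⟨hp, hpn, hn⟩))
  rw [psi]
  simp only [h]
  split_ifs <;> simp

/-- The divisor attached to a pair of `d` and a set of primes. -/
def pairProd (t : ℕ × Finset ℕ) : ℕ := t.1 * ∏ p ∈ t.2, p

/-- The pairs of `d ∈ Ds` and a set of primes below `y d` with `d ∏ p ≤ hi`. -/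
def sievePairs (Ds : Finset ℕ) (y : ℕ → ℝ) (hi : ℕ) : Finset (ℕ × Finset ℕ) :=
  (Ds ×ˢ ((Finset.range (hi + 1)).filter Nat.Prime).powerset).filter fun t =>
    (∀ p ∈ t.2, (p : ℝ) < y t.1) ∧ pairProd t ≤ hi

theorem prod_primes_dvd_of_subset {s : Finset ℕ} {n : ℕ} (h : s ⊆ n.primeFactors) :
    ∏ p ∈ s, p ∣ n :=
  Finset.prod_primes_dvd n (fun _ hp => (Nat.prime_of_mem_primeFactors (h hp)).prime)
    fun _ hp => Nat.dvd_of_mem_primeFactors (h hp)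

theorem mem_sievePairs_iff {Ds : Finset ℕ} {y : ℕ → ℝ} {hi : ℕ} {t : ℕ × Finset ℕ} :
    t ∈ sievePairs Ds y hi ↔ t.1 ∈ Ds ∧ (∀ p ∈ t.2, p ≤ hi ∧ p.Prime ∧ (p : ℝ) < y t.1) ∧
      pairProd t ≤ hi := by
  rw [sievePairs, Finset.mem_filter, Finset.mem_product, Finset.mem_powerset]
  constructor
  · rintro ⟨⟨h1, h2⟩, h3, h4⟩
    refine ⟨h1, fun p hp => ?_, h4⟩
    have h5 := Finset.mem_filter.mp (h2 hp)
    exact ⟨by have := Finset.mem_range.mp h5.1; omega, h5.2, h3 p hp⟩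
  · rintro ⟨h1, h2, h3⟩
    refine ⟨⟨h1, fun p hp => ?_⟩, fun p hp => (h2 p hp).2.2, h3⟩
    exact Finset.mem_filter.mpr ⟨Finset.mem_range.mpr (by have := (h2 p hp).1; omega),
      (h2 p hp).2.1⟩

theorem mem_sievePairs_and_dvd_iff {Ds : Finset ℕ} {y : ℕ → ℝ} {hi m : ℕ} (hm : 1 ≤ m)
    (hmhi : m ≤ hi) {t : ℕ × Finset ℕ} :
    t ∈ sievePairs Ds y hi ∧ pairProd t ∣ m ↔
      (t.1 ∈ Ds ∧ t.1 ∣ m) ∧ t.2 ⊆ smallPrimes (m / t.1) (y t.1) := by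
  rw [mem_sievePairs_iff]
  constructor
  · rintro ⟨⟨h1, h2, -⟩, h4⟩
    have h5 : t.1 ∣ m := dvd_of_mul_right_dvd h4
    refine ⟨⟨h1, h5⟩, fun p hp => ?_⟩
    have h6 : p ∣ m / t.1 := (Finset.dvd_prod_of_mem _ hp).trans (Nat.dvd_div_of_mul_dvd h4)
    have h7 : m / t.1 ≠ 0 := (Nat.div_pos (Nat.le_of_dvd hm h5) (Nat.pos_of_dvd_of_pos h5 hm)).ne'
    exact Finset.mem_filter.mpr ⟨Nat.mem_primeFactors.mpr ⟨(h2 p hp).2.1, h6, h7⟩, (h2 p hp).2.2⟩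
  · rintro ⟨⟨h1, h2⟩, h3⟩
    have h4 : pairProd t ∣ m := by
      rw [pairProd]
      exact Nat.mul_dvd_of_dvd_div h2
        (prod_primes_dvd_of_subset (h3.trans (Finset.filter_subset _ _)))
    refine ⟨⟨h1, fun p hp => ?_, (Nat.le_of_dvd hm h4).trans hmhi⟩, h4⟩
    have h5 := Finset.mem_filter.mp (h3 hp)
    have h6 := Nat.le_of_dvd hm ((Nat.dvd_of_mem_primeFactors h5.1).trans (Nat.div_dvd_of_dvd h2))
    exact ⟨h6.trans hmhi, Nat.prime_of_mem_primeFactors h5.1, h5.2⟩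

theorem pairProd_pos {Ds : Finset ℕ} {y : ℕ → ℝ} {hi : ℕ} (hd : ∀ d ∈ Ds, 0 < d)
    {t : ℕ × Finset ℕ} (ht : t ∈ sievePairs Ds y hi) : 1 ≤ pairProd t := by
  obtain ⟨h1, h2, -⟩ := mem_sievePairs_iff.mp ht
  exact Nat.mul_pos (hd _ h1) (Finset.prod_pos fun p hp => (h2 p hp).2.1.pos)

/-- The number of pairs with a given product is bounded by the divisor function. -/
theorem card_pairProd_fiber_le {Ds : Finset ℕ} {y : ℕ → ℝ} {hi : ℕ} (hd : ∀ d ∈ Ds, 0 < d)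
    (E : Finset (ℕ × Finset ℕ)) (hE : E ⊆ sievePairs Ds y hi) {k : ℕ} (hk : 1 ≤ k) :
    (E.filter (fun t => pairProd t = k)).card ≤ k.divisors.card := by
  refine Finset.card_le_card_of_injOn (fun t => t.1) (fun t ht => ?_) ?_
  · have h1 := (Finset.mem_filter.mp (Finset.mem_coe.mp ht)).2
    exact Finset.mem_coe.mpr (Nat.mem_divisors.mpr ⟨⟨_, h1.symm⟩, by omega⟩)
  · rintro ⟨d, s⟩ h1 ⟨d', s'⟩ h2 (rfl : d = d')
    obtain ⟨h3, h4⟩ := Finset.mem_filter.mp (Finset.mem_coe.mp h1)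
    obtain ⟨h5, h6⟩ := Finset.mem_filter.mp (Finset.mem_coe.mp h2)
    obtain ⟨h7, h8, -⟩ := mem_sievePairs_iff.mp (hE h3)
    obtain ⟨-, h9, -⟩ := mem_sievePairs_iff.mp (hE h5)
    have h10 : ∏ p ∈ s, p = ∏ p ∈ s', p :=
      Nat.eq_of_mul_eq_mul_left (hd d h7) (h4.trans h6.symm)
    rw [← Nat.primeFactors_prod (s := s) (fun p hp => (h8 p hp).2.1), h10,
      Nat.primeFactors_prod (s := s') (fun p hp => (h9 p hp).2.1)]

theorem sum_Icc_ite_dvd {lo hi k : ℕ} (hlo : 1 ≤ lo) (hk : 1 ≤ k) (f : ℕ → ℂ) :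
    ∑ m ∈ Finset.Icc lo hi, (if k ∣ m then f m else 0) =
      ∑ v ∈ Finset.Icc 1 hi, if lo ≤ k * v ∧ k * v ≤ hi then f (k * v) else 0 := by
  rw [← Finset.sum_filter, ← Finset.sum_filter]
  refine Finset.sum_nbij' (fun m => m / k) (fun v => k * v) ?_ ?_ ?_ ?_ ?_
  · intro m hm
    obtain ⟨h1, v, rfl⟩ := Finset.mem_filter.mp hm
    rw [Finset.mem_Icc] at h1
    rw [Nat.mul_div_cancel_left _ hk, Finset.mem_filter, Finset.mem_Icc]
    have h2 : 1 ≤ v := Nat.pos_of_ne_zero fun h => by subst h; omega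
    exact ⟨⟨h2, (Nat.le_mul_of_pos_left v hk).trans h1.2⟩, h1⟩
  · intro v hv
    obtain ⟨-, h2⟩ := Finset.mem_filter.mp hv
    exact Finset.mem_filter.mpr ⟨Finset.mem_Icc.mpr h2, dvd_mul_right k v⟩
  · intro m hm
    exact Nat.mul_div_cancel' (Finset.mem_filter.mp hm).2
  · intro v _
    exact Nat.mul_div_cancel_left _ hk
  · intro m hm
    rw [Nat.mul_div_cancel' (Finset.mem_filter.mp hm).2]

theorem sum_sieve_eq_sum_sievePairs {Ds : Finset ℕ} {y : ℕ → ℝ} {lo hi : ℕ} (hlo : 1 ≤ lo)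
    (hd : ∀ d ∈ Ds, 0 < d) (f : ℕ × Finset ℕ → ℕ → ℂ) :
    ∑ m ∈ Finset.Icc lo hi, ∑ d ∈ Ds.filter (· ∣ m),
      ∑ s ∈ (smallPrimes (m / d) (y d)).powerset, f (d, s) m =
    ∑ t ∈ sievePairs Ds y hi, ∑ v ∈ Finset.Icc 1 hi,
      if lo ≤ pairProd t * v ∧ pairProd t * v ≤ hi then f t (pairProd t * v) else 0 := by
  have h1 : ∀ m ∈ Finset.Icc lo hi, ∑ d ∈ Ds.filter (· ∣ m),
      ∑ s ∈ (smallPrimes (m / d) (y d)).powerset, f (d, s) m =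
      ∑ t ∈ sievePairs Ds y hi, if pairProd t ∣ m then f t m else 0 := by
    intro m hm
    rw [Finset.mem_Icc] at hm
    rw [← Finset.sum_filter, Finset.sum_sigma']
    refine Finset.sum_nbij' (fun t => (t.1, t.2)) (fun t => ⟨t.1, t.2⟩) ?_ ?_ ?_ ?_ ?_
    · intro t ht
      rw [Finset.mem_sigma, Finset.mem_filter, Finset.mem_powerset] at ht
      exact Finset.mem_filter.mpr ((mem_sievePairs_and_dvd_iff (by omega) hm.2).mpr ht)
    · intro t ht
      rw [Finset.mem_sigma, Finset.mem_filter, Finset.mem_powerset]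
      exact (mem_sievePairs_and_dvd_iff (by omega) hm.2).mp (Finset.mem_filter.mp ht)
    · intro t _; rfl
    · intro t _; rfl
    · intro t _; rfl
  rw [Finset.sum_congr rfl h1, Finset.sum_comm]
  exact Finset.sum_congr rfl fun t ht => sum_Icc_ite_dvd hlo (pairProd_pos hd ht) (f t)

/-- The smallest element of `s`, or `y` when `s` is empty. -/
def sieveLevel (y : ℕ → ℝ) (t : ℕ × Finset ℕ) : ℕ :=
  if h : t.2.Nonempty then t.2.min' h else ⌈y t.1⌉₊

/-- The least prime factor plus one, or `top` for `v = 1`. -/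
def roughness (top v : ℕ) : ℕ := if v = 1 then top else v.minFac + 1

theorem forall_exists_le_iff_sieveLevel_lt {Ds : Finset ℕ} {y : ℕ → ℝ} {hi : ℕ}
    (hd : ∀ d ∈ Ds, 0 < d) {t : ℕ × Finset ℕ} (ht : t ∈ sievePairs Ds y hi) {v : ℕ} (hv : 1 ≤ v)
    {top : ℕ} (htop : sieveLevel y t < top) :
    (∀ x ∈ smallPrimes (pairProd t * v / t.1) (y t.1), ∃ z ∈ t.2, z ≤ x) ↔
      sieveLevel y t < roughness top v := by
  obtain ⟨h1, h2, -⟩ := mem_sievePairs_iff.mp ht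
  have hs0 : 1 ≤ ∏ p ∈ t.2, p := Finset.prod_pos fun p hp => (h2 p hp).2.1.pos
  have hmem : ∀ x, x ∈ smallPrimes (pairProd t * v / t.1) (y t.1) ↔
      x.Prime ∧ (x ∈ t.2 ∨ x ∣ v) ∧ (x : ℝ) < y t.1 := by
    intro x
    rw [pairProd, mul_assoc, Nat.mul_div_cancel_left _ (hd _ h1), smallPrimes, Finset.mem_filter,
      Nat.mem_primeFactors]
    constructor
    · rintro ⟨⟨h3, h4, -⟩, h5⟩
      refine ⟨h3, ?_, h5⟩
      rcases h3.dvd_mul.mp h4 with h6 | h6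
      · obtain ⟨p, hp, hxp⟩ := (h3.prime.dvd_finsetProd_iff _).mp h6
        rw [(Nat.prime_dvd_prime_iff_eq h3 (h2 p hp).2.1).mp hxp]
        exact Or.inl hp
      · exact Or.inr h6
    · rintro ⟨h3, h4, h5⟩
      refine ⟨⟨h3, ?_, by positivity⟩, h5⟩
      rcases h4 with h4 | h4
      · exact (Finset.dvd_prod_of_mem _ h4).mul_right _
      · exact h4.mul_left _
  have hkey : (∀ x ∈ smallPrimes (pairProd t * v / t.1) (y t.1), ∃ z ∈ t.2, z ≤ x) ↔
      ∀ x : ℕ, x.Prime → x ∣ v → sieveLevel y t ≤ x := by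
    simp only [hmem]
    rw [sieveLevel]
    split_ifs with hne
    · constructor
      · intro h x hx hxv
        rcases lt_or_ge (x : ℝ) (y t.1) with h3 | h3
        · obtain ⟨z, hz, hzx⟩ := h x ⟨hx, Or.inr hxv, h3⟩
          exact (Finset.min'_le _ z hz).trans hzx
        · have h4 := (h2 _ (Finset.min'_mem _ hne)).2.2.le.trans h3
          exact_mod_cast h4
      · rintro h x ⟨hx, hx1 | hx1, -⟩
        · exact ⟨x, hx1, le_rfl⟩
        · exact ⟨_, Finset.min'_mem _ hne, h x hx hx1⟩
    · have hem : t.2 = ∅ := Finset.not_nonempty_iff_eq_empty.mp hne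
      rw [hem]
      simp only [Finset.notMem_empty, false_and, exists_false, false_or, Nat.ceil_le]
      exact ⟨fun h x hx hxv => not_lt.mp fun h3 => h x ⟨hx, hxv, h3⟩,
        fun h x hx => absurd (h x hx.1 hx.2.1) (not_le.mpr hx.2.2)⟩
  rw [hkey, roughness]
  split_ifs with hv1
  · subst hv1
    exact ⟨fun _ => htop, fun _ x hx hx1 => absurd (Nat.dvd_one.mp hx1) hx.ne_one⟩
  · rw [Nat.lt_succ_iff]
    exact ⟨fun h => h _ (Nat.minFac_prime hv1) (Nat.minFac_dvd v),
      fun h x hx hxv => h.trans (Nat.minFac_le_of_dvd hx.two_le hxv)⟩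

namespace MinorArc
variable {N P D α : ℝ} {q : ℕ}

theorem card_pairProd_fiber_le (h : MinorArc N P D α q) {Ds : Finset ℕ} {y : ℕ → ℝ} {hi : ℕ}
    (hhi : (hi : ℝ) ≤ N) (hd : ∀ d ∈ Ds, 0 < d) (E : Finset (ℕ × Finset ℕ))
    (hE : E ⊆ sievePairs Ds y hi) (k : ℕ) :
    ((E.filter (fun t => pairProd t = k)).card : ℝ) ≤ D := by
  by_cases hk : k ∈ Finset.Icc 1 hi
  · rw [Finset.mem_Icc] at hk
    refine le_trans (Nat.cast_le.mpr (_root_.card_pairProd_fiber_le hd E hE hk.1))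
      (h.divisors_le k hk.1 ?_)
    have h1 : (k : ℝ) ≤ hi := by exact_mod_cast hk.2
    nlinarith [h.one_le_N]
  · rw [Finset.filter_false_of_mem, Finset.card_empty]
    · have := h.two_le_D
      simpa using (by linarith : (0 : ℝ) ≤ D)
    · rintro t ht rfl
      exact hk (Finset.mem_Icc.mpr ⟨pairProd_pos hd (hE ht), (mem_sievePairs_iff.mp (hE ht)).2.2⟩)

theorem norm_sum_pairs_linear_le (h : MinorArc N P D α q) {Ds : Finset ℕ} {y : ℕ → ℝ} {lo hi : ℕ}
    (hhi : (hi : ℝ) ≤ N) (hd : ∀ d ∈ Ds, 0 < d) (E : Finset (ℕ × Finset ℕ))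
    (hE : E ⊆ sievePairs Ds y hi) (hEP : ∀ t ∈ E, (pairProd t : ℝ) * P ^ 3 ≤ N)
    (c : ℕ × Finset ℕ → ℂ) (hc : ∀ t, ‖c t‖ ≤ 1) :
    ‖∑ t ∈ E, ∑ v ∈ Finset.Icc 1 hi, c t * rangePhase lo hi α (pairProd t) v‖ ≤
      1500 * D ^ 5 * (N / P) := by
  have hD := h.two_le_D
  set f : ℕ → ℝ := fun k => if k * P ^ 3 ≤ N then
      ‖∑ v ∈ Finset.Icc 1 hi, rangePhase lo hi α k v‖ else 0 with hf
  calc ‖∑ t ∈ E, ∑ v ∈ Finset.Icc 1 hi, c t * rangePhase lo hi α (pairProd t) v‖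
      ≤ ∑ t ∈ E, f (pairProd t) := by
        refine (norm_sum_le _ _).trans (Finset.sum_le_sum fun t ht => ?_)
        rw [← Finset.mul_sum, norm_mul, hf]
        simp only [if_pos (hEP t ht)]
        exact mul_le_of_le_one_left (norm_nonneg _) (hc t)
    _ ≤ D * ∑ k ∈ Finset.Icc 1 hi, f k := by
        refine sum_comp_le_mul_sum E pairProd hi f (fun n => ?_) (fun t ht => ?_) D fun k _ =>
          h.card_pairProd_fiber_le hhi hd E hE k
        · rw [hf]
          positivity
        · exact Finset.mem_Icc.mpr
            ⟨pairProd_pos hd (hE ht), (mem_sievePairs_iff.mp (hE ht)).2.2⟩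
    _ ≤ D * (1500 * D ^ 4 * (N / P)) := by
        gcongr
        exact h.sum_norm_linear_le hhi
    _ = 1500 * D ^ 5 * (N / P) := by ring

theorem norm_sum_pairs_bilinear_le (h : MinorArc N P D α q) {w : ℝ} (hw : 1 ≤ w) (hPw : P ≤ w)
    (hwN : w ^ 7 = N) {Ds : Finset ℕ} {y : ℕ → ℝ} {lo hi : ℕ}
    (hhi : (hi : ℝ) ≤ N) (hloN : N ≤ D * lo) (hd : ∀ d ∈ Ds, 0 < d) (E : Finset (ℕ × Finset ℕ))
    (hE : E ⊆ sievePairs Ds y hi)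
    (hEw : (∀ t ∈ E, w ^ 2 ≤ (pairProd t : ℝ) ∧ (pairProd t : ℝ) ≤ w ^ 3) ∨
      (∀ t ∈ E, w ^ 4 ≤ (pairProd t : ℝ) ∧ (pairProd t : ℝ) ≤ w ^ 5))
    (a : ℕ × Finset ℕ → ℂ) (b : ℕ → ℂ) (ha : ∀ t, ‖a t‖ ≤ 1) (hb : ∀ v, ‖b v‖ ≤ 1) :
    ‖∑ t ∈ E, ∑ v ∈ Finset.Icc 1 hi, a t * b v * rangePhase lo hi α (pairProd t) v‖ ≤
      10 * D ^ 4 * (N / P) := by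
  have hD := h.two_le_D
  have hP := h.P_pos
  set A : ℕ → ℂ := fun k => ∑ t ∈ E.filter (fun t => pairProd t = k), a t with hA
  have hAD : ∀ k, ‖A k‖ ≤ D := by
    intro k
    refine (norm_sum_le _ _).trans ?_
    refine (Finset.sum_le_card_nsmul _ _ 1 fun t _ => ha t).trans ?_
    rw [nsmul_eq_mul, mul_one]
    exact h.card_pairProd_fiber_le hhi hd E hE k
  have hA0 : ∀ k, A k ≠ 0 → ∃ t ∈ E, pairProd t = k := by
    intro k hk
    obtain ⟨t, ht, -⟩ := Finset.exists_ne_zero_of_sum_ne_zero hk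
    exact ⟨t, (Finset.mem_filter.mp ht).1, (Finset.mem_filter.mp ht).2⟩
  have hbD : ∀ v, ‖b v‖ ≤ D := fun v => (hb v).trans (by linarith)
  have hgroup : ∑ t ∈ E, ∑ v ∈ Finset.Icc 1 hi, a t * b v * rangePhase lo hi α (pairProd t) v =
      ∑ u ∈ Finset.Icc 1 hi, ∑ v ∈ Finset.Icc 1 hi, A u * b v * rangePhase lo hi α u v := by
    rw [← Finset.sum_fiberwise_of_maps_to (g := pairProd) (t := Finset.Icc 1 hi) (fun t ht =>
      Finset.mem_Icc.mpr ⟨pairProd_pos hd (hE ht), (mem_sievePairs_iff.mp (hE ht)).2.2⟩)]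
    refine Finset.sum_congr rfl fun u _ => ?_
    rw [Finset.sum_comm]
    refine Finset.sum_congr rfl fun v _ => ?_
    rw [hA]
    simp only [Finset.sum_mul]
    refine Finset.sum_congr rfl fun t ht => ?_
    rw [(Finset.mem_filter.mp ht).2]
  rw [hgroup]
  have hPw4 : P ^ 4 ≤ w ^ 4 := pow_le_pow_left₀ hP.le hPw 4
  have hPw2 : P ^ 2 ≤ w ^ 2 := pow_le_pow_left₀ hP.le hPw 2
  have hw0 : 0 < w := by linarith
  rcases hEw with hEw | hEw
  · refine h.norm_bilinear_le hhi A b hAD hbD fun u hu => ?_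
    obtain ⟨t, ht, rfl⟩ := hA0 u hu
    obtain ⟨h1, h2⟩ := hEw t ht
    constructor
    · nlinarith [pow_pos hw0 2]
    · calc (pairProd t : ℝ) * P ^ 4 ≤ w ^ 3 * w ^ 4 := by gcongr
        _ = N := by rw [← hwN]; ring
  · set b' : ℕ → ℂ := fun v => if P ^ 2 ≤ D * v ∧ v * P ^ 4 ≤ N then b v else 0 with hb'
    have hb'D : ∀ v, ‖b' v‖ ≤ D := by
      intro v
      rw [hb']
      simp only
      split_ifs
      · exact hbD v
      · rw [norm_zero]; linarith
    rw [Finset.sum_comm]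
    refine le_trans (le_of_eq ?_) (h.norm_bilinear_le hhi b' A hb'D hAD (lo := lo) fun v hv => ?_)
    · congr 1
      refine Finset.sum_congr rfl fun v _ => Finset.sum_congr rfl fun u _ => ?_
      rw [rangePhase_comm, mul_comm (A u)]
      by_cases hu : A u = 0
      · rw [hu, mul_zero, zero_mul, mul_zero, zero_mul]
      by_cases hr : lo ≤ v * u ∧ v * u ≤ hi
      · congr 2
        rw [hb']
        simp only
        rw [if_pos]
        obtain ⟨t, ht, rfl⟩ := hA0 u hu
        obtain ⟨h1, h2⟩ := hEw t ht
        have h3 : (lo : ℝ) ≤ v * pairProd t := by exact_mod_cast hr.1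
        have h4 : (v : ℝ) * pairProd t ≤ N := le_trans (by exact_mod_cast hr.2) hhi
        have hv0 : (0 : ℝ) ≤ v := Nat.cast_nonneg v
        constructor
        · have h5 : w ^ 2 * w ^ 5 ≤ D * v * w ^ 5 := by
            calc w ^ 2 * w ^ 5 = N := by rw [← hwN]; ring
              _ ≤ D * (v * pairProd t) := hloN.trans (by gcongr)
              _ ≤ D * (v * w ^ 5) := by gcongr
              _ = D * v * w ^ 5 := by ring
          exact hPw2.trans (le_of_mul_le_mul_right h5 (by positivity))
        · exact le_trans (mul_le_mul_of_nonneg_left (hPw4.trans h1) hv0) h4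
      · rw [rangePhase, if_neg hr, mul_zero, mul_zero]
    · by_contra hcon
      apply hv
      rw [hb']
      simp only
      rw [if_neg hcon]

theorem norm_sum_pairs_level_le (h : MinorArc N P D α q) {w : ℝ} (hw : 1 ≤ w) (hPw : P ≤ w)
    (hwN : w ^ 7 = N) {Ds : Finset ℕ} {y : ℕ → ℝ} {lo hi K : ℕ} (hK : (K : ℝ) ≤ D)
    (hhi : (hi : ℝ) ≤ N) (hloN : N ≤ D * lo) (hd : ∀ d ∈ Ds, 0 < d) (E : Finset (ℕ × Finset ℕ))
    (hE : E ⊆ sievePairs Ds y hi) (hEw : ∀ t ∈ E, IsTypeII w (pairProd t))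
    (hx : ∀ t ∈ E, sieveLevel y t < 2 ^ K) (r : ℕ → ℕ) (hr : ∀ v ∈ Finset.Icc 1 hi, r v < 2 ^ K)
    (c : ℕ × Finset ℕ → ℂ) (hc : ∀ t, ‖c t‖ ≤ 1) :
    ‖∑ t ∈ E, ∑ v ∈ Finset.Icc 1 hi,
      if sieveLevel y t < r v then c t * rangePhase lo hi α (pairProd t) v else 0‖ ≤
      20 * D ^ 5 * (N / P) := by
  have hD := h.two_le_D
  have hNP : 0 < N / P := div_pos h.N_pos h.P_pos
  have key : ∀ E' ⊆ E,
      ((∀ t ∈ E', w ^ 2 ≤ (pairProd t : ℝ) ∧ (pairProd t : ℝ) ≤ w ^ 3) ∨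
      (∀ t ∈ E', w ^ 4 ≤ (pairProd t : ℝ) ∧ (pairProd t : ℝ) ≤ w ^ 5)) →
      ‖∑ t ∈ E', ∑ v ∈ Finset.Icc 1 hi,
        if sieveLevel y t < r v then c t * rangePhase lo hi α (pairProd t) v else 0‖ ≤
      D * (10 * D ^ 4 * (N / P)) := by
    intro E' hE' hE'w
    have h1 := norm_sum_ite_lt_le E' (Finset.Icc 1 hi)
      (fun t v => rangePhase lo hi α (pairProd t) v) (10 * D ^ 4 * (N / P))
      (fun a b ha hb => h.norm_sum_pairs_bilinear_le hw hPw hwN hhi hloN hd E' (hE'.trans hE)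
        hE'w a b ha hb) K (sieveLevel y) r (fun t ht => hx t (hE' ht)) hr c (fun _ => 1) hc
      (by simp)
    simp only [mul_one] at h1
    refine h1.trans ?_
    gcongr
  rw [← Finset.sum_filter_add_sum_filter_not E (fun t => (pairProd t : ℝ) ≤ w ^ 3)]
  refine (norm_add_le _ _).trans ?_
  have h1 := key _ (Finset.filter_subset (fun t => (pairProd t : ℝ) ≤ w ^ 3) E) (Or.inl ?_)
  · have h2 := key _ (Finset.filter_subset (fun t => ¬ (pairProd t : ℝ) ≤ w ^ 3) E) (Or.inr ?_)
    · refine (add_le_add h1 h2).trans (le_of_eq ?_)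
      ring
    · intro t ht
      obtain ⟨h3, h4⟩ := Finset.mem_filter.mp ht
      rcases hEw t h3 with h5 | h5
      · exact absurd h5.2 h4
      · exact h5
  · intro t ht
    obtain ⟨h3, h4⟩ := Finset.mem_filter.mp ht
    rcases hEw t h3 with h5 | h5
    · exact h5
    · exact ⟨(pow_le_pow_right₀ hw (by norm_num)).trans h5.1, h4⟩

/-- The exponential sum over squares, sieved by a combination of `psi`, on a minor arc. -/
theorem norm_sieve_sum_le (h : MinorArc N P D α q) {w : ℝ} (hw : 1 ≤ w) (hPw : P ≤ w)
    (hwN : w ^ 7 = N) {Ds : Finset ℕ} {y : ℕ → ℝ} {lo hi : ℕ} (hlo : 1 ≤ lo)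
    (hhi : (hi : ℝ) ≤ N) (hloN : N ≤ D * lo) (hd : ∀ d ∈ Ds, 0 < d) (hy : ∀ d ∈ Ds, y d ≤ N)
    (hlevel : ∀ d ∈ Ds, ∀ s : Finset ℕ, (∀ p ∈ s, 0 < p ∧ (p : ℝ) < y d) →
      NeverStops (fun t => IsTypeII w ((d * ∏ p ∈ t, p : ℕ) : ℝ)) s →
      ((d * ∏ p ∈ s, p : ℕ) : ℝ) < w ^ 4)
    (σ : ℕ → ℂ) (hσ : ∀ d, ‖σ d‖ ≤ 1) :
    ‖∑ m ∈ Finset.Icc lo hi, (∑ d ∈ Ds.filter (· ∣ m), σ d * (psi (m / d) (y d) : ℂ)) *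
      e ((m : ℝ) ^ 2 * α)‖ ≤ 1520 * D ^ 5 * (N / P) := by
  obtain ⟨I, hI1, hI2⟩ := h.log_le
  have hP := h.P_pos
  have hhiI : hi ≤ 2 ^ I := by
    have h1 : (hi : ℝ) ≤ ((2 ^ I : ℕ) : ℝ) := by push_cast; linarith
    exact_mod_cast h1
  have hpow : 2 ^ I + 2 < 2 ^ (I + 2) := by
    have := Nat.one_le_two_pow (n := I)
    rw [pow_add]
    omega
  set sat : ℕ → Finset ℕ → Prop := fun d t => IsTypeII w ((d * ∏ p ∈ t, p : ℕ) : ℝ) with hsat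
  set c : ℕ × Finset ℕ → ℂ := fun t => σ t.1 * (-1) ^ t.2.card with hc
  have hc1 : ∀ t, ‖c t‖ ≤ 1 := fun t => by simpa [hc] using hσ t.1
  set top := 2 ^ (I + 2) - 1 with htop
  have hx : ∀ t ∈ sievePairs Ds y hi, sieveLevel y t ≤ 2 ^ I := by
    intro t ht
    obtain ⟨h1, h2, -⟩ := mem_sievePairs_iff.mp ht
    rw [sieveLevel]
    split_ifs with hne
    · exact (h2 _ (Finset.min'_mem _ hne)).1.trans hhiI
    · rw [Nat.ceil_le]
      push_cast
      exact (hy _ h1).trans hI1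
  have hr : ∀ v ∈ Finset.Icc 1 hi, roughness top v < 2 ^ (I + 2) := by
    intro v hv
    rw [Finset.mem_Icc] at hv
    rw [roughness]
    have := Nat.minFac_le hv.1
    split_ifs <;> omega
  have hexpand : ∑ m ∈ Finset.Icc lo hi, (∑ d ∈ Ds.filter (· ∣ m), σ d * (psi (m / d) (y d) : ℂ)) *
      e ((m : ℝ) ^ 2 * α) =
      ∑ m ∈ Finset.Icc lo hi, ∑ d ∈ Ds.filter (· ∣ m),
        ∑ s ∈ (smallPrimes (m / d) (y d)).powerset, c (d, s) *
          ((if NeverStops (sat d) s then 1 else 0) +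
          if FirstStop (sat d) s ∧ ∀ x ∈ smallPrimes (m / d) (y d), ∃ z ∈ s, z ≤ x
            then 1 else 0) * e ((m : ℝ) ^ 2 * α) := by
    refine Finset.sum_congr rfl fun m hm => ?_
    rw [Finset.mem_Icc] at hm
    rw [Finset.sum_mul]
    refine Finset.sum_congr rfl fun d hdm => ?_
    obtain ⟨h1, h2⟩ := Finset.mem_filter.mp hdm
    have hmd : m / d ≠ 0 := (Nat.div_pos (Nat.le_of_dvd (by omega) h2) (hd d h1)).ne'
    rw [psi_eq_ite_smallPrimes hmd, ite_empty_eq_sum_stopping _ (sat d), Finset.mul_sum,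
      Finset.sum_mul]
    refine Finset.sum_congr rfl fun s _ => ?_
    rw [hc]
    ring
  have hswap := sum_sieve_eq_sum_sievePairs (lo := lo) (hi := hi) (y := y) hlo hd
    (fun t m => c t * ((if NeverStops (sat t.1) t.2 then 1 else 0) +
          if FirstStop (sat t.1) t.2 ∧ ∀ x ∈ smallPrimes (m / t.1) (y t.1), ∃ z ∈ t.2, z ≤ x
            then 1 else 0) * e ((m : ℝ) ^ 2 * α))
  rw [hexpand, hswap]
  set E₁ := (sievePairs Ds y hi).filter fun t => NeverStops (sat t.1) t.2 with hE₁
  set E₂ := (sievePairs Ds y hi).filter fun t => FirstStop (sat t.1) t.2 with hE₂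
  have hsplit : ∑ t ∈ sievePairs Ds y hi, ∑ v ∈ Finset.Icc 1 hi,
      (if lo ≤ pairProd t * v ∧ pairProd t * v ≤ hi then
        c t * ((if NeverStops (sat t.1) t.2 then 1 else 0) +
          if FirstStop (sat t.1) t.2 ∧
            ∀ x ∈ smallPrimes (pairProd t * v / t.1) (y t.1), ∃ z ∈ t.2, z ≤ x
            then 1 else 0) * e (((pairProd t * v : ℕ) : ℝ) ^ 2 * α) else 0) =
      ∑ t ∈ E₁, ∑ v ∈ Finset.Icc 1 hi, c t * rangePhase lo hi α (pairProd t) v +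
      ∑ t ∈ E₂, ∑ v ∈ Finset.Icc 1 hi, if sieveLevel y t < roughness top v then
        c t * rangePhase lo hi α (pairProd t) v else 0 := by
    rw [hE₁, hE₂, Finset.sum_filter, Finset.sum_filter, ← Finset.sum_add_distrib]
    refine Finset.sum_congr rfl fun t ht => ?_
    have hlev : ∀ v ∈ Finset.Icc 1 hi,
        ((∀ x ∈ smallPrimes (pairProd t * v / t.1) (y t.1), ∃ z ∈ t.2, z ≤ x) ↔
        sieveLevel y t < roughness top v) := fun v hv =>
      forall_exists_le_iff_sieveLevel_lt hd ht (Finset.mem_Icc.mp hv).1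
        (by have := hx t ht; omega)
    have hzero : ∀ Q : Prop, ∀ F : ℕ → ℂ, (if Q then ∑ v ∈ Finset.Icc 1 hi, F v else 0) =
        ∑ v ∈ Finset.Icc 1 hi, if Q then F v else 0 := by
      intro Q F
      split_ifs <;> simp
    rw [hzero, hzero, ← Finset.sum_add_distrib]
    refine Finset.sum_congr rfl fun v hv => ?_
    simp only [hlev v hv, rangePhase]
    by_cases h1 : NeverStops (sat t.1) t.2 <;> by_cases h2 : FirstStop (sat t.1) t.2 <;>
      by_cases h3 : sieveLevel y t < roughness top v <;>
      by_cases h4 : lo ≤ pairProd t * v ∧ pairProd t * v ≤ hi <;>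
      simp only [h1, h2, h3, h4, if_true, if_false, and_self, and_true, and_false,
        mul_zero, zero_mul, add_zero, zero_add] <;> ring
  have hsplit' := hsplit
  push_cast at hsplit' ⊢
  rw [hsplit']
  refine (norm_add_le _ _).trans ?_
  have h1 := h.norm_sum_pairs_linear_le (lo := lo) hhi hd E₁ (Finset.filter_subset _ _)
    (fun t ht => ?_) c hc1
  · have h2 := h.norm_sum_pairs_level_le (lo := lo) hw hPw hwN (K := I + 2) (by push_cast; exact hI2)
      hhi hloN hd E₂ (Finset.filter_subset _ _) (fun t ht => (Finset.mem_filter.mp ht).2.1)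
      (fun t ht => by have := hx t (Finset.filter_subset _ _ ht); omega) (roughness top) hr c hc1
    linarith
  · obtain ⟨h3, h4⟩ := Finset.mem_filter.mp ht
    obtain ⟨h5, h6, -⟩ := mem_sievePairs_iff.mp h3
    have h7 := hlevel _ h5 t.2 (fun p hp => ⟨(h6 p hp).2.1.pos, (h6 p hp).2.2⟩) h4
    calc (pairProd t : ℝ) * P ^ 3 ≤ w ^ 4 * w ^ 3 := by
          gcongr
          exact h7.le
      _ = N := by rw [← hwN]; ring

end MinorArc

/-- The divisor bound. -/
theorem exists_card_divisors_le {ε : ℝ} (hε : 0 < ε) :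
    ∃ C : ℝ, 0 < C ∧ ∀ n : ℕ, 1 ≤ n → (n.divisors.card : ℝ) ≤ C * (n : ℝ) ^ ε := by
  set M : ℝ := 2 ^ (1 / ε) with hM
  set K : ℝ := 1 + 1 / (ε * Real.log 2) with hK
  have hlog : 0 < Real.log 2 := Real.log_pos (by norm_num)
  have hK1 : 1 ≤ K := by
    rw [hK]
    have : 0 < 1 / (ε * Real.log 2) := by positivity
    linarith
  have hlocal : ∀ p a : ℕ, p.Prime → ((a + 1 : ℕ) : ℝ) ≤
      (if (p : ℝ) < M then K else 1) * ((p ^ a : ℕ) : ℝ) ^ ε := by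
    intro p a hp
    have hp2 : (2 : ℝ) ≤ p := by exact_mod_cast hp.two_le
    have hpow : ((p ^ a : ℕ) : ℝ) ^ ε = ((p : ℝ) ^ ε) ^ a := by
      push_cast
      rw [← Real.rpow_natCast, ← Real.rpow_natCast, ← Real.rpow_mul (by linarith),
        ← Real.rpow_mul (by linarith), mul_comm]
    rw [hpow]
    split_ifs with hpM
    · have h1 : 1 + ε * Real.log 2 ≤ (p : ℝ) ^ ε := by
        calc 1 + ε * Real.log 2 ≤ Real.exp (ε * Real.log 2) := by
              rw [add_comm]; exact Real.add_one_le_exp _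
          _ = (2 : ℝ) ^ ε := by rw [Real.rpow_def_of_pos (by norm_num), mul_comm]
          _ ≤ (p : ℝ) ^ ε := Real.rpow_le_rpow (by norm_num) hp2 hε.le
      have h2 : 1 + a * (ε * Real.log 2) ≤ ((p : ℝ) ^ ε) ^ a :=
        (one_add_mul_le_pow (by have := mul_pos hε hlog; linarith) a).trans
          (pow_le_pow_left₀ (by positivity) h1 a)
      have h3 : ((a + 1 : ℕ) : ℝ) ≤ K * (1 + a * (ε * Real.log 2)) := by
        have h4 : K * (1 + a * (ε * Real.log 2)) =
            1 + 1 / (ε * Real.log 2) + a * (ε * Real.log 2) + a := by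
          rw [hK]; field_simp; ring
        rw [h4]
        have h5 : 0 < 1 / (ε * Real.log 2) := by positivity
        have h6 : 0 ≤ a * (ε * Real.log 2) := by positivity
        push_cast
        linarith
      exact h3.trans (by gcongr)
    · rw [one_mul]
      have h1 : (2 : ℝ) ≤ (p : ℝ) ^ ε := by
        calc (2 : ℝ) = M ^ ε := by
              rw [hM, ← Real.rpow_mul (by norm_num), one_div, inv_mul_cancel₀ hε.ne',
                Real.rpow_one]
          _ ≤ (p : ℝ) ^ ε := Real.rpow_le_rpow (by positivity) (not_lt.mp hpM) hε.le
      have h2 : ((a + 1 : ℕ) : ℝ) ≤ 2 ^ a := by exact_mod_cast (Nat.lt_two_pow_self (n := a))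
      exact h2.trans (pow_le_pow_left₀ (by norm_num) h1 a)
  refine ⟨K ^ ⌈M⌉₊, by positivity, fun n hn => ?_⟩
  have hn0 : n ≠ 0 := by omega
  have hprod : (n : ℝ) ^ ε =
      ∏ p ∈ n.primeFactors, ((p ^ n.factorization p : ℕ) : ℝ) ^ ε := by
    rw [Real.finsetProd_rpow _ _ fun _ _ => by positivity, ← Nat.cast_prod]
    congr 2
    exact (Nat.prod_factorization_pow_eq_self hn0).symm
  rw [Nat.card_divisors hn0, hprod]
  push_cast
  calc (∏ p ∈ n.primeFactors, ((n.factorization p : ℝ) + 1))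
      ≤ ∏ p ∈ n.primeFactors, (if (p : ℝ) < M then K else 1) *
          ((p ^ n.factorization p : ℕ) : ℝ) ^ ε := by
        refine Finset.prod_le_prod (fun _ _ => by positivity) fun p hp => ?_
        have := hlocal p (n.factorization p) (Nat.prime_of_mem_primeFactors hp)
        push_cast at this ⊢
        exact this
    _ = K ^ (n.primeFactors.filter fun p : ℕ => (p : ℝ) < M).card *
          ∏ p ∈ n.primeFactors, ((p ^ n.factorization p : ℕ) : ℝ) ^ ε := by
        rw [Finset.prod_mul_distrib, ← Finset.prod_filter, Finset.prod_const]
    _ ≤ K ^ ⌈M⌉₊ * ∏ p ∈ n.primeFactors, ((p ^ n.factorization p : ℕ) : ℝ) ^ ε := by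
        gcongr
        · calc (n.primeFactors.filter fun p : ℕ => (p : ℝ) < M).card
              ≤ (Finset.range ⌈M⌉₊).card := Finset.card_le_card fun p hp =>
                Finset.mem_range.mpr (Nat.lt_ceil.mpr (Finset.mem_filter.mp hp).2)
            _ = ⌈M⌉₊ := Finset.card_range _
    _ = _ := by push_cast; rfl

theorem rpow_div_fourteen_pow {X : ℝ} (hX : 0 ≤ X) (n : ℕ) :
    (X ^ ((1 : ℝ) / 14)) ^ n = X ^ ((n : ℝ) / 14) := by
  rw [← Real.rpow_natCast, ← Real.rpow_mul hX]
  congr 1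
  ring

theorem zfun_cases {X : ℝ} (hX : 1 ≤ X) {d : ℕ} (hd : X ^ ((5 : ℝ) / 42) ≤ d) :
    ((d : ℝ) < (X ^ ((1 : ℝ) / 14)) ^ 2 ∧ 0 ≤ zfun X d ∧ zfun X d ≤ X ^ ((5 : ℝ) / 42) ∧
      zfun X d ^ 2 * d = (X ^ ((1 : ℝ) / 14)) ^ 5) ∨
    ((X ^ ((1 : ℝ) / 14)) ^ 2 ≤ (d : ℝ) ∧ (d : ℝ) ≤ (X ^ ((1 : ℝ) / 14)) ^ 3 ∧ zfun X d = d) ∨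
    ((X ^ ((1 : ℝ) / 14)) ^ 3 < (d : ℝ) ∧ zfun X d * d = (X ^ ((1 : ℝ) / 14)) ^ 5) := by
  have hX0 : 0 < X := by linarith
  have hd0 : (0 : ℝ) < d := lt_of_lt_of_le (by positivity) hd
  have e2 : (X ^ ((1 : ℝ) / 14)) ^ 2 = X ^ ((1 : ℝ) / 7) := by
    rw [rpow_div_fourteen_pow hX0.le]; norm_num
  have e3 : (X ^ ((1 : ℝ) / 14)) ^ 3 = X ^ ((3 : ℝ) / 14) := by
    rw [rpow_div_fourteen_pow hX0.le]; norm_num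
  have e5 : (X ^ ((1 : ℝ) / 14)) ^ 5 = X ^ ((5 : ℝ) / 14) := by
    rw [rpow_div_fourteen_pow hX0.le]; norm_num
  have e23 : X ^ ((1 : ℝ) / 7) ≤ X ^ ((3 : ℝ) / 14) :=
    Real.rpow_le_rpow_of_exponent_le hX (by norm_num)
  rw [e2, e3, e5, zfun]
  split_ifs with h1 h2
  · left
    have hsq : (X ^ ((5 : ℝ) / 28) * (d : ℝ) ^ (-(1 : ℝ) / 2)) ^ 2 * d = X ^ ((5 : ℝ) / 14) := by
      rw [mul_pow, ← Real.rpow_natCast, ← Real.rpow_natCast, ← Real.rpow_mul hX0.le,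
        ← Real.rpow_mul hd0.le]
      norm_num
      rw [Real.rpow_neg_one, mul_assoc, inv_mul_cancel₀ hd0.ne', mul_one]
    refine ⟨h1, by positivity, ?_, hsq⟩
    have h3 : X ^ ((5 : ℝ) / 14) = (X ^ ((5 : ℝ) / 42)) ^ 2 * X ^ ((5 : ℝ) / 42) := by
      rw [← pow_succ, ← Real.rpow_natCast, ← Real.rpow_mul hX0.le]
      norm_num
    refine le_of_pow_le_pow_left₀ (n := 2) (by norm_num) (by positivity) ?_
    refine le_of_mul_le_mul_right ?_ hd0
    rw [hsq, h3]
    gcongr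
  · right; left
    exact ⟨not_lt.mp h1, h2, rfl⟩
  · right; right
    refine ⟨not_le.mp h2, ?_⟩
    rw [mul_assoc, inv_mul_cancel₀ hd0.ne', mul_one]

/-- The values `1` and the primes subtracted in `rho`. -/
def rhoSupport (X : ℝ) : Finset ℕ :=
  insert 1 ((Finset.range (⌈X ^ ((1 : ℝ) / 4)⌉₊ + 1)).filter fun p : ℕ =>
    p.Prime ∧ X ^ ((5 : ℝ) / 42) ≤ (p : ℝ) ∧ (p : ℝ) < X ^ ((1 : ℝ) / 4))

/-- The sieving level attached to an element of `rhoSupport X`. -/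
def rhoLevel (X : ℝ) (d : ℕ) : ℝ := if d = 1 then X ^ ((5 : ℝ) / 42) else zfun X d

theorem rho_eq_sum (X : ℝ) (m : ℕ) :
    (rho X m : ℂ) = ∑ d ∈ (rhoSupport X).filter (· ∣ m),
      (if d = 1 then 1 else -1) * (psi (m / d) (rhoLevel X d) : ℂ) := by
  rw [rhoSupport, Finset.filter_insert, if_pos (one_dvd m), Finset.sum_insert, rho,
    Finset.filter_filter]
  · push_cast
    rw [one_mul, Nat.div_one, rhoLevel, if_pos rfl, sub_eq_add_neg,
      ← Finset.sum_neg_distrib]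
    congr 1
    refine Finset.sum_congr (Finset.filter_congr fun p _ => by tauto) fun p hp => ?_
    have h1 : p ≠ 1 := (Finset.mem_filter.mp hp).2.1.1.ne_one
    rw [if_neg h1, rhoLevel, if_neg h1, neg_one_mul]
  · intro h
    exact (Finset.mem_filter.mp (Finset.mem_filter.mp h).1).2.1.ne_one rfl

theorem mem_rhoSupport {X : ℝ} {d : ℕ} (hd : d ∈ rhoSupport X) :
    d = 1 ∨ d ≠ 1 ∧ 0 < d ∧ X ^ ((5 : ℝ) / 42) ≤ (d : ℝ) ∧ (d : ℝ) < X ^ ((1 : ℝ) / 4) := by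
  rcases Finset.mem_insert.mp hd with h | h
  · exact Or.inl h
  · obtain ⟨-, h1, h2⟩ := Finset.mem_filter.mp h
    exact Or.inr ⟨h1.ne_one, h1.pos, h2⟩

theorem rhoLevel_le {X : ℝ} (hX : 1 ≤ X) {d : ℕ} (hd : d ∈ rhoSupport X) :
    rhoLevel X d ≤ X ^ ((1 : ℝ) / 2) := by
  have hX0 : 0 < X := by linarith
  have h0 : X ^ ((5 : ℝ) / 42) ≤ X ^ ((1 : ℝ) / 2) :=
    Real.rpow_le_rpow_of_exponent_le hX (by norm_num)
  rw [rhoLevel]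
  rcases mem_rhoSupport hd with h | ⟨h1, h2, h3, h4⟩
  · rwa [if_pos h]
  · rw [if_neg h1]
    rcases zfun_cases hX h3 with h | h | h
    · exact h.2.2.1.trans h0
    · rw [h.2.2]
      exact h4.le.trans (Real.rpow_le_rpow_of_exponent_le hX (by norm_num))
    · have h5 : (1 : ℝ) ≤ d := by exact_mod_cast h2
      have h6 : 0 ≤ zfun X d := by
        by_contra hneg
        have h7 : 0 < (X ^ ((1 : ℝ) / 14)) ^ 5 := by positivity
        nlinarith [h.2]
      calc zfun X d ≤ zfun X d * d := le_mul_of_one_le_right h6 h5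
        _ = X ^ ((5 : ℝ) / 14) := by rw [h.2, rpow_div_fourteen_pow hX0.le]; norm_num
        _ ≤ _ := Real.rpow_le_rpow_of_exponent_le hX (by norm_num)

theorem rhoSupport_mul_prod_lt {X : ℝ} (hX : 1 < X) {d : ℕ} (hd : d ∈ rhoSupport X) (s : Finset ℕ)
    (hs : ∀ p ∈ s, 0 < p ∧ (p : ℝ) < rhoLevel X d)
    (hT : NeverStops (fun t => IsTypeII (X ^ ((1 : ℝ) / 14)) ((d * ∏ p ∈ t, p : ℕ) : ℝ)) s) :
    ((d * ∏ p ∈ s, p : ℕ) : ℝ) < (X ^ ((1 : ℝ) / 14)) ^ 4 := by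
  have hX0 : 0 < X := by linarith
  have hw : 1 < X ^ ((1 : ℝ) / 14) := Real.one_lt_rpow hX (by norm_num)
  refine mul_prod_lt_of_neverStops (z := X ^ ((5 : ℝ) / 42)) (y := rhoLevel X d) hw.le
    (by positivity) ?_ ?_ ?_ s hs hT
  · rw [rpow_div_fourteen_pow hX0.le, ← Real.rpow_natCast, ← Real.rpow_mul hX0.le]
    norm_num
  · rcases mem_rhoSupport hd with h | ⟨h1, h2, h3, h4⟩
    · rw [h, Nat.cast_one]
      exact one_lt_pow₀ hw (by norm_num)
    · refine h4.trans_le ?_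
      rw [rpow_div_fourteen_pow hX0.le]
      exact Real.rpow_le_rpow_of_exponent_le hX.le (by norm_num)
  · rcases mem_rhoSupport hd with h | ⟨h1, h2, h3, h4⟩
    · exact Or.inl ⟨h, by rw [rhoLevel, if_pos h]⟩
    · right
      rw [rhoLevel, if_neg h1]
      rcases zfun_cases hX.le h3 with h | h | h
      · exact Or.inl ⟨h3, h⟩
      · exact Or.inr (Or.inl ⟨h.1, h.2.1⟩)
      · exact Or.inr (Or.inr h)

theorem Stilde_eq_sum_Icc {δ X : ℝ} (hX : 1 ≤ X) (α : ℝ) :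
    Stilde δ X α = ∑ m ∈ Finset.Icc ⌈√(δ * X)⌉₊ ⌊√X⌋₊, (rho X m : ℂ) * e ((m : ℝ) ^ 2 * α) := by
  rw [Stilde]
  refine Finset.sum_congr ?_ fun _ _ => rfl
  ext m
  rw [Finset.mem_filter, Finset.mem_range, Finset.mem_Icc, Nat.ceil_le, Nat.le_floor_iff
    (Real.sqrt_nonneg X), Real.sqrt_le_left (Nat.cast_nonneg m),
    Real.le_sqrt (Nat.cast_nonneg m) (by linarith)]
  refine ⟨fun h => h.2, fun h => ⟨?_, h⟩⟩
  have h1 : (m : ℝ) ≤ X := by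
    by_contra hc
    nlinarith [h.2]
  have h2 : (m : ℝ) ≤ (⌈X⌉₊ : ℝ) := h1.trans (Nat.le_ceil X)
  have h3 : m ≤ ⌈X⌉₊ := by exact_mod_cast h2
  omega

theorem MinorArc.norm_Stilde_le {δ X P D α : ℝ} {q : ℕ} (hδ : 0 < δ) (hX : 1 < X)
    (h : MinorArc √X P D α q) (hP : P ≤ X ^ ((1 : ℝ) / 14)) (hD : 1 ≤ D * √δ) :
    ‖Stilde δ X α‖ ≤ 1520 * D ^ 5 * (√X / P) := by
  have hX0 : 0 < X := by linarith
  have hlo : √(δ * X) ≤ (⌈√(δ * X)⌉₊ : ℝ) := Nat.le_ceil _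
  have hD0 := h.two_le_D
  rw [Stilde_eq_sum_Icc hX.le]
  simp only [rho_eq_sum]
  refine h.norm_sieve_sum_le (w := X ^ ((1 : ℝ) / 14)) (Real.one_lt_rpow hX (by norm_num)).le hP
    ?_ (Nat.ceil_pos.mpr (by positivity)) (Nat.floor_le (Real.sqrt_nonneg X)) ?_ (fun d hd => ?_)
    (fun d hd => ?_) (fun d hd s => rhoSupport_mul_prod_lt hX hd s) _ (fun d => ?_)
  · rw [rpow_div_fourteen_pow hX0.le, Real.sqrt_eq_rpow]
    norm_num
  · calc √X ≤ D * √δ * √X := le_mul_of_one_le_left (Real.sqrt_nonneg X) hD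
      _ = D * √(δ * X) := by rw [Real.sqrt_mul hδ.le]; ring
      _ ≤ _ := by gcongr
  · rcases mem_rhoSupport hd with h1 | h1
    · omega
    · exact h1.2.1
  · rw [Real.sqrt_eq_rpow]
    exact rhoLevel_le hX.le hd
  · split_ifs <;> simp

theorem exists_coprime_mul_sub_le (ξ : ℝ) {Q : ℝ} (hQ : 1 ≤ Q) :
    ∃ (a : ℤ) (q : ℕ), 0 < q ∧ IsCoprime a (q : ℤ) ∧ (q : ℝ) ≤ Q ∧ |q * ξ - a| ≤ 1 / Q := by
  have hQ0 : 0 < Q := by linarith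
  obtain ⟨x, hx, hxQ⟩ := Real.exists_rat_abs_sub_le_and_den_le ξ (Nat.floor_pos.mpr hQ)
  have hr0 : (0 : ℝ) < x.den := by exact_mod_cast x.den_pos
  refine ⟨x.num, x.den, x.den_pos, Int.isCoprime_iff_gcd_eq_one.mpr x.reduced,
    (Nat.cast_le.mpr hxQ).trans (Nat.floor_le hQ0.le), ?_⟩
  have h1 : (x.den : ℝ) * ξ - x.num = x.den * (ξ - x) := by
    rw [mul_sub]; congr 1
    rw [Rat.cast_def x]; field_simp
  rw [h1, abs_mul, abs_of_pos hr0]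
  calc x.den * |ξ - x| ≤ x.den * (1 / ((⌊Q⌋₊ + 1) * x.den)) := by gcongr
    _ = 1 / (⌊Q⌋₊ + 1) := by field_simp
    _ ≤ 1 / Q := one_div_le_one_div_of_le hQ0 (Nat.lt_floor_add_one Q).le

theorem exists_le_two_pow_and_le {X η : ℝ} (hX : 1 ≤ X) (hη : 0 < η) (ht : 4 / η + 3 ≤ X ^ (η / 2)) :
    ∃ I : ℕ, √X ≤ 2 ^ I ∧ (I : ℝ) + 2 ≤ X ^ η := by
  have hX0 : 0 < X := by linarith
  obtain ⟨n, hn1, hn2⟩ := exists_nat_pow_near (Real.one_le_sqrt.mpr hX) (one_lt_two (α := ℝ))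
  refine ⟨n + 1, hn2.le, ?_⟩
  have h1 : n * Real.log 2 ≤ Real.log X / 2 := by
    rw [← Real.log_pow, ← Real.log_sqrt hX0.le]
    exact Real.log_le_log (by positivity) hn1
  have h2 : (1 / 2 : ℝ) ≤ Real.log 2 := by have := Real.log_two_gt_d9; linarith
  have h3 : (n : ℝ) ≤ Real.log X := by nlinarith [Nat.cast_nonneg (α := ℝ) n]
  have h4 : Real.log X ≤ X ^ (η / 2) / (η / 2) := Real.log_le_rpow_div hX0.le (by positivity)
  have h5 : X ^ (η / 2) / (η / 2) = 2 / η * X ^ (η / 2) := by field_simp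
  have h6 : X ^ η = X ^ (η / 2) * X ^ (η / 2) := by
    rw [← Real.rpow_add hX0]; congr 1; ring
  have h7 : 0 < 2 / η := by positivity
  have h8 : 4 / η = 2 * (2 / η) := by ring
  push_cast
  rw [h6]
  rw [h5] at h4
  nlinarith

theorem exists_norm_Stilde_le {δ ε : ℝ} (hδ : 0 < δ) (hε : 0 < ε) :
    ∃ X0 : ℝ, 1 < X0 ∧ ∀ X ≥ X0, ∀ Z : ℝ, X ^ ((1 : ℝ) / 2 - 1 / 14 + ε) ≤ Z →
      Z ≤ X ^ ((1 : ℝ) / 2) → ∀ (α : ℝ) (q : ℕ), IsApproxDenom α q →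
      (X ^ ((1 : ℝ) / 2 + ε) / Z) ^ 4 ≤ q → q * (X ^ ((1 : ℝ) / 2 + ε) / Z) ^ 4 ≤ X →
      ‖Stilde δ X α‖ ≤ Z := by
  obtain ⟨C, hC, hdiv⟩ := exists_card_divisors_le (ε := ε / 20) (by positivity)
  have hlim := tendsto_rpow_atTop (y := ε / 20) (by positivity)
  obtain ⟨X1, hX1⟩ := Filter.eventually_atTop.mp
    ((hlim.eventually_ge_atTop (4 / (ε / 10) + 3)).and
      ((hlim.eventually_ge_atTop (C * 16 ^ (ε / 20))).and
      ((hlim.eventually_ge_atTop (1 / √δ)).and (hlim.eventually_ge_atTop 1520))))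
  refine ⟨max X1 2, lt_of_lt_of_le one_lt_two (le_max_right _ _), ?_⟩
  intro X hX Z hZ1 hZ2 α q hq hq1 hq2
  obtain ⟨ht1, ht2, ht3, ht4⟩ := hX1 X ((le_max_left _ _).trans hX)
  have hX2 : 2 ≤ X := (le_max_right _ _).trans hX
  have hX0 : 0 < X := by linarith
  have hX1' : 1 ≤ X := by linarith
  set t := X ^ (ε / 20) with ht
  have htD : X ^ (ε / 10) = t * t := by rw [ht, ← Real.rpow_add hX0]; congr 1; ring
  have htε : X ^ ε = t ^ 20 := by
    rw [ht, ← Real.rpow_natCast, ← Real.rpow_mul hX0.le]; congr 1; push_cast; ring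
  have hZ0 : 0 < Z := lt_of_lt_of_le (by positivity) hZ1
  set P := X ^ ((1 : ℝ) / 2 + ε) / Z with hP
  have hP1 : 1 ≤ P := by
    rw [hP, one_le_div hZ0]
    exact hZ2.trans (Real.rpow_le_rpow_of_exponent_le hX1' (by linarith))
  have hPw : P ≤ X ^ ((1 : ℝ) / 14) := by
    rw [hP, div_le_iff₀ hZ0]
    calc X ^ ((1 : ℝ) / 2 + ε) = X ^ ((1 : ℝ) / 14) * X ^ ((1 : ℝ) / 2 - 1 / 14 + ε) := by
          rw [← Real.rpow_add hX0]; congr 1; ring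
      _ ≤ _ := by gcongr
  have hminor : MinorArc √X P (X ^ (ε / 10)) α q := by
    refine ⟨hP1, ?_, fun k hk1 hk2 => ?_, exists_le_two_pow_and_le hX1' (by positivity) ?_, hq, hq1,
      ?_⟩
    · refine (pow_le_pow_left₀ (by linarith) hPw 7).trans (le_of_eq ?_)
      rw [rpow_div_fourteen_pow hX0.le, Real.sqrt_eq_rpow]
      norm_num
    · rw [Real.sq_sqrt hX0.le] at hk2
      calc (k.divisors.card : ℝ) ≤ C * (k : ℝ) ^ (ε / 20) := hdiv k hk1
        _ ≤ C * (16 * X) ^ (ε / 20) := by gcongr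
        _ = C * 16 ^ (ε / 20) * t := by rw [Real.mul_rpow (by norm_num) hX0.le, mul_assoc]
        _ ≤ t * t := by gcongr
        _ = X ^ (ε / 10) := htD.symm
    · rwa [show ε / 10 / 2 = ε / 20 by ring]
    · rwa [Real.sq_sqrt hX0.le]
  have hδ' : 0 < √δ := Real.sqrt_pos.mpr hδ
  have hDδ : 1 ≤ X ^ (ε / 10) * √δ := by
    rw [div_le_iff₀ hδ'] at ht3
    rw [htD]
    nlinarith
  refine (hminor.norm_Stilde_le hδ (by linarith) hPw hDδ).trans ?_
  have hratio : √X / P = Z / t ^ 20 := by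
    rw [hP, ← htε, Real.rpow_add hX0, Real.sqrt_eq_rpow]
    have : X ^ ((1 : ℝ) / 2) ≠ 0 := by positivity
    field_simp
  have ht0 : 0 < t := by positivity
  have ht10 : 1520 ≤ t ^ 10 := ht4.trans (le_self_pow₀ (by linarith) (by norm_num))
  rw [hratio, htD, mul_div_assoc', div_le_iff₀ (by positivity)]
  calc 1520 * (t * t) ^ 5 * Z ≤ t ^ 10 * (t * t) ^ 5 * Z := by gcongr
    _ = Z * t ^ 20 := by ring

theorem statement11 (δ l : ℝ) (hδ0 : 0 < δ) (hδ1 : δ < 1) (hl : l ≠ 0)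
    (ε : ℝ) (hε : 0 < ε) :
    ∃ C > 0, ∃ X0 : ℝ, ∀ X ≥ X0, ∀ Z : ℝ,
      X ^ ((1 : ℝ) / 2 - 1 / 14 + ε) ≤ Z → Z ≤ X ^ ((1 : ℝ) / 2) →
      ∀ α : ℝ, Z < ‖Stilde δ X (l * α)‖ →
      ∃ a q : ℤ, IsCoprime a q ∧ 1 ≤ q ∧ (q : ℝ) ≤ (X ^ ((1 : ℝ) / 2 + ε) / Z) ^ 4 ∧
        |(q : ℝ) * l * α - (a : ℝ)| ≤ C * X⁻¹ * (X ^ ((1 : ℝ) / 2 + ε) / Z) ^ 4 := by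
  obtain ⟨X0, hX0, hbound⟩ := exists_norm_Stilde_le hδ0 hε
  refine ⟨1, one_pos, X0, fun X hX Z hZ1 hZ2 α hα => ?_⟩
  have hX1 : 1 < X := lt_of_lt_of_le hX0 hX
  have hXpos : 0 < X := by linarith
  have hZ0 : 0 < Z := lt_of_lt_of_le (by positivity) hZ1
  set P := X ^ ((1 : ℝ) / 2 + ε) / Z with hP
  have hP0 : 0 < P := by positivity
  have hP4 : P ^ 4 ≤ X := by
    have h1 : P ≤ X ^ ((1 : ℝ) / 14) := by
      rw [hP, div_le_iff₀ hZ0]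
      calc X ^ ((1 : ℝ) / 2 + ε) = X ^ ((1 : ℝ) / 14) * X ^ ((1 : ℝ) / 2 - 1 / 14 + ε) := by
            rw [← Real.rpow_add hXpos]; congr 1; ring
        _ ≤ _ := by gcongr
    calc P ^ 4 ≤ (X ^ ((1 : ℝ) / 14)) ^ 4 := pow_le_pow_left₀ hP0.le h1 4
      _ = X ^ (((4 : ℕ) : ℝ) / 14) := rpow_div_fourteen_pow hXpos.le 4
      _ ≤ X ^ (1 : ℝ) := Real.rpow_le_rpow_of_exponent_le hX1.le (by norm_num)
      _ = X := Real.rpow_one X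
  obtain ⟨a, q, hq0, hcop, hqQ, happ⟩ := exists_coprime_mul_sub_le (l * α) (Q := X / P ^ 4)
    ((one_le_div (by positivity)).mpr hP4)
  have hq0' : (0 : ℝ) < q := by exact_mod_cast hq0
  refine ⟨a, q, hcop, by exact_mod_cast hq0, ?_, ?_⟩
  · rw [Int.cast_natCast]
    by_contra hlarge
    refine absurd hα (not_lt.mpr (hbound X hX Z hZ1 hZ2 (l * α) q ⟨hq0, a, hcop, ?_⟩
      (not_le.mp hlarge).le ((le_div_iff₀ (by positivity)).mp hqQ)))
    exact happ.trans (one_div_le_one_div_of_le hq0' hqQ)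
  · rw [Int.cast_natCast, mul_assoc]
    refine happ.trans (le_of_eq ?_)
    field_simp

end
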